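/- arXiv:1512.09340 — 3 statements merged into one kernel-verified Lean document; each statement's English description precedes it below -/
import Mathlib

section
/- For every integer q ≥ 2 there exist a σ-finite measure space (X,μ) with μ nonatomic and μ(X) = ∞, and an invertible measure-preserving transformation T of (X,μ), such that: (i) T is weak doubly ergodic; (ii) the Cartesian square T × T is not ergodic with respect to μ × μ; and (iii) T is of (1 − q⁻¹)-type, that is, for every measurable set A with 0 < μ(A) < ∞ one has limsup_{n→∞} μ(A ∩ Tⁿ(A)) = (1 − 1/q)·μ(A) < μ(A). -/
open MeasureTheory Filter Set
open scoped ENNReal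

/-- `T` is weak doubly ergodic with respect to `μ`. -/
def WDE {X : Type*} [MeasurableSpace X] (μ : Measure X) (T : X → X) : Prop :=
  ∀ A B : Set X, MeasurableSet A → MeasurableSet B → 0 < μ A → 0 < μ B →
    ∃ n : ℕ, 1 ≤ n ∧ 0 < μ (A ∩ T^[n] '' A) ∧ 0 < μ (B ∩ T^[n] '' A)

/-- `R` is ergodic with respect to `ν`: invariant sets are null or conull. -/
def IsErgodicT {Y : Type*} [MeasurableSpace Y] (ν : Measure Y) (R : Y → Y) : Prop :=
  ∀ A : Set Y, MeasurableSet A → R ⁻¹' A = A → ν A = 0 ∨ ν Aᶜ = 0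

/-- `T` is of `α`-type with respect to `μ`: for every measurable set of finite positive
measure, `limsup_{n→∞} μ(A ∩ Tⁿ(A)) = α · μ(A)`. -/
def IsAlphaType {X : Type*} [MeasurableSpace X] (μ : Measure X) (T : X → X) (α : ℝ≥0∞) : Prop :=
  ∀ A : Set X, MeasurableSet A → 0 < μ A → μ A < ∞ →
    Filter.limsup (fun n : ℕ => μ (A ∩ T^[n] '' A)) Filter.atTop = α * μ A

open scoped Pointwise Topology

/-- Combinatorial data of a rank-one construction: at stage `n` the column `[-b n, b n]` is copied
at the places listed in `D n`. -/
structure CutData (q : ℕ) where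
  D : ℕ → Finset ℤ
  b : ℕ → ℤ
  one_le_b_zero : 1 ≤ b 0
  two_le_card : ∀ n, 2 ≤ (D n).card
  separated : ∀ n, ∀ d ∈ D n, ∀ d' ∈ D n, d ≠ d' → 4 * b n < |d - d'|
  bound : ∀ n, ∀ d ∈ D n, |d| + b n < b (n + 1)
  spacers : ∀ n, 2 * (((D n).card : ℤ) * (2 * b n + 1)) ≤ 2 * b (n + 1) + 1
  overlap : ∀ n k, 2 * b n < k →
    q * ((D n).filter fun d => ∃ d' ∈ D n, |d - d' - k| ≤ 2 * b n).card ≤ (q - 1) * (D n).card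
  rigid : ∃ᶠ n in atTop, ∃ k : ℕ, n ≤ k ∧
    (q - 1) * (D n).card ≤ q * ((D n).filter fun d : ℤ => d - (k : ℤ) ∈ D n).card
  stairs : ∀ j : ℤ, ∃ᶠ n in atTop, ∃ (s : ℕ) (x y z : Fin s → ℤ) (m : Fin s → ℕ),
    x.Injective ∧ y.Injective ∧ z.Injective ∧ 3 * s = (D n).card ∧
      ∀ t, 1 ≤ m t ∧ x t ∈ D n ∧ y t ∈ D n ∧ z t ∈ D n ∧
        y t = x t + m t ∧ z t = y t + m t + j
  dissociated : ∀ n, 2 ^ (n + 2) * ((D n ×ˢ D n).filter fun p => ∃ x ∈ D n, ∃ y ∈ D n,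
    (y - p.2) - (x - p.1) ≠ 0 ∧ |(y - p.2) - (x - p.1)| ≤ 4 * b n).card ≤ (D n).card ^ 2

namespace CutData

variable {q : ℕ} (c : CutData q)

/-- The column of stage `n`. -/
noncomputable def F (n : ℕ) : Finset ℤ := Finset.Icc (-c.b n) (c.b n)

/-- The positions at stage `m` of the levels which have positions `P` at stage `n`. -/
noncomputable def expand (n m : ℕ) (P : Finset ℤ) : Finset ℤ := P + ∑ i ∈ Finset.Ico n m, c.D i

/-- Sequences of digits. -/
abbrev Digits : Type := ∀ i, {x // x ∈ c.D i}

/-- Points are given by an initial position and a sequence of digits. -/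
structure Space : Type where
  start : ℤ
  digits : c.Digits

variable {c}

/-- The position of a point at stage `n`. -/
def pos (n : ℕ) (z : c.Space) : ℤ := z.start + ∑ i ∈ Finset.range n, (z.digits i : ℤ)

/-- The translation by `k`. -/
def shift (k : ℤ) (z : c.Space) : c.Space := ⟨z.start + k, z.digits⟩

variable (c)

/-- The union of the levels of stage `n` whose positions are in `P`. -/
def level (n : ℕ) (P : Finset ℤ) : Set c.Space := {z | ∃ m, n ≤ m ∧ pos m z ∈ c.expand n m P}

lemma b_lt (n : ℕ) : c.b n < c.b (n + 1) := by
  obtain ⟨d, hd⟩ : (c.D n).Nonempty := Finset.card_pos.1 (by have := c.two_le_card n; omega)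
  have := c.bound n d hd
  have := abs_nonneg d
  omega

lemma lt_b (n : ℕ) : (n : ℤ) < c.b n := by
  induction n with
  | zero => have := c.one_le_b_zero; simpa using by omega
  | succ n ih => have := c.b_lt n; push_cast; omega

lemma mem_F {n : ℕ} {p : ℤ} : p ∈ c.F n ↔ |p| ≤ c.b n := by
  simp [F, abs_le]

lemma expand_self (n : ℕ) (P : Finset ℤ) : c.expand n n P = P := by
  simp [expand]

lemma expand_succ {n m : ℕ} (h : n ≤ m) (P : Finset ℤ) :
    c.expand n (m + 1) P = c.expand n m P + c.D m := by
  rw [expand, expand, Finset.sum_Ico_succ_top h, add_assoc]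

lemma expand_expand {n m l : ℕ} (h : n ≤ m) (h' : m ≤ l) (P : Finset ℤ) :
    c.expand m l (c.expand n m P) = c.expand n l P := by
  rw [expand, expand, expand, add_assoc, Finset.sum_Ico_consecutive _ h h']

lemma expand_union (n m : ℕ) (P Q : Finset ℤ) :
    c.expand n m (P ∪ Q) = c.expand n m P ∪ c.expand n m Q := Finset.union_add

lemma expand_mono (n m : ℕ) {P Q : Finset ℤ} (h : P ⊆ Q) : c.expand n m P ⊆ c.expand n m Q :=
  Finset.add_subset_add_right h

lemma expand_add (n m : ℕ) (k : ℤ) (P : Finset ℤ) :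
    c.expand n m ({k} + P) = {k} + c.expand n m P := add_assoc _ _ _

lemma expand_bound {n m : ℕ} (h : n ≤ m) {P : Finset ℤ} {e : ℤ} (hP : ∀ p ∈ P, |p| ≤ e) :
    ∀ p ∈ c.expand n m P, |p| ≤ e + (c.b m - m) - (c.b n - n) := by
  induction m, h using Nat.le_induction with
  | base => intro p hp; rw [expand_self] at hp; have := hP p hp; omega
  | succ m h ih =>
    intro p hp
    rw [expand_succ c h, Finset.mem_add] at hp
    obtain ⟨u, hu, d, hd, rfl⟩ := hp
    have h1 := ih u hu
    have h2 := c.bound m d hd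
    have h3 := abs_add_le u d
    push_cast
    omega

lemma expand_subset_F {n m : ℕ} (h : n ≤ m) {P : Finset ℤ} (hP : P ⊆ c.F n) :
    c.expand n m P ⊆ c.F m := by
  intro p hp
  have := c.expand_bound h (fun p hp => c.mem_F.1 (hP hp)) p hp
  rw [mem_F]
  omega

lemma eventually_expand_subset_F (n : ℕ) (P : Finset ℤ) :
    ∀ᶠ m in atTop, n ≤ m ∧ c.expand n m P ⊆ c.F m := by
  obtain ⟨e, he⟩ : ∃ e : ℕ, ∀ p ∈ P, |p| ≤ e := by
    refine ⟨∑ p ∈ P, p.natAbs, fun p hp => ?_⟩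
    rw [Int.abs_eq_natAbs]
    exact_mod_cast Finset.single_le_sum (f := Int.natAbs) (fun _ _ => Nat.zero_le _) hp
  filter_upwards [eventually_ge_atTop (n + e)] with m hm
  refine ⟨by omega, fun p hp => ?_⟩
  have h1 := c.expand_bound (by omega) he p hp
  have h2 := c.lt_b n
  rw [mem_F]
  omega

lemma F_add_subset (n : ℕ) : c.F n + c.D n ⊆ c.F (n + 1) := by
  have := c.expand_subset_F (Nat.le_succ n) (Finset.Subset.refl (c.F n))
  rwa [Nat.succ_eq_add_one, expand_succ c le_rfl, expand_self] at this

lemma add_injOn (n : ℕ) {u v d e : ℤ} (hu : u ∈ c.F n) (hv : v ∈ c.F n) (hd : d ∈ c.D n)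
    (he : e ∈ c.D n) (h : u + d = v + e) : u = v ∧ d = e := by
  have hde : d = e := by
    by_contra hne
    have h1 := c.separated n d hd e he hne
    rw [mem_F, abs_le] at hu hv
    have h2 : |d - e| ≤ 2 * c.b n := by rw [abs_le]; omega
    have := c.lt_b n
    omega
  exact ⟨by omega, hde⟩

lemma card_add {n : ℕ} {P E : Finset ℤ} (hP : P ⊆ c.F n) (hE : E ⊆ c.D n) :
    (P + E).card = P.card * E.card := by
  rw [Finset.card_add_iff]
  rintro ⟨u, d⟩ h ⟨v, e⟩ h' heq
  simp only [Set.mem_prod, Finset.mem_coe] at h h' heq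
  obtain ⟨h1, h2⟩ := c.add_injOn n (hP h.1) (hP h'.1) (hE h.2) (hE h'.2) heq
  rw [h1, h2]

lemma mem_add_iff {n : ℕ} {P E : Finset ℤ} (hP : P ⊆ c.F n) (hE : E ⊆ c.D n) {u d : ℤ}
    (hu : u ∈ c.F n) (hd : d ∈ c.D n) : u + d ∈ P + E ↔ u ∈ P ∧ d ∈ E := by
  refine ⟨fun h => ?_, fun h => Finset.add_mem_add h.1 h.2⟩
  obtain ⟨v, hv, e, he, h⟩ := Finset.mem_add.1 h
  obtain ⟨rfl, rfl⟩ := c.add_injOn n (hP hv) hu (hE he) hd h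
  exact ⟨hv, he⟩

lemma expand_sdiff {n m : ℕ} (h : n ≤ m) {P Q : Finset ℤ} (hP : P ⊆ c.F n) (hQ : Q ⊆ c.F n) :
    c.expand n m (P \ Q) = c.expand n m P \ c.expand n m Q := by
  induction m, h using Nat.le_induction with
  | base => simp only [expand_self]
  | succ m h ih =>
    rw [expand_succ c h, expand_succ c h, expand_succ c h, ih]
    have hP' := c.expand_subset_F h hP
    have hQ' := c.expand_subset_F h hQ
    ext p
    rw [Finset.mem_sdiff]
    constructor
    · intro hp
      obtain ⟨u, hu, d, hd, rfl⟩ := Finset.mem_add.1 hp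
      rw [Finset.mem_sdiff] at hu
      refine ⟨Finset.add_mem_add hu.1 hd, fun hp' => hu.2 ?_⟩
      exact ((c.mem_add_iff hQ' subset_rfl (hP' hu.1) hd).1 hp').1
    · rintro ⟨hp, hp'⟩
      obtain ⟨u, hu, d, hd, rfl⟩ := Finset.mem_add.1 hp
      exact Finset.add_mem_add (Finset.mem_sdiff.2
        ⟨hu, fun hu' => hp' (Finset.add_mem_add hu' hd)⟩) hd

lemma card_expand {n m : ℕ} (h : n ≤ m) {P : Finset ℤ} (hP : P ⊆ c.F n) :
    (c.expand n m P).card * ∏ i ∈ Finset.range n, (c.D i).card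
      = P.card * ∏ i ∈ Finset.range m, (c.D i).card := by
  induction m, h using Nat.le_induction with
  | base => rw [expand_self]
  | succ m h ih =>
    rw [expand_succ c h, c.card_add (c.expand_subset_F h hP) subset_rfl, Finset.prod_range_succ,
      mul_right_comm, ih, mul_assoc]

lemma pos_succ (n : ℕ) (z : c.Space) : pos (n + 1) z = pos n z + z.digits n := by
  rw [pos, pos, Finset.sum_range_succ, add_assoc]

lemma pos_mem_expand {n m : ℕ} (h : n ≤ m) (z : c.Space) :
    pos m z ∈ c.expand n m {pos n z} := by
  induction m, h using Nat.le_induction with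
  | base => simp [expand_self]
  | succ m h ih =>
    rw [expand_succ c h, pos_succ]
    exact Finset.add_mem_add ih (z.digits m).2

lemma pos_mem_F {n m : ℕ} (h : n ≤ m) {z : c.Space} (hz : pos n z ∈ c.F n) : pos m z ∈ c.F m :=
  c.expand_subset_F h (Finset.singleton_subset_iff.2 hz) (c.pos_mem_expand h z)

lemma eventually_pos_mem_F (z : c.Space) : ∀ᶠ m in atTop, pos m z ∈ c.F m := by
  filter_upwards [c.eventually_expand_subset_F 0 {pos 0 z}] with m hm
  exact hm.2 (c.pos_mem_expand hm.1 z)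

lemma mem_level_iff_eventually {n : ℕ} {P : Finset ℤ} {z : c.Space} :
    z ∈ c.level n P ↔ ∀ᶠ m in atTop, pos m z ∈ c.expand n m P := by
  constructor
  · rintro ⟨m, hm, h⟩
    filter_upwards [eventually_ge_atTop m] with l hl
    induction l, hl using Nat.le_induction with
    | base => exact h
    | succ l hl ih =>
      rw [expand_succ c (hm.trans hl), pos_succ]
      exact Finset.add_mem_add ih (z.digits l).2
  · intro h
    obtain ⟨m, h1, h2⟩ := (h.and (eventually_ge_atTop n)).exists
    exact ⟨m, h2, h1⟩

lemma level_expand {n m : ℕ} (h : n ≤ m) (P : Finset ℤ) :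
    c.level m (c.expand n m P) = c.level n P := by
  ext z
  rw [mem_level_iff_eventually, mem_level_iff_eventually]
  refine eventually_congr ?_
  filter_upwards [eventually_ge_atTop m] with l hl
  rw [c.expand_expand h hl]

lemma mem_level_iff {n : ℕ} {P : Finset ℤ} (hP : P ⊆ c.F n) {z : c.Space} (hz : pos n z ∈ c.F n) :
    z ∈ c.level n P ↔ pos n z ∈ P := by
  constructor
  · rintro ⟨m, hm, h⟩
    induction m, hm using Nat.le_induction with
    | base => rwa [expand_self] at h
    | succ m hm ih =>
      rw [expand_succ c hm, pos_succ] at h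
      exact ih ((c.mem_add_iff (c.expand_subset_F hm hP) subset_rfl (c.pos_mem_F hm hz)
        (z.digits m).2).1 h).1
  · intro h
    exact ⟨n, le_rfl, by rwa [expand_self]⟩

lemma level_union (n : ℕ) (P Q : Finset ℤ) :
    c.level n (P ∪ Q) = c.level n P ∪ c.level n Q := by
  ext z
  simp only [level, expand_union, Finset.mem_union, Set.mem_union, Set.mem_ofPred_eq,
    and_or_left, exists_or]

lemma level_sdiff {n : ℕ} {P Q : Finset ℤ} (hP : P ⊆ c.F n) (hQ : Q ⊆ c.F n) :
    c.level n (P \ Q) = c.level n P \ c.level n Q := by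
  ext z
  obtain ⟨m, hz, hm⟩ := ((c.eventually_pos_mem_F z).and (eventually_ge_atTop n)).exists
  rw [← c.level_expand hm, ← c.level_expand hm, ← c.level_expand hm, Set.mem_sdiff,
    c.mem_level_iff (c.expand_subset_F hm hP) hz, c.mem_level_iff (c.expand_subset_F hm hQ) hz,
    c.mem_level_iff (c.expand_subset_F hm (Finset.sdiff_subset.trans hP)) hz,
    c.expand_sdiff hm hP hQ, Finset.mem_sdiff]

lemma level_mono (n : ℕ) {P Q : Finset ℤ} (h : P ⊆ Q) : c.level n P ⊆ c.level n Q :=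
  fun _ ⟨m, hm, h'⟩ => ⟨m, hm, c.expand_mono n m h h'⟩

lemma level_empty (n : ℕ) : c.level n ∅ = ∅ := by
  ext z; simp [level, expand]

lemma level_inter {n : ℕ} {P Q : Finset ℤ} (hP : P ⊆ c.F n) (hQ : Q ⊆ c.F n) :
    c.level n (P ∩ Q) = c.level n P ∩ c.level n Q := by
  have h : P ∩ Q = P \ (P \ Q) := (sdiff_sdiff_right_self (x := P) (y := Q)).symm
  rw [h, c.level_sdiff hP (Finset.sdiff_subset.trans hP), c.level_sdiff hP hQ]
  exact sdiff_sdiff_right_self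

lemma pos_shift (n : ℕ) (k : ℤ) (z : c.Space) : pos n (shift k z) = k + pos n z := by
  rw [pos, pos, shift, add_comm z.start k, add_assoc]

lemma shift_mem_level {n : ℕ} {k : ℤ} {P : Finset ℤ} {z : c.Space} :
    shift k z ∈ c.level n ({k} + P) ↔ z ∈ c.level n P := by
  have h (e : ℤ) (Q : Finset ℤ) : k + e ∈ {k} + Q ↔ e ∈ Q := by
    simp [Finset.singleton_add, Finset.mem_vadd_finset]
  simp only [level, Set.mem_ofPred_eq, pos_shift, expand_add, h]

end CutData

namespace CutData

open ProbabilityTheory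

variable {q : ℕ} (c : CutData q)

instance : MeasurableSpace c.Space :=
  MeasurableSpace.generateFrom {s | ∃ n P, c.level n P = s}

lemma measurableSet_level (n : ℕ) (P : Finset ℤ) : MeasurableSet (c.level n P) :=
  MeasurableSpace.measurableSet_generateFrom ⟨n, P, rfl⟩

lemma isSetRing_level : IsSetRing {s | ∃ n P, c.level n P = s} := by
  have key (n n' : ℕ) (P P' : Finset ℤ) : ∃ m Q Q', Q ⊆ c.F m ∧ Q' ⊆ c.F m ∧
      c.level n P = c.level m Q ∧ c.level n' P' = c.level m Q' := by
    obtain ⟨m, h, h'⟩ := ((c.eventually_expand_subset_F n P).and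
      (c.eventually_expand_subset_F n' P')).exists
    exact ⟨m, _, _, h.2, h'.2, (c.level_expand h.1 P).symm, (c.level_expand h'.1 P').symm⟩
  refine ⟨⟨0, ∅, c.level_empty 0⟩, ?_, ?_⟩
  · rintro _ _ ⟨n, P, rfl⟩ ⟨n', P', rfl⟩
    obtain ⟨m, Q, Q', -, -, h, h'⟩ := key n n' P P'
    exact ⟨m, Q ∪ Q', by rw [h, h', level_union]⟩
  · rintro _ _ ⟨n, P, rfl⟩ ⟨n', P', rfl⟩
    obtain ⟨m, Q, Q', hQ, hQ', h, h'⟩ := key n n' P P'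
    exact ⟨m, Q \ Q', by rw [h, h', c.level_sdiff hQ hQ']⟩

instance (n : ℕ) : Nonempty {x // x ∈ c.D n} := by
  obtain ⟨d, hd⟩ : (c.D n).Nonempty := Finset.card_pos.1 (by have := c.two_le_card n; omega)
  exact ⟨⟨d, hd⟩⟩

instance (n : ℕ) : IsProbabilityMeasure (uniformOn (univ : Set {x // x ∈ c.D n})) :=
  isProbabilityMeasure_uniformOn finite_univ univ_nonempty

/-- The law of a sequence of independent uniform digits. -/
noncomputable def digitMeasure : Measure c.Digits :=
  Measure.infinitePi fun n => uniformOn (univ : Set {x // x ∈ c.D n})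

instance : IsProbabilityMeasure c.digitMeasure := by
  unfold digitMeasure; infer_instance

lemma digitMeasure_digit {n : ℕ} {d : ℤ} (hd : d ∈ c.D n) :
    c.digitMeasure {y | (y n : ℤ) = d} = ((c.D n).card : ℝ≥0∞)⁻¹ := by
  have h : {y : c.Digits | (y n : ℤ) = d} = Function.eval n ⁻¹' {⟨d, hd⟩} := by
    ext y; simp [Subtype.ext_iff]
  have h' := (measurePreserving_eval_infinitePi
    (fun n => uniformOn (univ : Set {x // x ∈ c.D n})) n).measure_preimage
    (measurableSet_singleton (⟨d, hd⟩ : {x // x ∈ c.D n})).nullMeasurableSet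
  rw [h, digitMeasure, h', uniformOn_univ]
  simp

/-- The point with the given digits and position `p` at stage `n`. -/
def place (n : ℕ) (p : ℤ) (y : c.Digits) : c.Space := ⟨p - ∑ i ∈ Finset.range n, (y i : ℤ), y⟩

lemma pos_place (n : ℕ) (p : ℤ) (y : c.Digits) : pos n (c.place n p y) = p := by
  simp [pos, place]

lemma pos_place_of_le {n m : ℕ} (h : n ≤ m) (p : ℤ) (y : c.Digits) :
    pos m (c.place n p y) = p + ∑ i ∈ Finset.Ico n m, (y i : ℤ) := by
  simp only [pos, place, Finset.sum_Ico_eq_sub _ h]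
  ring

lemma measurable_digit (n : ℕ) : Measurable fun y : c.Digits => (y n : ℤ) :=
  measurable_subtype_coe.comp (measurable_pi_apply n)

lemma measurable_place (n : ℕ) (p : ℤ) : Measurable (c.place n p) := by
  refine measurable_generateFrom ?_
  rintro _ ⟨m, P, rfl⟩
  have h : c.place n p ⁻¹' c.level m P = ⋃ l, ⋃ (_ : m ≤ l),
      (fun y => pos l (c.place n p y)) ⁻¹' (c.expand m l P : Set ℤ) := by
    ext y
    simp [level]
  rw [h]
  refine MeasurableSet.iUnion fun l => MeasurableSet.iUnion fun _ => ?_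
  refine measurableSet_preimage ?_ (Finset.measurableSet _)
  simp only [pos, place]
  have (k : ℕ) := Finset.measurable_sum (Finset.range k) fun i _ => c.measurable_digit i
  exact (measurable_const.sub (this n)).add (this l)

/-- The measure of a level of stage `n`. -/
noncomputable def width (n : ℕ) : ℝ≥0∞ := ((∏ i ∈ Finset.range n, (c.D i).card : ℕ) : ℝ≥0∞)⁻¹

/-- The positions of the spacers added in the construction of the column of stage `n`. -/
noncomputable def spacer : ℕ → Finset ℤ
  | 0 => c.F 0
  | n + 1 => c.F (n + 1) \ (c.F n + c.D n)

/-- The measure giving mass `width n` to the levels of stage `n`. -/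
noncomputable def measure : Measure c.Space :=
  Measure.sum fun n => ∑ p ∈ c.spacer n, c.width n • c.digitMeasure.map (c.place n p)

lemma measure_apply {s : Set c.Space} (hs : MeasurableSet s) :
    c.measure s =
      ∑' n, ∑ p ∈ c.spacer n, c.width n * c.digitMeasure (c.place n p ⁻¹' s) := by
  rw [measure, Measure.sum_apply _ hs]
  refine tsum_congr fun n => ?_
  rw [Measure.finsetSum_apply]
  refine Finset.sum_congr rfl fun p _ => ?_
  rw [Measure.smul_apply, Measure.map_apply (c.measurable_place n p) hs, smul_eq_mul]

lemma spacer_subset (n : ℕ) : c.spacer n ⊆ c.F n := by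
  cases n with
  | zero => exact subset_rfl
  | succ n => exact Finset.sdiff_subset

lemma notMem_expand {n m : ℕ} (h : m < n) {p : ℤ} (hp : p ∈ c.spacer n) {P : Finset ℤ}
    (hP : P ⊆ c.F m) : p ∉ c.expand m n P := by
  cases n with
  | zero => omega
  | succ n =>
    intro hp'
    rw [expand_succ c (by omega)] at hp'
    exact (Finset.mem_sdiff.1 hp).2 (Finset.add_subset_add_right
      (c.expand_subset_F (by omega) hP) hp')

lemma place_mem_level_iff {n m : ℕ} (h : n ≤ m) {p : ℤ} (hp : p ∈ c.F n) {P : Finset ℤ}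
    (hP : P ⊆ c.F m) (y : c.Digits) :
    c.place n p y ∈ c.level m P ↔ p + ∑ i ∈ Finset.Ico n m, (y i : ℤ) ∈ P := by
  rw [c.mem_level_iff hP (c.pos_mem_F h (by rwa [pos_place])), c.pos_place_of_le h]

lemma place_notMem_level {n m : ℕ} (h : m < n) {p : ℤ} (hp : p ∈ c.spacer n) {P : Finset ℤ}
    (hP : P ⊆ c.F m) (y : c.Digits) : c.place n p y ∉ c.level m P := by
  rw [← c.level_expand h.le, c.mem_level_iff (c.expand_subset_F h.le hP)
    (by rw [pos_place]; exact c.spacer_subset n hp), pos_place]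
  exact c.notMem_expand h hp hP

lemma measure_level_spacer {n : ℕ} {p : ℤ} (hp : p ∈ c.spacer n) :
    c.measure (c.level n {p}) = c.width n := by
  have hP : {p} ⊆ c.F n := Finset.singleton_subset_iff.2 (c.spacer_subset n hp)
  rw [measure_apply c (c.measurableSet_level n _), tsum_eq_single n, Finset.sum_eq_single p]
  · have : c.place n p ⁻¹' c.level n {p} = univ := by
      ext y
      simp [c.place_mem_level_iff le_rfl (c.spacer_subset n hp) hP]
    rw [this, measure_univ, mul_one]
  · intro s hs hsp
    have : c.place n s ⁻¹' c.level n {p} = ∅ := by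
      ext y
      simp [c.place_mem_level_iff le_rfl (c.spacer_subset n hs) hP, hsp]
    rw [this, measure_empty, mul_zero]
  · exact fun h => (h hp).elim
  · intro m hm
    refine Finset.sum_eq_zero fun s hs => ?_
    have : c.place m s ⁻¹' c.level n {p} = ∅ := by
      rw [eq_empty_iff_forall_notMem]
      intro y hy
      rcases lt_or_gt_of_ne hm with h | h
      · rw [mem_preimage, c.place_mem_level_iff h.le (c.spacer_subset m hs) hP,
          Finset.mem_singleton, ← c.pos_place_of_le h.le] at hy
        refine c.notMem_expand h hp (Finset.singleton_subset_iff.2 (c.spacer_subset m hs)) ?_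
        rw [← hy]
        simpa [pos_place] using c.pos_mem_expand h.le (c.place m s y)
      · exact c.place_notMem_level h hs hP y hy
    rw [this, measure_empty, mul_zero]

lemma measure_level_add {n : ℕ} {p d : ℤ} (hp : p ∈ c.F n) (hd : d ∈ c.D n) :
    c.measure (c.level (n + 1) {p + d}) = c.measure (c.level n {p}) * ((c.D n).card : ℝ≥0∞)⁻¹ := by
  have hP : {p} ⊆ c.F n := Finset.singleton_subset_iff.2 hp
  have hP' : {p + d} ⊆ c.F (n + 1) :=
    Finset.singleton_subset_iff.2 (c.F_add_subset n (Finset.add_mem_add hp hd))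
  rw [measure_apply c (c.measurableSet_level _ _), measure_apply c (c.measurableSet_level _ _),
    ← ENNReal.tsum_mul_right]
  refine tsum_congr fun m => ?_
  rw [Finset.sum_mul]
  refine Finset.sum_congr rfl fun s hs => ?_
  have hsF := c.spacer_subset m hs
  rw [mul_assoc]
  congr 1
  rcases le_or_gt m n with h | h
  · have h1 : c.place m s ⁻¹' c.level (n + 1) {p + d} =
        c.place m s ⁻¹' c.level n {p} ∩ {y | (y n : ℤ) = d} := by
      ext y
      simp only [mem_preimage, mem_inter_iff, c.place_mem_level_iff h hsF hP,
        c.place_mem_level_iff (h.trans n.le_succ) hsF hP', Finset.mem_singleton, mem_ofPred_eq]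
      rw [Finset.sum_Ico_succ_top h, ← add_assoc]
      refine ⟨fun heq => c.add_injOn n ?_ hp (y n).2 hd heq, fun heq => by rw [heq.1, heq.2]⟩
      rw [← c.pos_place_of_le h]
      exact c.pos_mem_F h (by rwa [pos_place])
    have hind := (iIndepFun_infinitePi (P := fun n => uniformOn (univ : Set {x // x ∈ c.D n}))
      (X := fun n (x : {x // x ∈ c.D n}) => (x : ℤ)) fun _ =>
        measurable_subtype_coe).indepFun_finsetSum_of_notMem c.measurable_digit
      (s := Finset.Ico m n) (i := n) (by simp)
    have h2 : c.place m s ⁻¹' c.level n {p} =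
        (∑ i ∈ Finset.Ico m n, fun y : c.Digits => (y i : ℤ)) ⁻¹' {p - s} := by
      ext y
      simp only [mem_preimage, c.place_mem_level_iff h hsF hP, Finset.mem_singleton,
        Finset.sum_apply, mem_singleton_iff]
      constructor <;> intro <;> omega
    rw [h1, h2, ← c.digitMeasure_digit hd]
    exact hind.measure_inter_preimage_eq_mul {p - s} {d} (measurableSet_singleton _)
      (measurableSet_singleton _)
  · have h1 : c.place m s ⁻¹' c.level n {p} = ∅ :=
      eq_empty_iff_forall_notMem.2 fun y => c.place_notMem_level h hs hP y
    have h2 : c.place m s ⁻¹' c.level (n + 1) {p + d} = ∅ := by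
      refine eq_empty_iff_forall_notMem.2 fun y hy => ?_
      refine c.place_notMem_level h hs hP y ?_
      rw [← c.level_expand n.le_succ, Nat.succ_eq_add_one, expand_succ c le_rfl, expand_self]
      refine c.level_mono _ ?_ hy
      exact Finset.singleton_subset_iff.2 (Finset.add_mem_add (Finset.mem_singleton_self p) hd)
    rw [h1, h2, measure_empty, zero_mul]

end CutData
namespace CutData

variable {q : ℕ} (c : CutData q)

lemma width_ne_zero (n : ℕ) : c.width n ≠ 0 := ENNReal.inv_ne_zero.2 (ENNReal.natCast_ne_top _)

lemma prod_card_pos (n : ℕ) : 0 < ∏ i ∈ Finset.range n, (c.D i).card :=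
  Finset.prod_pos fun i _ => by have := c.two_le_card i; omega

lemma width_ne_top (n : ℕ) : c.width n ≠ ∞ :=
  ENNReal.inv_ne_top.2 (by exact_mod_cast (c.prod_card_pos n).ne')

lemma width_zero : c.width 0 = 1 := by simp [width]

lemma width_succ (n : ℕ) : c.width (n + 1) = c.width n * ((c.D n).card : ℝ≥0∞)⁻¹ := by
  rw [width, width, Finset.prod_range_succ, Nat.cast_mul, ENNReal.mul_inv]
  · right; exact ENNReal.natCast_ne_top _
  · left; exact ENNReal.natCast_ne_top _

lemma width_le (n : ℕ) : c.width n ≤ 2⁻¹ ^ n := by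
  induction n with
  | zero => simp [width_zero]
  | succ n ih =>
    rw [width_succ, pow_succ]
    refine mul_le_mul' ih (ENNReal.inv_le_inv.2 ?_)
    exact_mod_cast c.two_le_card n

lemma tendsto_width : Tendsto c.width atTop (𝓝 0) :=
  tendsto_of_tendsto_of_tendsto_of_le_of_le tendsto_const_nhds
    (ENNReal.tendsto_pow_atTop_nhds_zero_of_lt_one (by simp)) (fun _ => zero_le) c.width_le

lemma width_eq_mul_card (n : ℕ) : c.width n = c.width (n + 1) * (c.D n).card := by
  rw [width_succ, mul_assoc, ENNReal.inv_mul_cancel, mul_one]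
  · have := c.two_le_card n
    exact_mod_cast (by omega : (c.D n).card ≠ 0)
  · exact ENNReal.natCast_ne_top _

lemma measure_level_singleton {n : ℕ} {p : ℤ} (hp : p ∈ c.F n) :
    c.measure (c.level n {p}) = c.width n := by
  induction n generalizing p with
  | zero => exact c.measure_level_spacer hp
  | succ n ih =>
    by_cases h : p ∈ c.F n + c.D n
    · obtain ⟨u, hu, d, hd, rfl⟩ := Finset.mem_add.1 h
      rw [c.measure_level_add hu hd, ih hu, width_succ]
    · exact c.measure_level_spacer (Finset.mem_sdiff.2 ⟨hp, h⟩)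

lemma measure_level {n : ℕ} {P : Finset ℤ} (hP : P ⊆ c.F n) :
    c.measure (c.level n P) = c.width n * P.card := by
  induction P using Finset.induction_on with
  | empty => simp [level_empty]
  | insert p P hp ih =>
    rw [Finset.insert_subset_iff] at hP
    rw [Finset.insert_eq, level_union, measure_union _ (c.measurableSet_level _ _), ih hP.2,
      c.measure_level_singleton hP.1, ← Finset.insert_eq, Finset.card_insert_of_notMem hp]
    · push_cast; ring
    · rw [Set.disjoint_iff_inter_eq_empty,
        ← c.level_inter (Finset.singleton_subset_iff.2 hP.1) hP.2,
        Finset.singleton_inter_of_notMem hp, level_empty]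

lemma measure_level_ne_top (n : ℕ) (P : Finset ℤ) : c.measure (c.level n P) ≠ ∞ := by
  obtain ⟨m, h, h'⟩ := (c.eventually_expand_subset_F n P).exists
  rw [← c.level_expand h, c.measure_level h']
  exact ENNReal.mul_ne_top (c.width_ne_top m) (ENNReal.natCast_ne_top _)

lemma level_F_mono : Monotone fun n => c.level n (c.F n) := by
  intro n m h
  simp only
  rw [← c.level_expand h]
  exact c.level_mono m (c.expand_subset_F h subset_rfl)

lemma iUnion_level_F : ⋃ n, c.level n (c.F n) = univ := by
  refine eq_univ_of_forall fun z => mem_iUnion.2 ?_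
  obtain ⟨m, hm⟩ := (c.eventually_pos_mem_F z).exists
  exact ⟨m, (c.mem_level_iff subset_rfl hm).2 hm⟩

instance : SigmaFinite c.measure :=
  ⟨⟨⟨fun n => c.level n (c.F n), fun _ => trivial,
    fun n => (c.measure_level_ne_top n _).lt_top, c.iUnion_level_F⟩⟩⟩

lemma measure_singleton (z : c.Space) : c.measure {z} = 0 := by
  refine le_antisymm (ge_of_tendsto c.tendsto_width ?_) zero_le
  filter_upwards [c.eventually_pos_mem_F z] with m hm
  rw [← c.measure_level_singleton hm]
  refine measure_mono (Set.singleton_subset_iff.2 ?_)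
  exact (c.mem_level_iff (Finset.singleton_subset_iff.2 hm) hm).2 (Finset.mem_singleton_self _)

lemma card_F (n : ℕ) : ((c.F n).card : ℤ) = 2 * c.b n + 1 := by
  have := c.lt_b n
  rw [F, Int.card_Icc]
  omega

lemma two_mul_measure_level_F_le (n : ℕ) :
    2 * c.measure (c.level n (c.F n)) ≤ c.measure (c.level (n + 1) (c.F (n + 1))) := by
  have h : 2 * ((c.D n).card * (c.F n).card) ≤ (c.F (n + 1)).card := by
    zify
    rw [card_F, card_F]
    exact c.spacers n
  rw [c.measure_level subset_rfl, c.measure_level subset_rfl, c.width_eq_mul_card n]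
  calc 2 * (c.width (n + 1) * (c.D n).card * (c.F n).card)
      = c.width (n + 1) * (2 * ((c.D n).card * (c.F n).card) : ℕ) := by push_cast; ring
    _ ≤ _ := by gcongr

lemma measure_univ_eq_top : c.measure univ = ∞ := by
  have h (n : ℕ) : (2 : ℝ≥0∞) ^ n ≤ c.measure univ := by
    refine le_trans ?_ (measure_mono (subset_univ (c.level n (c.F n))))
    induction n with
    | zero =>
      rw [c.measure_level subset_rfl, width_zero, one_mul, pow_zero]
      have := c.card_F 0
      have := c.one_le_b_zero
      exact_mod_cast (by omega : 1 ≤ (c.F 0).card)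
    | succ n ih =>
      rw [pow_succ, mul_comm]
      exact (mul_le_mul_right ih 2).trans (c.two_mul_measure_level_F_le n)
  refine top_unique (le_of_tendsto' (ENNReal.tendsto_pow_atTop_nhds_top_iff.2 ?_) h)
  norm_num

lemma shift_preimage_level (k : ℤ) (n : ℕ) (P : Finset ℤ) :
    shift k ⁻¹' c.level n P = c.level n ({-k} + P) := by
  ext z
  have h : P = {k} + ({-k} + P) := by
    rw [← add_assoc, Finset.singleton_add_singleton, add_neg_cancel, Finset.singleton_zero,
      zero_add]
  conv_lhs => rw [h]
  exact c.shift_mem_level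

lemma measurable_shift (k : ℤ) : Measurable (shift k : c.Space → c.Space) := by
  refine measurable_generateFrom ?_
  rintro _ ⟨n, P, rfl⟩
  rw [shift_preimage_level]
  exact c.measurableSet_level n ({-k} + P)

variable {c} in
lemma shift_shift (k l : ℤ) (z : c.Space) : shift k (shift l z) = shift (l + k) z := by
  simp [shift, add_assoc]

variable {c} in
lemma shift_zero (z : c.Space) : shift 0 z = z := by
  simp [shift]

/-- The translation by one as a measurable equivalence. -/
def shiftEquiv : c.Space ≃ᵐ c.Space where
  toFun := shift 1
  invFun := shift (-1)
  left_inv z := by simp [shift_shift, shift_zero]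
  right_inv z := by simp [shift_shift, shift_zero]
  measurable_toFun := c.measurable_shift 1
  measurable_invFun := c.measurable_shift (-1)

lemma measure_level_singleton_add (k : ℤ) (n : ℕ) (P : Finset ℤ) :
    c.measure (c.level n ({k} + P)) = c.measure (c.level n P) := by
  obtain ⟨m, h, h'⟩ := ((c.eventually_expand_subset_F n P).and
    (c.eventually_expand_subset_F n ({k} + P))).exists
  rw [← c.level_expand h.1, ← c.level_expand h'.1, c.measure_level h.2, c.measure_level h'.2,
    expand_add]
  simp [Finset.singleton_add]

lemma measurePreserving_shift (k : ℤ) : MeasurePreserving (shift k) c.measure c.measure := by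
  refine ⟨c.measurable_shift k, Eq.symm ?_⟩
  refine Measure.ext_of_generateFrom_of_iUnion _ (fun n => c.level n (c.F n)) rfl
    c.isSetRing_level.isSetSemiring.isPiSystem c.iUnion_level_F (fun n => ⟨n, _, rfl⟩)
    (fun n => c.measure_level_ne_top n _) ?_
  rintro _ ⟨n, P, rfl⟩
  rw [Measure.map_apply (c.measurable_shift k) (c.measurableSet_level n P),
    shift_preimage_level, measure_level_singleton_add]

lemma shiftEquiv_iterate (n : ℕ) : c.shiftEquiv^[n] = shift (n : ℤ) := by
  induction n with
  | zero => ext1 z; simp [shift_zero]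
  | succ n ih =>
    ext1 z
    rw [Function.iterate_succ_apply', ih]
    simp [shiftEquiv, shift_shift]

lemma shiftEquiv_image_eq (n : ℕ) (A : Set c.Space) :
    c.shiftEquiv^[n] '' A = shift (-n : ℤ) ⁻¹' A := by
  rw [shiftEquiv_iterate]
  refine congrFun (Set.image_eq_preimage_of_inverse (fun z => ?_) fun z => ?_) A <;>
    simp [shift_shift, shift_zero]

lemma exists_level_symmDiff_lt {A : Set c.Space} (hA : MeasurableSet A) (hA' : c.measure A ≠ ∞)
    {ε : ℝ≥0∞} (hε : 0 < ε) :
    ∃ n P, P ⊆ c.F n ∧ c.measure (symmDiff A (c.level n P)) < ε := by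
  have hlim : Tendsto (fun n => c.measure (A \ c.level n (c.F n))) atTop (𝓝 0) := by
    have h := tendsto_measure_iInter_atTop (μ := c.measure)
      (s := fun n => A \ c.level n (c.F n))
      (fun n => (hA.diff (c.measurableSet_level _ _)).nullMeasurableSet)
      (fun n m h => sdiff_le_sdiff_left (c.level_F_mono h))
      ⟨0, measure_ne_top_of_subset Set.sdiff_subset hA'⟩
    rwa [← Set.sdiff_iUnion, iUnion_level_F, Set.sdiff_univ, measure_empty] at h
  obtain ⟨n, hn⟩ := (hlim.eventually (gt_mem_nhds (ENNReal.half_pos hε.ne'))).exists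
  set Y := c.level n (c.F n) with hY
  have hYm : MeasurableSet Y := c.measurableSet_level _ _
  have : IsFiniteMeasure (c.measure.restrict Y) :=
    isFiniteMeasure_restrict.2 (c.measure_level_ne_top n _)
  obtain ⟨_, ⟨m, P, rfl⟩, h⟩ := exists_measure_symmDiff_lt_of_generateFrom_isSetRing
    (μ := c.measure.restrict Y) c.isSetRing_level
    ⟨{Y}, countable_singleton _, singleton_subset_iff.2 ⟨n, _, rfl⟩, by
      rw [sUnion_singleton, Measure.restrict_apply hYm.compl, compl_inter_self, measure_empty]⟩
    rfl hA (ENNReal.half_pos hε.ne')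
  obtain ⟨l, h1, h2⟩ := ((c.eventually_expand_subset_F m P).and
    (eventually_ge_atTop n)).exists
  refine ⟨l, c.expand m l P ∩ c.expand n l (c.F n), Finset.inter_subset_left.trans h1.2, ?_⟩
  rw [c.level_inter h1.2 (c.expand_subset_F h2 subset_rfl), level_expand c h1.1,
    level_expand c h2, ← hY]
  rw [Measure.restrict_apply ((c.measurableSet_level _ _).symmDiff hA)] at h
  calc c.measure (symmDiff A (c.level m P ∩ Y))
      ≤ c.measure (symmDiff (c.level m P) A ∩ Y ∪ A \ Y) := by
        refine measure_mono fun z => ?_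
        simp only [Set.mem_symmDiff, mem_inter_iff, mem_union, Set.mem_sdiff]
        tauto
    _ ≤ _ := measure_union_le _ _
    _ < ε / 2 + ε / 2 := ENNReal.add_lt_add h hn
    _ = ε := ENNReal.add_halves ε

end CutData
namespace CutData

variable {q : ℕ} (c : CutData q)

lemma card_inter_expand_le {n m : ℕ} (h : n ≤ m) {P : Finset ℤ} (hP : P ⊆ c.F n) {k : ℤ}
    (hk : 2 * c.b n < k) :
    q * (c.expand n m P ∩ ({k} + c.expand n m P)).card ≤ (q - 1) * (c.expand n m P).card := by
  induction m, h using Nat.le_induction with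
  | base =>
    have : P ∩ ({k} + P) = ∅ := by
      refine Finset.eq_empty_of_forall_notMem fun u hu => ?_
      obtain ⟨hu, hu'⟩ := Finset.mem_inter.1 hu
      obtain ⟨_, hk', v, hv, rfl⟩ := Finset.mem_add.1 hu'
      rw [Finset.mem_singleton.1 hk'] at hu
      have h1 := c.mem_F.1 (hP hu)
      have h2 := c.mem_F.1 (hP hv)
      rw [abs_le] at h1 h2
      omega
    simp [expand_self, this]
  | succ m h ih =>
    rw [expand_succ c h]
    have hF := c.expand_subset_F h hP
    set R := c.expand n m P
    rw [c.card_add hF subset_rfl]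
    by_cases hkm : k ≤ 2 * c.b m
    · have hsub : (R + c.D m) ∩ ({k} + (R + c.D m)) ⊆ (R ∩ ({k} + R)) + c.D m := by
        intro w hw
        obtain ⟨hw, hw'⟩ := Finset.mem_inter.1 hw
        obtain ⟨u, hu, d, hd, rfl⟩ := Finset.mem_add.1 hw
        obtain ⟨_, hk', _, h', heq⟩ := Finset.mem_add.1 hw'
        obtain ⟨v, hv, e, he, rfl⟩ := Finset.mem_add.1 h'
        rw [Finset.mem_singleton.1 hk'] at heq
        have hde : d = e := by
          by_contra hne
          have h1 := c.separated m d hd e he hne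
          have h2 := c.mem_F.1 (hF hu)
          have h3 := c.mem_F.1 (hF hv)
          have h4 := c.lt_b n
          rw [abs_le] at h2 h3
          have h5 : |d - e| ≤ 4 * c.b m := by rw [abs_le]; omega
          omega
        refine Finset.add_mem_add (Finset.mem_inter.2 ⟨hu, ?_⟩) hd
        exact Finset.mem_add.2 ⟨k, Finset.mem_singleton_self k, v, hv, by omega⟩
      calc q * ((R + c.D m) ∩ ({k} + (R + c.D m))).card
          ≤ q * ((R ∩ ({k} + R)).card * (c.D m).card) := by
            refine Nat.mul_le_mul_left q ((Finset.card_le_card hsub).trans ?_)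
            exact Finset.card_add_le
        _ = q * (R ∩ ({k} + R)).card * (c.D m).card := by ring
        _ ≤ (q - 1) * R.card * (c.D m).card := Nat.mul_le_mul_right _ ih
        _ = _ := by ring
    · have hsub : (R + c.D m) ∩ ({k} + (R + c.D m)) ⊆
          R + (c.D m).filter fun d => ∃ d' ∈ c.D m, |d - d' - k| ≤ 2 * c.b m := by
        intro w hw
        obtain ⟨hw, hw'⟩ := Finset.mem_inter.1 hw
        obtain ⟨u, hu, d, hd, rfl⟩ := Finset.mem_add.1 hw
        obtain ⟨_, hk', _, h', heq⟩ := Finset.mem_add.1 hw'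
        obtain ⟨v, hv, e, he, rfl⟩ := Finset.mem_add.1 h'
        rw [Finset.mem_singleton.1 hk'] at heq
        refine Finset.add_mem_add hu (Finset.mem_filter.2 ⟨hd, e, he, ?_⟩)
        have h2 := c.mem_F.1 (hF hu)
        have h3 := c.mem_F.1 (hF hv)
        rw [abs_le] at h2 h3 ⊢
        omega
      calc q * ((R + c.D m) ∩ ({k} + (R + c.D m))).card
          ≤ q * (R.card *
              ((c.D m).filter fun d => ∃ d' ∈ c.D m, |d - d' - k| ≤ 2 * c.b m).card) := by
            refine Nat.mul_le_mul_left q ((Finset.card_le_card hsub).trans ?_)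
            exact Finset.card_add_le
        _ = R.card *
              (q * ((c.D m).filter fun d => ∃ d' ∈ c.D m, |d - d' - k| ≤ 2 * c.b m).card) := by
            ring
        _ ≤ R.card * ((q - 1) * (c.D m).card) :=
            Nat.mul_le_mul_left _ (c.overlap m k (by omega))
        _ = _ := by ring

end CutData

lemma ENNReal.inv_mul_pred {q : ℕ} (hq : 2 ≤ q) :
    (q : ℝ≥0∞)⁻¹ * (q - 1 : ℕ) = 1 - (q : ℝ≥0∞)⁻¹ := by
  have h0 : (q : ℝ≥0∞) ≠ 0 := by exact_mod_cast (by omega : q ≠ 0)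
  refine ENNReal.eq_sub_of_add_eq (ENNReal.inv_ne_top.2 h0) ?_
  calc (q : ℝ≥0∞)⁻¹ * (q - 1 : ℕ) + (q : ℝ≥0∞)⁻¹
      = (q : ℝ≥0∞)⁻¹ * ((q - 1 : ℕ) + 1) := by ring
    _ = (q : ℝ≥0∞)⁻¹ * q := by
      congr 1
      exact_mod_cast (by omega : q - 1 + 1 = q)
    _ = 1 := ENNReal.inv_mul_cancel h0 (ENNReal.natCast_ne_top q)

namespace CutData

variable {q : ℕ} (c : CutData q)

lemma measure_inter_shift_le (hq : 2 ≤ q) {n : ℕ} {P : Finset ℤ} (hP : P ⊆ c.F n) {k : ℤ}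
    (hk : 2 * c.b n < k) :
    c.measure (c.level n P ∩ shift (-k) ⁻¹' c.level n P) ≤
      (1 - (q : ℝ≥0∞)⁻¹) * c.measure (c.level n P) := by
  have h0 : (q : ℝ≥0∞) ≠ 0 := by exact_mod_cast (by omega : q ≠ 0)
  obtain ⟨m, ⟨h, h1⟩, -, h2⟩ := ((c.eventually_expand_subset_F n P).and
    (c.eventually_expand_subset_F n ({k} + P))).exists
  rw [shift_preimage_level, neg_neg, ← c.level_expand h, ← c.level_expand h,
    ← c.level_inter h1 h2, c.measure_level h1, c.measure_level (Finset.inter_subset_left.trans h1),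
    expand_add, ← ENNReal.inv_mul_pred hq]
  calc c.width m * ((c.expand n m P ∩ ({k} + c.expand n m P)).card : ℝ≥0∞)
      = (q : ℝ≥0∞)⁻¹ * q * (c.width m * (c.expand n m P ∩ ({k} + c.expand n m P)).card) := by
        rw [ENNReal.inv_mul_cancel h0 (ENNReal.natCast_ne_top q), one_mul]
    _ = (q : ℝ≥0∞)⁻¹ * c.width m *
        (q * (c.expand n m P ∩ ({k} + c.expand n m P)).card : ℕ) := by push_cast; ring
    _ ≤ (q : ℝ≥0∞)⁻¹ * c.width m * ((q - 1) * (c.expand n m P).card : ℕ) := by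
        exact mul_le_mul' le_rfl (Nat.cast_le.2 (c.card_inter_expand_le h hP hk))
    _ = _ := by push_cast; ring

lemma frequently_le_measure_inter_shift (hq : 2 ≤ q) {n : ℕ} {P : Finset ℤ} (hP : P ⊆ c.F n) :
    ∃ᶠ k : ℕ in atTop, (1 - (q : ℝ≥0∞)⁻¹) * c.measure (c.level n P) ≤
      c.measure (c.level n P ∩ shift (-k : ℤ) ⁻¹' c.level n P) := by
  have h0 : (q : ℝ≥0∞) ≠ 0 := by exact_mod_cast (by omega : q ≠ 0)
  rw [frequently_atTop]
  intro a
  obtain ⟨m, hm, k, hmk, hk⟩ := frequently_atTop.1 c.rigid (max a n)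
  have hnm : n ≤ m := (le_max_right _ _).trans hm
  refine ⟨k, (le_max_left _ _).trans (hm.trans hmk), ?_⟩
  have hF := c.expand_subset_F hnm hP
  set E := (c.D m).filter fun d : ℤ => d - (k : ℤ) ∈ c.D m with hE
  have hED : E ⊆ c.D m := Finset.filter_subset _ _
  have hsub : c.level (m + 1) (c.expand n m P + E) ⊆
      c.level n P ∩ shift (-k : ℤ) ⁻¹' c.level n P := by
    rw [shift_preimage_level, neg_neg, ← c.level_expand (hnm.trans m.le_succ),
      ← c.level_expand (hnm.trans m.le_succ), expand_add, Nat.succ_eq_add_one, expand_succ c hnm]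
    refine subset_inter (c.level_mono _ (Finset.add_subset_add_left hED)) (c.level_mono _ ?_)
    intro w hw
    obtain ⟨u, hu, d, hd, rfl⟩ := Finset.mem_add.1 hw
    have hd' := (Finset.mem_filter.1 hd).2
    exact Finset.mem_add.2 ⟨k, Finset.mem_singleton_self _, _, Finset.add_mem_add hu hd', by ring⟩
  refine le_trans ?_ (measure_mono hsub)
  rw [← c.level_expand hnm, c.measure_level hF,
    c.measure_level ((Finset.add_subset_add_left hED).trans
      ((Finset.add_subset_add_right hF).trans (c.F_add_subset m))), c.card_add hF hED,
    ← ENNReal.inv_mul_pred hq, c.width_eq_mul_card m]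
  set R := c.expand n m P
  calc (q : ℝ≥0∞)⁻¹ * (q - 1 : ℕ) * (c.width (m + 1) * (c.D m).card * R.card)
      = (q : ℝ≥0∞)⁻¹ * c.width (m + 1) * R.card * ((q - 1) * (c.D m).card : ℕ) := by
        push_cast; ring
    _ ≤ (q : ℝ≥0∞)⁻¹ * c.width (m + 1) * R.card * (q * E.card : ℕ) := by
        gcongr
    _ = (q : ℝ≥0∞)⁻¹ * q * (c.width (m + 1) * (R.card * E.card : ℕ)) := by push_cast; ring
    _ = _ := by rw [ENNReal.inv_mul_cancel h0 (ENNReal.natCast_ne_top q), one_mul]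

lemma measure_inter_shift_le_add {A B : Set c.Space} (hA : MeasurableSet A)
    (hB : MeasurableSet B) (k : ℤ) :
    c.measure (A ∩ shift k ⁻¹' A) ≤ c.measure (B ∩ shift k ⁻¹' B) +
      2 * c.measure (symmDiff A B) := by
  have h := (c.measurePreserving_shift k).measure_preimage (hA.symmDiff hB).nullMeasurableSet
  calc c.measure (A ∩ shift k ⁻¹' A)
      ≤ c.measure ((B ∩ shift k ⁻¹' B) ∪ (symmDiff A B ∪ shift k ⁻¹' symmDiff A B)) := by
        refine measure_mono fun z => ?_
        simp only [Set.mem_symmDiff, mem_inter_iff, mem_union, mem_preimage]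
        tauto
    _ ≤ c.measure (B ∩ shift k ⁻¹' B) +
        (c.measure (symmDiff A B) + c.measure (shift k ⁻¹' symmDiff A B)) :=
      (measure_union_le _ _).trans (by gcongr; exact measure_union_le _ _)
    _ = _ := by rw [h, two_mul]

lemma measure_le_add_symmDiff (A B : Set c.Space) :
    c.measure A ≤ c.measure B + c.measure (symmDiff A B) := by
  refine (measure_mono fun z hz => ?_).trans (measure_union_le _ _)
  by_cases h : z ∈ B
  · exact Or.inl h
  · exact Or.inr (Or.inl ⟨hz, h⟩)

theorem isAlphaType (hq : 2 ≤ q) : IsAlphaType c.measure c.shiftEquiv (1 - (q : ℝ≥0∞)⁻¹) := by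
  intro A hA _ hA'
  simp only [shiftEquiv_image_eq]
  have hα : (1 - (q : ℝ≥0∞)⁻¹) ≤ 1 := tsub_le_self
  have key (ε : ℝ≥0∞) (hε : 0 < ε) : ∃ n P, P ⊆ c.F n ∧
      c.measure (symmDiff A (c.level n P)) ≤ ε ∧ c.measure (symmDiff (c.level n P) A) ≤ ε := by
    obtain ⟨n, P, hP, h⟩ := c.exists_level_symmDiff_lt hA hA'.ne hε
    exact ⟨n, P, hP, h.le, by rw [symmDiff_comm]; exact h.le⟩
  have hε3 (ε : NNReal) (hε : 0 < ε) : 0 < (ε / 3 : ℝ≥0∞) :=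
    ENNReal.div_pos (by exact_mod_cast hε.ne') (by simp)
  have h3 (ε : NNReal) : (ε / 3 : ℝ≥0∞) + 2 * (ε / 3) = ε := by
    rw [← one_add_mul, show (1 + 2 : ℝ≥0∞) = 3 by norm_num,
      ENNReal.mul_div_cancel (by simp) (by simp)]
  refine le_antisymm ?_ ?_
  · refine ENNReal.le_of_forall_pos_le_add fun ε hε _ => ?_
    obtain ⟨n, P, hP, h1, h2⟩ := key _ (hε3 ε hε)
    refine limsup_le_of_le (by isBoundedDefault) ?_
    filter_upwards [eventually_gt_atTop (2 * c.b n).toNat] with k hk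
    calc c.measure (A ∩ shift (-k : ℤ) ⁻¹' A)
        ≤ _ := c.measure_inter_shift_le_add hA (c.measurableSet_level n P) _
      _ ≤ (1 - (q : ℝ≥0∞)⁻¹) * c.measure (c.level n P) + 2 * (ε / 3) := by
        gcongr
        exact c.measure_inter_shift_le hq hP (by omega)
      _ ≤ (1 - (q : ℝ≥0∞)⁻¹) * (c.measure A + ε / 3) + 2 * (ε / 3) := by
        gcongr
        exact (c.measure_le_add_symmDiff _ A).trans (by gcongr)
      _ ≤ (1 - (q : ℝ≥0∞)⁻¹) * c.measure A + 1 * (ε / 3) + 2 * (ε / 3) := by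
        rw [mul_add]
        gcongr
      _ = _ := by rw [one_mul, add_assoc, h3]
  · refine ENNReal.le_of_forall_pos_le_add fun ε hε _ => ?_
    obtain ⟨n, P, hP, h1, h2⟩ := key _ (hε3 ε hε)
    rw [← tsub_le_iff_right]
    refine le_limsup_of_frequently_le ?_ (by isBoundedDefault)
    refine (c.frequently_le_measure_inter_shift hq hP).mono fun k hk => ?_
    rw [tsub_le_iff_right]
    calc (1 - (q : ℝ≥0∞)⁻¹) * c.measure A
        ≤ (1 - (q : ℝ≥0∞)⁻¹) * (c.measure (c.level n P) + ε / 3) := by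
          gcongr
          exact (c.measure_le_add_symmDiff A _).trans (by gcongr)
      _ ≤ (1 - (q : ℝ≥0∞)⁻¹) * c.measure (c.level n P) + 1 * (ε / 3) := by
        rw [mul_add]
        gcongr
      _ ≤ c.measure (A ∩ shift (-k : ℤ) ⁻¹' A) + 2 * (ε / 3) + 1 * (ε / 3) := by
        gcongr
        refine hk.trans ((c.measure_inter_shift_le_add (c.measurableSet_level n P) hA _).trans ?_)
        gcongr
      _ = _ := by rw [one_mul, add_assoc, add_comm (2 * _), h3]

end CutData
namespace CutData

variable {q : ℕ} (c : CutData q)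

lemma disjoint_level {n : ℕ} {P Q : Finset ℤ} (hP : P ⊆ c.F n) (hQ : Q ⊆ c.F n)
    (h : Disjoint P Q) : Disjoint (c.level n P) (c.level n Q) := by
  rw [Set.disjoint_iff_inter_eq_empty, ← c.level_inter hP hQ, Finset.disjoint_iff_inter_eq_empty.1 h,
    level_empty]

lemma measure_level_sdiff_eq_sum {n : ℕ} {P : Finset ℤ} (hP : P ⊆ c.F n) {A : Set c.Space}
    (hA : MeasurableSet A) :
    c.measure (c.level n P \ A) = ∑ p ∈ P, c.measure (c.level n {p} \ A) := by
  induction P using Finset.induction_on with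
  | empty => simp [level_empty]
  | insert p P hp ih =>
    rw [Finset.insert_subset_iff] at hP
    rw [Finset.sum_insert hp, ← ih hP.2, Finset.insert_eq, level_union, Set.union_sdiff_distrib,
      measure_union _ ((c.measurableSet_level _ _).diff hA)]
    exact (c.disjoint_level (Finset.singleton_subset_iff.2 hP.1) hP.2
      (Finset.disjoint_singleton_left.2 hp)).mono Set.sdiff_subset Set.sdiff_subset

lemma exists_level_singleton_sdiff_le {n : ℕ} {P : Finset ℤ} (hP : P ⊆ c.F n) (hP' : P.Nonempty)
    {A : Set c.Space} (hA : MeasurableSet A)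
    (h : 10 * c.measure (c.level n P \ A) ≤ c.measure (c.level n P)) :
    ∃ p ∈ P, 10 * c.measure (c.level n {p} \ A) ≤ c.width n := by
  by_contra! hlt
  have := ENNReal.sum_lt_sum_of_nonempty hP' hlt
  rw [← Finset.mul_sum, ← c.measure_level_sdiff_eq_sum hP hA, Finset.sum_const, nsmul_eq_mul,
    mul_comm, ← c.measure_level hP] at this
  exact this.not_ge h

lemma eventually_exists_level_sdiff_le {A : Set c.Space} (hA : MeasurableSet A)
    (hA' : 0 < c.measure A) :
    ∀ᶠ n in atTop, ∃ p ∈ c.F n, 10 * c.measure (c.level n {p} \ A) ≤ c.width n := by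
  obtain ⟨A', hm, hsub, hpos, hfin⟩ := Measure.exists_subset_measure_lt_top hA hA'
  set δ := c.measure A' / 20 with hδ
  have hδ0 : 0 < δ := ENNReal.div_pos hpos.ne' (by simp)
  have hδt : δ ≠ ∞ := ENNReal.div_ne_top hfin.ne (by simp)
  have hδA : 19 * δ + δ = c.measure A' := by
    rw [← add_one_mul, show (19 + 1 : ℝ≥0∞) = 20 by norm_num,
      ENNReal.mul_div_cancel (by simp) (by simp)]
  obtain ⟨n, P, hP, h⟩ := c.exists_level_symmDiff_lt hm hfin.ne hδ0
  have h1 : 19 * δ ≤ c.measure (c.level n P) := by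
    refine (ENNReal.add_le_add_iff_right hδt).1 ?_
    rw [hδA]
    exact (c.measure_le_add_symmDiff A' _).trans (by gcongr)
  have h2 : 10 * c.measure (c.level n P \ A) ≤ c.measure (c.level n P) := by
    refine le_trans ?_ h1
    refine mul_le_mul' (by norm_num) (le_trans (measure_mono ?_) h.le)
    exact fun z hz => Or.inr ⟨hz.1, fun hz' => hz.2 (hsub hz')⟩
  filter_upwards [eventually_ge_atTop n] with m hnm
  have hne : P.Nonempty := by
    rw [Finset.nonempty_iff_ne_empty]
    rintro rfl
    rw [level_empty, measure_empty] at h1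
    exact (ENNReal.mul_pos (by norm_num) hδ0.ne').not_ge h1
  rw [← c.level_expand hnm] at h2
  have hne' : (c.expand n m P).Nonempty := by
    refine Finset.card_pos.1 (pos_of_mul_pos_left (a := (c.expand n m P).card)
      (b := ∏ i ∈ Finset.range n, (c.D i).card) ?_ (Nat.zero_le _))
    rw [c.card_expand hnm hP]
    exact Nat.mul_pos (Finset.card_pos.2 hne) (c.prod_card_pos m)
  have hF := c.expand_subset_F hnm hP
  obtain ⟨p, hp, h3⟩ := c.exists_level_singleton_sdiff_le hF hne' hA h2
  exact ⟨p, hF hp, h3⟩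

lemma sum_measure_level_sdiff_le {n s : ℕ} {Q : Finset ℤ} (hQ : Q ⊆ c.F n) {x : Fin s → ℤ}
    (hx : x.Injective) (hxD : ∀ t, x t ∈ c.D n) {A : Set c.Space} (hA : MeasurableSet A) :
    ∑ t, c.measure (c.level (n + 1) (Q + {x t}) \ A) ≤ c.measure (c.level n Q \ A) := by
  have hsub (t) : Q + {x t} ⊆ c.F (n + 1) :=
    (Finset.add_subset_add hQ (Finset.singleton_subset_iff.2 (hxD t))).trans (c.F_add_subset n)
  rw [← measure_biUnion_finset _ fun t _ => (c.measurableSet_level _ _).diff hA]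
  · refine measure_mono (iUnion₂_subset fun t _ => Set.sdiff_subset_sdiff_left ?_)
    rw [← c.level_expand n.le_succ, Nat.succ_eq_add_one, expand_succ c le_rfl, expand_self]
    exact c.level_mono _ (Finset.add_subset_add_left (Finset.singleton_subset_iff.2 (hxD t)))
  · intro t _ t' _ htt'
    refine (c.disjoint_level (hsub t) (hsub t') ?_).mono Set.sdiff_subset Set.sdiff_subset
    rw [Finset.disjoint_left]
    intro w hw hw'
    obtain ⟨u, hu, d, hd, rfl⟩ := Finset.mem_add.1 hw
    obtain ⟨v, hv, e, he, h⟩ := Finset.mem_add.1 hw'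
    rw [Finset.mem_singleton] at hd he
    subst hd he
    exact htt' (hx (c.add_injOn n (hQ hv) (hQ hu) (hxD t') (hxD t) h).2.symm)

lemma measure_inter_shift_pos {A B U : Set c.Space} (hA : MeasurableSet A) (hU : MeasurableSet U)
    {k : ℤ} (h : c.measure (U \ A) + c.measure (shift k ⁻¹' U \ B) < c.measure U) :
    0 < c.measure (B ∩ shift k ⁻¹' A) := by
  refine pos_iff_ne_zero.2 fun h0 => h.not_ge ?_
  have hp := c.measurePreserving_shift k
  rw [← hp.measure_preimage hU.nullMeasurableSet,
    ← hp.measure_preimage (hU.diff hA).nullMeasurableSet]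
  calc c.measure (shift k ⁻¹' U)
      ≤ c.measure ((B ∩ shift k ⁻¹' A) ∪ (shift k ⁻¹' (U \ A) ∪ shift k ⁻¹' U \ B)) := by
        refine measure_mono fun z => ?_
        simp only [mem_inter_iff, mem_union, mem_preimage, Set.mem_sdiff]
        tauto
    _ ≤ c.measure (B ∩ shift k ⁻¹' A) +
        (c.measure (shift k ⁻¹' (U \ A)) + c.measure (shift k ⁻¹' U \ B)) :=
      (measure_union_le _ _).trans (by gcongr; exact measure_union_le _ _)
    _ = _ := by rw [h0, zero_add]

theorem wde : WDE c.measure c.shiftEquiv := by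
  intro A B hA hB hA' hB'
  simp only [shiftEquiv_image_eq]
  obtain ⟨N, ⟨p, hp, hpA⟩, p', hp', hpB⟩ := ((c.eventually_exists_level_sdiff_le hA hA').and
    (c.eventually_exists_level_sdiff_le hB hB')).exists
  obtain ⟨n, hn, s, x, y, z, m, hx, hy, hz, hs, hm⟩ := frequently_atTop.1 (c.stairs (p - p')) N
  have hpF := Finset.singleton_subset_iff.2 hp
  have hpF' := Finset.singleton_subset_iff.2 hp'
  have hQ := c.expand_subset_F hn hpF
  have hQ' := c.expand_subset_F hn hpF'
  set Q := c.expand N n {p} with hQdef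
  set Q' := c.expand N n {p'} with hQdef'
  have hQQ' : Q' = {p' - p} + Q := by
    rw [hQdef, hQdef', ← expand_add, Finset.singleton_add_singleton, sub_add_cancel]
  set U := fun t => c.level (n + 1) (Q + {x t}) with hU
  set V := fun t => c.level (n + 1) (Q + {y t}) with hV
  set W := fun t => c.level (n + 1) (Q' + {z t}) with hW
  have hUV (t) : shift (-(m t : ℤ)) ⁻¹' U t = V t := by
    rw [hU, hV]
    simp only
    rw [shift_preimage_level, neg_neg, (hm t).2.2.2.2.1, add_left_comm,
      Finset.singleton_add_singleton, add_comm (m t : ℤ)]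
  have hVW (t) : shift (-(m t : ℤ)) ⁻¹' V t = W t := by
    rw [hW, hV]
    simp only
    rw [shift_preimage_level, neg_neg, (hm t).2.2.2.2.2, hQQ', add_left_comm,
      Finset.singleton_add_singleton, add_right_comm, add_comm Q, Finset.singleton_add_singleton]
    congr 3
    ring
  have hUm (t) : MeasurableSet (U t) := c.measurableSet_level _ _
  have hVm (t) : MeasurableSet (V t) := c.measurableSet_level _ _
  have hmU (t) : c.measure (U t) = c.width (n + 1) * Q.card := by
    rw [hU, c.measure_level, c.card_add hQ (Finset.singleton_subset_iff.2 (hm t).2.1),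
      Finset.card_singleton, mul_one]
    exact (Finset.add_subset_add hQ (Finset.singleton_subset_iff.2 (hm t).2.1)).trans
      (c.F_add_subset n)
  have hmV (t) : c.measure (V t) = c.measure (U t) := by
    rw [← hUV, (c.measurePreserving_shift _).measure_preimage (hUm t).nullMeasurableSet]
  have htotal : 3 * ∑ t, c.measure (U t) = c.width N := by
    rw [Finset.sum_congr rfl fun t _ => hmU t, Finset.sum_const, Finset.card_univ,
      Fintype.card_fin, nsmul_eq_mul, ← c.measure_level_singleton hp, ← c.level_expand hn,
      c.measure_level hQ, c.width_eq_mul_card n, ← hs]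
    push_cast
    ring
  obtain ⟨t, ht⟩ : ∃ t, c.measure (U t \ A) + c.measure (V t \ A) + c.measure (W t \ B) <
      c.measure (U t) := by
    by_contra! hle
    have h1 := Finset.sum_le_sum fun t (_ : t ∈ Finset.univ) => hle t
    rw [Finset.sum_add_distrib, Finset.sum_add_distrib] at h1
    have hUA := c.sum_measure_level_sdiff_le hQ hx (fun t => (hm t).2.1) hA
    have hVA := c.sum_measure_level_sdiff_le hQ hy (fun t => (hm t).2.2.1) hA
    have hWB := c.sum_measure_level_sdiff_le hQ' hz (fun t => (hm t).2.2.2.1) hB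
    rw [hQdef, c.level_expand hn] at hUA hVA
    rw [hQdef', c.level_expand hn] at hWB
    have h2 : 10 * c.width N ≤ 9 * c.width N := by
      calc 10 * c.width N = 3 * (10 * ∑ t, c.measure (U t)) := by rw [← htotal]; ring
        _ ≤ 3 * (10 * (c.measure (c.level N {p} \ A) + c.measure (c.level N {p} \ A) +
            c.measure (c.level N {p'} \ B))) := by
          gcongr
          exact h1.trans (add_le_add (add_le_add hUA hVA) hWB)
        _ = 3 * (10 * c.measure (c.level N {p} \ A) + 10 * c.measure (c.level N {p} \ A) +
            10 * c.measure (c.level N {p'} \ B)) := by ring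
        _ ≤ 3 * (c.width N + c.width N + c.width N) := by gcongr
        _ = 9 * c.width N := by ring
    rw [ENNReal.mul_le_mul_iff_left (c.width_ne_zero N) (c.width_ne_top N)] at h2
    norm_num at h2
  refine ⟨m t, (hm t).1, c.measure_inter_shift_pos hA (hUm t) ?_,
    c.measure_inter_shift_pos hA (hVm t) ?_⟩
  · rw [hUV]
    exact lt_of_le_of_lt le_self_add ht
  · rw [hVW, hmV]
    refine lt_of_le_of_lt ?_ ht
    rw [add_assoc]
    exact le_add_self

end CutData
namespace CutData

variable {q : ℕ} (c : CutData q)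

lemma map_place_le_measure {p : ℤ} (hp : p ∈ c.F 0) :
    c.digitMeasure.map (c.place 0 p) ≤ c.measure := by
  refine Measure.le_iff.2 fun s hs => ?_
  rw [Measure.map_apply (c.measurable_place 0 p) hs, measure_apply c hs]
  calc c.digitMeasure (c.place 0 p ⁻¹' s)
      = c.width 0 * c.digitMeasure (c.place 0 p ⁻¹' s) := by rw [width_zero, one_mul]
    _ ≤ ∑ p ∈ c.spacer 0, c.width 0 * c.digitMeasure (c.place 0 p ⁻¹' s) :=
      Finset.single_le_sum (f := fun p => c.width 0 * c.digitMeasure (c.place 0 p ⁻¹' s))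
        (fun _ _ => zero_le) hp
    _ ≤ _ := ENNReal.le_tsum
      (f := fun n => ∑ p ∈ c.spacer n, c.width n * c.digitMeasure (c.place n p ⁻¹' s)) 0

/-- The pairs of digits of stage `n` which can be moved to another pair by almost equal
translations. -/
noncomputable def associated (n : ℕ) : Finset (ℤ × ℤ) :=
  (c.D n ×ˢ c.D n).filter fun p => ∃ x ∈ c.D n, ∃ y ∈ c.D n,
    (y - p.2) - (x - p.1) ≠ 0 ∧ |(y - p.2) - (x - p.1)| ≤ 4 * c.b n

lemma measure_associated_le (n : ℕ) :
    (c.digitMeasure.prod c.digitMeasure) {w | ((w.1 n : ℤ), (w.2 n : ℤ)) ∈ c.associated n} ≤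
      2⁻¹ * 2⁻¹ ^ (n + 1) := by
  have hsub : {w : c.Digits × c.Digits | ((w.1 n : ℤ), (w.2 n : ℤ)) ∈ c.associated n} ⊆
      ⋃ p ∈ c.associated n, {x : c.Digits | (x n : ℤ) = p.1} ×ˢ {y : c.Digits | (y n : ℤ) = p.2} := by
    intro w hw
    exact mem_iUnion₂.2 ⟨_, hw, rfl, rfl⟩
  have hr0 : ((c.D n).card : ℝ≥0∞) ≠ 0 := by
    have := c.two_le_card n
    exact_mod_cast (by omega : (c.D n).card ≠ 0)
  have hrt : ((c.D n).card : ℝ≥0∞) ≠ ∞ := ENNReal.natCast_ne_top _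
  refine (measure_mono hsub).trans ((measure_biUnion_finset_le _ _).trans ?_)
  have hp : ∀ p ∈ c.associated n, (c.digitMeasure.prod c.digitMeasure)
      ({x : c.Digits | (x n : ℤ) = p.1} ×ˢ {y : c.Digits | (y n : ℤ) = p.2}) =
        ((c.D n).card : ℝ≥0∞)⁻¹ * ((c.D n).card : ℝ≥0∞)⁻¹ := by
    intro p hp
    have hp' := Finset.mem_product.1 (Finset.mem_filter.1 hp).1
    rw [Measure.prod_prod, c.digitMeasure_digit hp'.1, c.digitMeasure_digit hp'.2]
  rw [Finset.sum_congr rfl hp, Finset.sum_const, nsmul_eq_mul]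
  have h : (2 : ℝ≥0∞) ^ (n + 2) * (c.associated n).card ≤ (c.D n).card ^ 2 := by
    exact_mod_cast c.dissociated n
  calc ((c.associated n).card : ℝ≥0∞) * (((c.D n).card : ℝ≥0∞)⁻¹ * ((c.D n).card : ℝ≥0∞)⁻¹)
      = (2⁻¹ * 2) ^ (n + 2) * (c.associated n).card *
        (((c.D n).card : ℝ≥0∞)⁻¹ * ((c.D n).card : ℝ≥0∞)⁻¹) := by
        rw [ENNReal.inv_mul_cancel (by simp) (by simp), one_pow, one_mul]
    _ = 2⁻¹ ^ (n + 2) * (2 ^ (n + 2) * (c.associated n).card) *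
        (((c.D n).card : ℝ≥0∞)⁻¹ * ((c.D n).card : ℝ≥0∞)⁻¹) := by ring
    _ ≤ 2⁻¹ ^ (n + 2) * (c.D n).card ^ 2 *
        (((c.D n).card : ℝ≥0∞)⁻¹ * ((c.D n).card : ℝ≥0∞)⁻¹) := by gcongr
    _ = 2⁻¹ * 2⁻¹ ^ (n + 1) * (((c.D n).card : ℝ≥0∞)⁻¹ * (c.D n).card) *
        (((c.D n).card : ℝ≥0∞)⁻¹ * (c.D n).card) := by ring
    _ = _ := by rw [ENNReal.inv_mul_cancel hr0 hrt, mul_one, mul_one]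

lemma measure_exists_associated_le :
    (c.digitMeasure.prod c.digitMeasure) {w | ∃ n, ((w.1 n : ℤ), (w.2 n : ℤ)) ∈ c.associated n} ≤
      2⁻¹ := by
  rw [show {w : c.Digits × c.Digits | ∃ n, ((w.1 n : ℤ), (w.2 n : ℤ)) ∈ c.associated n} =
    ⋃ n, {w | ((w.1 n : ℤ), (w.2 n : ℤ)) ∈ c.associated n} by ext; simp]
  refine (measure_iUnion_le _).trans ((ENNReal.tsum_le_tsum c.measure_associated_le).trans ?_)
  rw [ENNReal.tsum_mul_left, ENNReal.tsum_geometric_add_one, ENNReal.one_sub_inv_two, inv_inv,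
    ENNReal.inv_mul_cancel (by simp) (by simp), mul_one]

lemma sum_eq_zero_or_lt_abs {δ : ℕ → ℤ} (h : ∀ n, δ n = 0 ∨ 4 * c.b n < |δ n|)
    (h' : ∀ n, |δ n| ≤ 4 * (c.b (n + 1) - c.b n)) (M : ℕ) :
    (∑ i ∈ Finset.range M, δ i = 0 ∨ 4 * c.b 0 < |∑ i ∈ Finset.range M, δ i|) ∧
      |∑ i ∈ Finset.range M, δ i| ≤ 4 * (c.b M - c.b 0) := by
  induction M with
  | zero => simp
  | succ M ih =>
    rw [Finset.sum_range_succ]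
    have h1 := h M
    have h2 := h' M
    grind

/-- The pairs of points which are in the level of position `0` of stage `0` at a common time. -/
def meeting : Set (c.Space × c.Space) :=
  {w | ∃ k : ℤ, shift k w.1 ∈ c.level 0 {0} ∧ shift k w.2 ∈ c.level 0 {0}}

lemma measurableSet_meeting : MeasurableSet c.meeting := by
  rw [show c.meeting = ⋃ k : ℤ,
    (shift k ⁻¹' c.level 0 {0}) ×ˢ (shift k ⁻¹' c.level 0 {0}) by ext; simp [meeting]]
  refine MeasurableSet.iUnion fun k => ?_
  have := c.measurable_shift k (c.measurableSet_level 0 {0})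
  exact this.prod this

lemma preimage_meeting : Prod.map c.shiftEquiv c.shiftEquiv ⁻¹' c.meeting = c.meeting := by
  ext w
  simp only [meeting, mem_preimage, mem_ofPred_eq, Prod.map_fst, Prod.map_snd, shiftEquiv,
    MeasurableEquiv.coe_mk, Equiv.coe_fn_mk, shift_shift]
  constructor
  · rintro ⟨k, hk⟩
    exact ⟨1 + k, hk⟩
  · rintro ⟨k, hk⟩
    exact ⟨k - 1, by simpa using hk⟩

lemma eventually_exists_digits {k p : ℤ} {x : c.Digits}
    (h : shift k (c.place 0 p x) ∈ c.level 0 {0}) :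
    ∀ᶠ M in atTop, ∃ x' : ℕ → ℤ, (∀ i < M, x' i ∈ c.D i) ∧
      ∑ i ∈ Finset.range M, x' i = k + (p + ∑ i ∈ Finset.range M, (x i : ℤ)) := by
  filter_upwards [c.mem_level_iff_eventually.1 h] with M hM
  rw [pos_shift, c.pos_place_of_le M.zero_le, expand, Finset.singleton_zero, zero_add,
    ← Finset.range_eq_Ico, ← Finset.mem_coe, Finset.coe_sum, Set.mem_finsetSum] at hM
  obtain ⟨x', hx', hsum⟩ := hM
  exact ⟨x', fun i hi => hx' (Finset.mem_range.2 hi), hsum⟩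

lemma exists_associated_of_mem_meeting {x y : c.Digits}
    (h : (c.place 0 0 x, c.place 0 1 y) ∈ c.meeting) :
    ∃ n, ((x n : ℤ), (y n : ℤ)) ∈ c.associated n := by
  by_contra! hxy
  obtain ⟨k, h1, h2⟩ := h
  obtain ⟨M, ⟨x', hx', hx⟩, y', hy', hy⟩ :=
    ((c.eventually_exists_digits h1).and (c.eventually_exists_digits h2)).exists
  let δ : ℕ → ℤ := fun i => if i < M then (y' i - y i) - (x' i - x i) else 0
  have hδ (n : ℕ) : δ n = 0 ∨ 4 * c.b n < |δ n| := by
    by_cases hn : n < M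
    · by_contra! hne
      simp only [δ, hn, if_true] at hne
      refine hxy n (Finset.mem_filter.2 ⟨Finset.mem_product.2 ⟨(x n).2, (y n).2⟩,
        x' n, hx' n hn, y' n, hy' n hn, hne⟩)
    · left; simp [δ, hn]
  have hδ' (n : ℕ) : |δ n| ≤ 4 * (c.b (n + 1) - c.b n) := by
    by_cases hn : n < M
    · have h1 := c.bound n _ (hx' n hn)
      have h2 := c.bound n _ (hy' n hn)
      have h3 := c.bound n _ (x n).2
      have h4 := c.bound n _ (y n).2
      have hlt {u : ℤ} (h : |u| + c.b n < c.b (n + 1)) :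
          -(c.b (n + 1) - c.b n) < u ∧ u < c.b (n + 1) - c.b n := abs_lt.1 (by omega)
      have := hlt h1
      have := hlt h2
      have := hlt h3
      have := hlt h4
      simp only [δ, hn, if_true]
      rw [abs_le]
      omega
    · have := c.b_lt n
      simp [δ, hn]
      omega
  have hsum : ∑ i ∈ Finset.range M, δ i = 1 := by
    rw [Finset.sum_congr rfl fun i hi => if_pos (Finset.mem_range.1 hi), Finset.sum_sub_distrib,
      Finset.sum_sub_distrib, Finset.sum_sub_distrib, hx, hy]
    ring
  have h3 := (c.sum_eq_zero_or_lt_abs hδ hδ' M).1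
  have h4 := c.one_le_b_zero
  rw [hsum] at h3
  norm_num at h3
  omega

theorem not_isErgodicT_prod :
    ¬ IsErgodicT (c.measure.prod c.measure) (Prod.map c.shiftEquiv c.shiftEquiv) := by
  intro h
  have h0 : (0 : ℤ) ∈ c.F 0 := c.mem_F.2 (by have := c.one_le_b_zero; rw [abs_zero]; omega)
  have h1 : (1 : ℤ) ∈ c.F 0 := c.mem_F.2 (by have := c.one_le_b_zero; rw [abs_one]; omega)
  rcases h c.meeting c.measurableSet_meeting c.preimage_meeting with h | h
  · have := measure_mono_null (s := c.level 0 {0} ×ˢ c.level 0 {0}) (fun w hw => ?_) h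
    · rw [Measure.prod_prod, c.measure_level_singleton h0, width_zero] at this
      norm_num at this
    · exact ⟨0, by simpa [shift_zero] using hw⟩
  · have hle := Measure.prod_mono (c.map_place_le_measure h0) (c.map_place_le_measure h1)
    have hnull := le_antisymm ((hle _).trans h.le) zero_le
    rw [Measure.map_prod_map _ _ (c.measurable_place 0 0) (c.measurable_place 0 1),
      Measure.map_apply ((c.measurable_place 0 0).prodMap (c.measurable_place 0 1))
      c.measurableSet_meeting.compl] at hnull
    have huniv : (univ : Set (c.Digits × c.Digits)) ⊆
        Prod.map (c.place 0 0) (c.place 0 1) ⁻¹' c.meetingᶜ ∪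
          {w | ∃ n, ((w.1 n : ℤ), (w.2 n : ℤ)) ∈ c.associated n} := by
      intro w _
      by_cases hw : Prod.map (c.place 0 0) (c.place 0 1) w ∈ c.meeting
      · exact Or.inr (c.exists_associated_of_mem_meeting hw)
      · exact Or.inl hw
    have := (measure_mono (μ := c.digitMeasure.prod c.digitMeasure) huniv).trans
      (measure_union_le _ _)
    rw [hnull, zero_add, measure_univ] at this
    have := this.trans c.measure_exists_associated_le
    rw [ENNReal.one_le_inv] at this
    norm_num at this

end CutData
/-- The conditions on the set of cutting places `D` of stage `n` when the column is `[-b, b]`. -/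
structure IsCut (q n : ℕ) (b : ℤ) (D : Finset ℤ) : Prop where
  two_le_card : 2 ≤ D.card
  separated : ∀ d ∈ D, ∀ d' ∈ D, d ≠ d' → 4 * b < |d - d'|
  overlap : ∀ k, 2 * b < k →
    q * (D.filter fun d => ∃ d' ∈ D, |d - d' - k| ≤ 2 * b).card ≤ (q - 1) * D.card
  dissociated : 2 ^ (n + 2) * ((D ×ˢ D).filter fun p => ∃ x ∈ D, ∃ y ∈ D,
    (y - p.2) - (x - p.1) ≠ 0 ∧ |(y - p.2) - (x - p.1)| ≤ 4 * b).card ≤ D.card ^ 2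

lemma Int.lt_abs_mul_of_ne_zero {g : ℕ} {b m : ℤ} (hg : b < g) (hm : m ≠ 0) : b < |m * g| := by
  rw [abs_mul, Nat.abs_cast]
  have := Int.one_le_abs hm
  nlinarith

lemma exists_isCut_rigid {q : ℕ} (hq : 2 ≤ q) (n : ℕ) {b : ℤ} (hb : 1 ≤ b) :
    ∃ D, IsCut q n b D ∧ ∃ k : ℕ, n ≤ k ∧
      (q - 1) * D.card ≤ q * (D.filter fun d : ℤ => d - (k : ℤ) ∈ D).card := by
  obtain ⟨g, hng, hg⟩ : ∃ g : ℕ, n ≤ g ∧ 4 * b < g := ⟨n + (4 * b + 1).toNat, by omega, by omega⟩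
  have hinj : Function.Injective fun i : ℕ => (i : ℤ) * g := by
    intro i i' h
    have : g ≠ 0 := by omega
    simpa [this] using h
  set D := (Finset.range q).image fun i : ℕ => (i : ℤ) * g with hD
  have hcard : D.card = q := by rw [hD, Finset.card_image_of_injective _ hinj, Finset.card_range]
  have hmem {d : ℤ} : d ∈ D ↔ ∃ i < q, (i : ℤ) * g = d := by simp [hD]
  refine ⟨D, ⟨by omega, ?_, ?_, ?_⟩, g, hng, ?_⟩
  · intro d hd d' hd' hne
    obtain ⟨i, -, rfl⟩ := hmem.1 hd
    obtain ⟨i', -, rfl⟩ := hmem.1 hd'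
    rw [← sub_mul]
    refine Int.lt_abs_mul_of_ne_zero hg fun h => hne ?_
    rw [sub_eq_zero.1 h]
  · intro k hk
    rw [hcard, mul_comm]
    refine Nat.mul_le_mul_right q ?_
    have hsub : (D.filter fun d => ∃ d' ∈ D, |d - d' - k| ≤ 2 * b) ⊆ D.erase 0 := by
      intro d hd
      obtain ⟨hd, d', hd', h⟩ := Finset.mem_filter.1 hd
      refine Finset.mem_erase.2 ⟨?_, hd⟩
      rintro rfl
      obtain ⟨i', -, rfl⟩ := hmem.1 hd'
      have : (0 : ℤ) ≤ i' * g := by positivity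
      rw [abs_le] at h
      omega
    refine (Finset.card_le_card hsub).trans ?_
    rw [Finset.card_erase_of_mem (hmem.2 ⟨0, by omega, by simp⟩), hcard]
  · rw [Finset.filter_false_of_mem]
    · simp
    rintro ⟨d, e⟩ h ⟨x, hx, y, hy, hne, hle⟩
    rw [Finset.mem_product] at h
    obtain ⟨i1, -, h1⟩ := hmem.1 h.1
    obtain ⟨i2, -, h2⟩ := hmem.1 h.2
    obtain ⟨i3, -, rfl⟩ := hmem.1 hx
    obtain ⟨i4, -, rfl⟩ := hmem.1 hy
    simp only at h1 h2 hne hle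
    rw [← h1, ← h2, ← sub_mul, ← sub_mul, ← sub_mul] at hne hle
    exact (Int.lt_abs_mul_of_ne_zero hg (left_ne_zero_of_mul hne)).not_ge hle
  · rw [hcard, mul_comm]
    refine Nat.mul_le_mul_left q ?_
    have hsub : ((Finset.range (q - 1)).image fun i : ℕ => ((i + 1 : ℕ) : ℤ) * g) ⊆
        D.filter fun d : ℤ => d - (g : ℤ) ∈ D := by
      intro d hd
      obtain ⟨i, hi, rfl⟩ := Finset.mem_image.1 hd
      rw [Finset.mem_range] at hi
      exact Finset.mem_filter.2 ⟨hmem.2 ⟨i + 1, by omega, rfl⟩, hmem.2 ⟨i, by omega, by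
        push_cast; ring⟩⟩
    refine le_trans ?_ (Finset.card_le_card hsub)
    have := Finset.card_image_of_injective (Finset.range (q - 1))
      (hinj.comp (add_left_injective 1))
    rw [Finset.card_range] at this
    exact this.ge

lemma eq_zero_of_sum_mul_pow_eq_zero {v : ℕ → ℤ} (hv : ∀ u, |v u| < 100) {s : ℕ}
    (h : ∑ u ∈ Finset.range s, v u * 100 ^ u = 0) : ∀ u < s, v u = 0 := by
  induction s generalizing v with
  | zero => intro u hu; omega
  | succ s ih =>
    have hsum : ∑ u ∈ Finset.range s, v (u + 1) * 100 ^ (u + 1) =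
        100 * ∑ u ∈ Finset.range s, v (u + 1) * 100 ^ u := by
      rw [Finset.mul_sum]
      exact Finset.sum_congr rfl fun u _ => by ring
    rw [Finset.sum_range_succ', hsum, pow_zero, mul_one] at h
    have h0 := abs_lt.1 (hv 0)
    intro u hu
    cases u with
    | zero => omega
    | succ u => exact ih (v := fun u => v (u + 1)) (fun u => hv _) (by omega) u (by omega)

/-- The places where the column is copied at a stage of staircase type. -/
def stair (g : ℕ) (j : ℤ) (a : ℕ × ℕ) : ℤ :=
  100 ^ a.1 * (1 + 10 * a.2) * g + if a.2 = 2 then j else 0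

lemma digits_eq_of_abs_stair_le {g s : ℕ} {b j : ℤ} (hg : 4 * b + 2 * |j| < g)
    {a₁ a₂ a₃ a₄ : ℕ × ℕ} (h₁ : a₁ ∈ Finset.range s ×ˢ Finset.range 3)
    (h₂ : a₂ ∈ Finset.range s ×ˢ Finset.range 3) (h₃ : a₃ ∈ Finset.range s ×ˢ Finset.range 3)
    (h₄ : a₄ ∈ Finset.range s ×ˢ Finset.range 3)
    (h : |stair g j a₁ - stair g j a₂ - stair g j a₃ + stair g j a₄| ≤ 4 * b) {u : ℕ}
    (hu : u < s) :
    (if a₁.1 = u then (1 + 10 * a₁.2 : ℤ) else 0) + (if a₄.1 = u then (1 + 10 * a₄.2 : ℤ) else 0) =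
      (if a₂.1 = u then (1 + 10 * a₂.2 : ℤ) else 0) +
        (if a₃.1 = u then (1 + 10 * a₃.2 : ℤ) else 0) := by
  simp only [Finset.mem_product, Finset.mem_range] at h₁ h₂ h₃ h₄
  set v : ℕ → ℤ := fun u => (if a₁.1 = u then (1 + 10 * a₁.2 : ℤ) else 0) +
    (if a₄.1 = u then (1 + 10 * a₄.2 : ℤ) else 0) - (if a₂.1 = u then (1 + 10 * a₂.2 : ℤ) else 0) -
      (if a₃.1 = u then (1 + 10 * a₃.2 : ℤ) else 0) with hv
  have hsum (a : ℕ × ℕ) (ha : a.1 < s) :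
      ∑ u ∈ Finset.range s, (if a.1 = u then (1 + 10 * a.2 : ℤ) else 0) * 100 ^ u =
        100 ^ a.1 * (1 + 10 * a.2) := by
    simp only [ite_mul, zero_mul]
    rw [Finset.sum_ite_eq, if_pos (Finset.mem_range.2 ha), mul_comm]
  have hv0 : ∑ u ∈ Finset.range s, v u * 100 ^ u = 0 := by
    simp only [hv, sub_mul, add_mul, Finset.sum_sub_distrib, Finset.sum_add_distrib]
    rw [hsum _ h₁.1, hsum _ h₂.1, hsum _ h₃.1, hsum _ h₄.1]
    by_contra hne
    refine (Int.lt_abs_mul_of_ne_zero hg hne).not_ge ?_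
    have hj (a : ℕ × ℕ) : (if a.2 = 2 then j else 0) = 0 ∨ (if a.2 = 2 then j else 0) = j := by
      split_ifs <;> simp
    have hj1 := hj a₁
    have hj2 := hj a₂
    have hj3 := hj a₃
    have hj4 := hj a₄
    simp only [stair] at h
    generalize (if a₁.2 = 2 then j else 0) = j1 at *
    generalize (if a₂.2 = 2 then j else 0) = j2 at *
    generalize (if a₃.2 = 2 then j else 0) = j3 at *
    generalize (if a₄.2 = 2 then j else 0) = j4 at *
    have hjj : |j1 - j2 - j3 + j4| ≤ 2 * |j| := by
      clear h
      have := le_abs_self j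
      have := neg_abs_le j
      rw [abs_le]
      omega
    rw [abs_le] at h hjj ⊢
    constructor <;> linarith [h.1, h.2, hjj.1, hjj.2]
  have hv1 (u) : |v u| < 100 := by
    simp only [hv]
    rw [abs_lt]
    split_ifs <;> omega
  have := eq_zero_of_sum_mul_pow_eq_zero hv1 hv0 u hu
  simp only [hv] at this
  omega

lemma eq_of_abs_stair_sub_le {g s : ℕ} {b j : ℤ} (hg : 4 * b + 2 * |j| < g) {a a' : ℕ × ℕ}
    (h : a ∈ Finset.range s ×ˢ Finset.range 3) (h' : a' ∈ Finset.range s ×ˢ Finset.range 3)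
    (hle : |stair g j a - stair g j a'| ≤ 4 * b) : a = a' := by
  have := digits_eq_of_abs_stair_le hg h h' h' h' (by rwa [sub_add_cancel])
    (Finset.mem_range.1 (Finset.mem_product.1 h).1)
  rw [if_pos rfl, add_left_inj] at this
  split_ifs at this with heq
  · exact Prod.ext heq.symm (by omega)
  · omega

lemma fst_eq_of_abs_stair_le {g s : ℕ} {b j : ℤ} (hg : 4 * b + 2 * |j| < g)
    {a₁ a₂ a₃ a₄ : ℕ × ℕ} (h₁ : a₁ ∈ Finset.range s ×ˢ Finset.range 3)
    (h₂ : a₂ ∈ Finset.range s ×ˢ Finset.range 3) (h₃ : a₃ ∈ Finset.range s ×ˢ Finset.range 3)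
    (h₄ : a₄ ∈ Finset.range s ×ˢ Finset.range 3)
    (h : |stair g j a₁ - stair g j a₂ - stair g j a₃ + stair g j a₄| ≤ 4 * b)
    (h13 : a₁.1 ≠ a₃.1) : a₁ = a₂ := by
  have := digits_eq_of_abs_stair_le hg h₁ h₂ h₃ h₄ h
    (Finset.mem_range.1 (Finset.mem_product.1 h₁).1)
  simp only [Finset.mem_product, Finset.mem_range] at h₁ h₂ h₃ h₄
  rw [if_pos rfl, if_neg h13.symm, add_zero] at this
  split_ifs at this with h4 h2 h2
  · omega
  · omega
  · exact Prod.ext h2.symm (by omega)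
  · omega

lemma exists_isCut_stairs {q : ℕ} (hq : 2 ≤ q) (n : ℕ) {b : ℤ} (hb : 1 ≤ b) (j : ℤ) :
    ∃ D, IsCut q n b D ∧ ∃ (s : ℕ) (x y z : Fin s → ℤ) (m : Fin s → ℕ),
      x.Injective ∧ y.Injective ∧ z.Injective ∧ 3 * s = D.card ∧
        ∀ t, 1 ≤ m t ∧ x t ∈ D ∧ y t ∈ D ∧ z t ∈ D ∧
          y t = x t + m t ∧ z t = y t + m t + j := by
  obtain ⟨g, hg⟩ : ∃ g : ℕ, 4 * b + 2 * |j| < g :=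
    ⟨(4 * b + 2 * |j| + 1).toNat, by omega⟩
  have hg1 : 1 ≤ g := by
    have := abs_nonneg j
    omega
  set s := 2 ^ (n + 2) with hs
  have hs2 : 2 ≤ s := by
    rw [hs, pow_succ]
    have := Nat.one_le_two_pow (n := n + 1)
    omega
  set I := Finset.range s ×ˢ Finset.range 3 with hI
  have hinj : ∀ a ∈ I, ∀ a' ∈ I, stair g j a = stair g j a' → a = a' := fun a ha a' ha' h =>
    eq_of_abs_stair_sub_le hg ha ha' (by rw [h, sub_self, abs_zero]; omega)
  set D := I.image (stair g j) with hD
  have hcard : D.card = 3 * s := by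
    rw [hD, Finset.card_image_of_injOn fun a ha a' ha' => hinj a ha a' ha', hI,
      Finset.card_product, Finset.card_range, Finset.card_range, mul_comm]
  have hmem {d : ℤ} : d ∈ D ↔ ∃ a ∈ I, stair g j a = d := by simp only [hD, Finset.mem_image]
  have hmemI (t : Fin s) (i : ℕ) (hi : i < 3) : ((t : ℕ), i) ∈ I := by
    simp [hI, hi]
  have hinjI (i : ℕ) (hi : i < 3) : Function.Injective fun t : Fin s => stair g j (t, i) :=
    fun t t' h => Fin.ext (congrArg Prod.fst (hinj _ (hmemI t i hi) _ (hmemI t' i hi) h))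
  refine ⟨D, ⟨by omega, ?_, ?_, ?_⟩, s, fun t => stair g j (t, 0), fun t => stair g j (t, 1),
    fun t => stair g j (t, 2), fun t => 10 * g * 100 ^ (t : ℕ), hinjI 0 (by omega),
    hinjI 1 (by omega), hinjI 2 (by omega), hcard.symm, fun t => ⟨?_,
      hmem.2 ⟨_, hmemI t 0 (by omega), rfl⟩, hmem.2 ⟨_, hmemI t 1 (by omega), rfl⟩,
      hmem.2 ⟨_, hmemI t 2 (by omega), rfl⟩, ?_, ?_⟩⟩
  · intro d hd d' hd' hne
    obtain ⟨a, ha, rfl⟩ := hmem.1 hd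
    obtain ⟨a', ha', rfl⟩ := hmem.1 hd'
    by_contra! hle
    exact hne (congrArg _ (eq_of_abs_stair_sub_le hg ha ha' hle))
  · intro k hk
    set E := D.filter fun d => ∃ d' ∈ D, |d - d' - k| ≤ 2 * b with hE
    have hE3 : E.card ≤ 3 := by
      obtain hemp | ⟨d₀, hd₀⟩ := E.eq_empty_or_nonempty
      · simp [hemp]
      obtain ⟨hd₀, d₀', hd₀', hle₀⟩ := Finset.mem_filter.1 hd₀
      obtain ⟨a₀, ha₀, rfl⟩ := hmem.1 hd₀
      obtain ⟨a₀', ha₀', rfl⟩ := hmem.1 hd₀'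
      have hsub : E ⊆ (Finset.range 3).image fun i => stair g j (a₀.1, i) := by
        intro d hd
        obtain ⟨hd, d', hd', hle⟩ := Finset.mem_filter.1 hd
        obtain ⟨a, ha, rfl⟩ := hmem.1 hd
        obtain ⟨a', ha', rfl⟩ := hmem.1 hd'
        have heq : a.1 = a₀.1 := by
          by_contra hne
          have h := fst_eq_of_abs_stair_le hg ha ha' ha₀ ha₀' (by
            rw [abs_le] at *
            constructor <;> linarith [hle.1, hle.2, hle₀.1, hle₀.2]) hne
          rw [h, abs_le] at hle
          omega
        exact Finset.mem_image.2 ⟨a.2, (Finset.mem_product.1 ha).2, by rw [← heq]⟩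
      exact (Finset.card_le_card hsub).trans (Finset.card_image_le.trans (by simp))
    rw [hcard]
    calc q * E.card ≤ q * 3 := Nat.mul_le_mul_left q hE3
      _ ≤ (q - 1) * (3 * 2) := by omega
      _ ≤ (q - 1) * (3 * s) := by gcongr
  · set B := (D ×ˢ D).filter fun p => ∃ x ∈ D, ∃ y ∈ D,
      (y - p.2) - (x - p.1) ≠ 0 ∧ |(y - p.2) - (x - p.1)| ≤ 4 * b with hB
    have hsub : B ⊆ (Finset.range s ×ˢ Finset.range 3 ×ˢ Finset.range 3).image fun w =>
        (stair g j (w.1, w.2.1), stair g j (w.1, w.2.2)) := by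
      rintro ⟨d, e⟩ hp
      obtain ⟨hp, x, hx, y, hy, hne, hle⟩ := Finset.mem_filter.1 hp
      obtain ⟨hd, he⟩ := Finset.mem_product.1 hp
      obtain ⟨a, ha, had⟩ := hmem.1 hd
      obtain ⟨a', ha', hae⟩ := hmem.1 he
      obtain ⟨u, hu, rfl⟩ := hmem.1 hx
      obtain ⟨u', hu', rfl⟩ := hmem.1 hy
      simp only at had hae hne hle
      subst had hae
      have heq : a.1 = a'.1 := by
        by_contra h
        have hau := fst_eq_of_abs_stair_le hg ha hu ha' hu' (by
          convert hle using 2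
          ring) h
        subst hau
        rw [sub_self, sub_zero] at hne hle
        exact hne (sub_eq_zero.2 (congrArg _ (eq_of_abs_stair_sub_le hg hu' ha' hle)))
      refine Finset.mem_image.2 ⟨(a.1, a.2, a'.2), ?_, by simp only [Prod.mk.eta]; rw [heq]⟩
      rw [Finset.mem_product] at ha ha'
      exact Finset.mem_product.2 ⟨ha.1, Finset.mem_product.2 ⟨ha.2, ha'.2⟩⟩
    have hB9 : B.card ≤ s * (3 * 3) := by
      refine (Finset.card_le_card hsub).trans (Finset.card_image_le.trans ?_)
      simp only [Finset.card_product, Finset.card_range, le_refl]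
    rw [hcard, ← hs]
    calc s * B.card ≤ s * (s * (3 * 3)) := Nat.mul_le_mul_left s hB9
      _ = (3 * s) ^ 2 := by ring
  · have := Nat.one_le_pow (t : ℕ) 100 (by omega)
    nlinarith
  · simp only [stair]
    push_cast
    norm_num
    ring
  · simp only [stair]
    push_cast
    norm_num
    ring

lemma frequently_eq_decode (o : Option ℤ) :
    ∃ᶠ n : ℕ in atTop, (Encodable.decode (α := Option ℤ) n.unpair.1).join = o := by
  refine frequently_atTop.2 fun a => ⟨Nat.pair (Encodable.encode o) a, Nat.right_le_pair _ _, ?_⟩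
  simp

theorem exists_cutData {q : ℕ} (hq : 2 ≤ q) : Nonempty (CutData q) := by
  have key (n : ℕ) (b : ℤ) (o : Option ℤ) : ∃ D, 1 ≤ b → IsCut q n b D ∧
      (o = none → ∃ k : ℕ, n ≤ k ∧
        (q - 1) * D.card ≤ q * (D.filter fun d : ℤ => d - (k : ℤ) ∈ D).card) ∧
      ∀ j, o = some j → ∃ (s : ℕ) (x y z : Fin s → ℤ) (m : Fin s → ℕ),
        x.Injective ∧ y.Injective ∧ z.Injective ∧ 3 * s = D.card ∧
          ∀ t, 1 ≤ m t ∧ x t ∈ D ∧ y t ∈ D ∧ z t ∈ D ∧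
            y t = x t + m t ∧ z t = y t + m t + j := by
    by_cases hb : 1 ≤ b
    · cases o with
      | none =>
        obtain ⟨D, hD, h⟩ := exists_isCut_rigid hq n hb
        exact ⟨D, fun _ => ⟨hD, fun _ => h, by simp⟩⟩
      | some j =>
        obtain ⟨D, hD, h⟩ := exists_isCut_stairs hq n hb j
        refine ⟨D, fun _ => ⟨hD, by simp, ?_⟩⟩
        rintro j' ⟨⟩
        exact h
    · exact ⟨∅, fun h => absurd h hb⟩
  choose D hD using key
  let f (n : ℕ) : Option ℤ := (Encodable.decode n.unpair.1).join
  let b : ℕ → ℤ := fun n => n.rec 1 fun n b =>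
    b + ∑ d ∈ D n b (f n), |d| + 1 + (D n b (f n)).card * (2 * b + 1)
  have hsucc (n : ℕ) : b (n + 1) =
    b n + ∑ d ∈ D n (b n) (f n), |d| + 1 + (D n (b n) (f n)).card * (2 * b n + 1) := rfl
  have hsum (n : ℕ) : 0 ≤ ∑ d ∈ D n (b n) (f n), |d| := Finset.sum_nonneg fun _ _ => abs_nonneg _
  have hb (n : ℕ) : 1 ≤ b n := by
    induction n with
    | zero => exact le_rfl
    | succ n ih =>
      rw [hsucc]
      have := hsum n
      have : 0 ≤ ((D n (b n) (f n)).card : ℤ) * (2 * b n + 1) := by positivity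
      omega
  have hcut (n : ℕ) := hD n (b n) (f n) (hb n)
  exact ⟨{
    D := fun n => D n (b n) (f n)
    b := b
    one_le_b_zero := hb 0
    two_le_card := fun n => (hcut n).1.two_le_card
    separated := fun n => (hcut n).1.separated
    bound := by
      intro n d hd
      have h1 := Finset.single_le_sum (f := fun d : ℤ => |d|) (fun _ _ => abs_nonneg _) hd
      have h2 : 0 ≤ ((D n (b n) (f n)).card : ℤ) * (2 * b n + 1) := by
        have := hb n
        positivity
      rw [hsucc]
      omega
    spacers := by
      intro n
      have := hsum n
      have := hb n
      rw [hsucc]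
      omega
    overlap := fun n => (hcut n).1.overlap
    rigid := (frequently_eq_decode none).mono fun n hn => (hcut n).2.1 hn
    stairs := fun j => (frequently_eq_decode (some j)).mono fun n hn => (hcut n).2.2 j hn
    dissociated := fun n => (hcut n).1.dissociated }⟩

/-- For every `q ≥ 2` there is an invertible measure-preserving transformation of an infinite
nonatomic σ-finite measure space which is weak doubly ergodic, whose cartesian square is not
ergodic, and which is of `(1 - q⁻¹)`-type. -/
theorem exists_WDE_squareNotErgodic_oneSubInvQType (q : ℕ) (hq : 2 ≤ q) :
    ∃ (X : Type) (_ : MeasurableSpace X) (μ : Measure X) (_ : SigmaFinite μ) (T : X ≃ᵐ X),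
      (∀ x : X, μ {x} = 0) ∧ μ Set.univ = ∞ ∧
      MeasurePreserving T μ μ ∧
      WDE μ T ∧
      ¬ IsErgodicT (μ.prod μ) (Prod.map T T) ∧
      IsAlphaType μ T (1 - (q : ℝ≥0∞)⁻¹) ∧
      (∀ A : Set X, MeasurableSet A → 0 < μ A → μ A < ∞ →
        (1 - (q : ℝ≥0∞)⁻¹) * μ A < μ A) := by
  obtain ⟨c⟩ := exists_cutData hq
  refine ⟨c.Space, inferInstance, c.measure, inferInstance, c.shiftEquiv, c.measure_singleton,
    c.measure_univ_eq_top, c.measurePreserving_shift 1, c.wde, c.not_isErgodicT_prod,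
    c.isAlphaType hq, fun A _ hA hA' => ?_⟩
  have hlt : 1 - (q : ℝ≥0∞)⁻¹ < 1 :=
    ENNReal.sub_lt_self ENNReal.one_ne_top one_ne_zero (by simp)
  calc (1 - (q : ℝ≥0∞)⁻¹) * c.measure A < 1 * c.measure A :=
        ENNReal.mul_lt_mul_left hA.ne' hA'.ne hlt
    _ = c.measure A := one_mul _
end

section
/- For every integer q ≥ 2 there exist a σ-finite measure space (X,μ) with μ nonatomic and μ(X) = ∞, and an invertible measure-preserving transformation T of (X,μ), such that T is conservative and ergodic, T is of (1 − q⁻¹)-type (for every measurable set A with 0 < μ(A) < ∞, limsup_{n→∞} μ(A ∩ Tⁿ(A)) = (1 − 1/q)·μ(A)), and T is not weak doubly ergodic. -/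
open MeasureTheory Filter Set
open scoped ENNReal

/-- `R` is conservative with respect to `ν`. -/
def IsConservative {Y : Type*} [MeasurableSpace Y] (ν : Measure Y) (R : Y → Y) : Prop :=
  ∀ A : Set Y, MeasurableSet A → 0 < ν A → ∃ n : ℕ, 1 ≤ n ∧ 0 < ν (A ∩ R^[n] ⁻¹' A)

namespace PadicInt

variable {p : ℕ} [hp : Fact p.Prime] {q : ℕ}

noncomputable instance : MeasurableSpace ℤ_[p] := borel _

instance : BorelSpace ℤ_[p] := ⟨rfl⟩

/-- The `p`-adic integer whose `i`-th digit is `ω i + 1`. -/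
noncomputable def ofSuccDigits (p : ℕ) [Fact p.Prime] {q : ℕ} (ω : ℕ → Fin q) : ℤ_[p] :=
  ∑' i, ((ω i + 1 : ℕ) : ℤ_[p]) * (p : ℤ_[p]) ^ i

lemma norm_succDigit_mul_pow_le (ω : ℕ → Fin q) (i : ℕ) :
    ‖((ω i + 1 : ℕ) : ℤ_[p]) * (p : ℤ_[p]) ^ i‖ ≤ ((p : ℝ)⁻¹) ^ i := by
  rw [norm_mul, norm_pow, norm_p]
  exact mul_le_of_le_one_left (by positivity) (norm_le_one _)

lemma summable_inv_pow : Summable fun i : ℕ => ((p : ℝ)⁻¹) ^ i :=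
  summable_geometric_of_lt_one (by positivity)
    (inv_lt_one_of_one_lt₀ (by exact_mod_cast hp.out.one_lt))

lemma ofSuccDigits_eq (ω : ℕ → Fin q) :
    ofSuccDigits p ω = ((ω 0 + 1 : ℕ) : ℤ_[p]) + p * ofSuccDigits p (fun i => ω (i + 1)) := by
  have hs : Summable fun i => ((ω i + 1 : ℕ) : ℤ_[p]) * (p : ℤ_[p]) ^ i :=
    .of_norm_bounded summable_inv_pow (norm_succDigit_mul_pow_le ω)
  have hs' : Summable fun i => ((ω (i + 1) + 1 : ℕ) : ℤ_[p]) * (p : ℤ_[p]) ^ i :=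
    .of_norm_bounded summable_inv_pow (norm_succDigit_mul_pow_le fun i => ω (i + 1))
  rw [ofSuccDigits, hs.tsum_eq_zero_add, ofSuccDigits, ← hs'.tsum_mul_left]
  simp only [pow_zero, mul_one]
  congr 2
  ext1 i
  ring

lemma continuous_ofSuccDigits : Continuous (ofSuccDigits p (q := q)) := by
  refine continuous_tsum (fun i => ?_) summable_inv_pow fun i ω => norm_succDigit_mul_pow_le ω i
  have : Continuous fun d : Fin q => ((d + 1 : ℕ) : ℤ_[p]) := continuous_of_discreteTopology
  exact (this.comp (continuous_apply i)).mul continuous_const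

lemma dvd_natCast_sub_natCast {a b : ℕ} :
    (p : ℤ_[p]) ∣ (a : ℤ_[p]) - b ↔ (p : ℤ) ∣ (a : ℤ) - b := by
  rw [← norm_lt_one_iff_dvd, ← norm_int_lt_one_iff_dvd]
  simp

lemma eq_of_dvd_natCast_sub {a b : ℕ} (ha : a < p) (hb : b < p)
    (h : (p : ℤ_[p]) ∣ (a : ℤ_[p]) - b) : a = b := by
  rw [dvd_natCast_sub_natCast] at h
  have := Int.eq_zero_of_abs_lt_dvd h (by rw [abs_lt]; omega)
  omega

lemma digits_eq_of_pow_dvd (hpq : q < p) (n : ℕ) {ω ω' : ℕ → Fin q}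
    (h : (p : ℤ_[p]) ^ n ∣ ofSuccDigits p ω - ofSuccDigits p ω') : ∀ i < n, ω i = ω' i := by
  induction n generalizing ω ω' with
  | zero => simp
  | succ n ih =>
    rw [ofSuccDigits_eq ω, ofSuccDigits_eq ω'] at h
    have h0 : (ω 0 : ℕ) + 1 = ω' 0 + 1 := by
      refine eq_of_dvd_natCast_sub (p := p) (by omega) (by omega) ?_
      have h1 := (dvd_pow_self (p : ℤ_[p]) n.succ_ne_zero).trans h
      have := dvd_sub h1 (dvd_mul_right (p : ℤ_[p])
        (ofSuccDigits p (fun i => ω (i + 1)) - ofSuccDigits p (fun i => ω' (i + 1))))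
      ring_nf at this ⊢
      exact this
    have hp0 : (p : ℤ_[p]) ≠ 0 := by exact_mod_cast hp.out.ne_zero
    rw [h0, add_sub_add_left_eq_sub, ← mul_sub, pow_succ', mul_dvd_mul_iff_left hp0] at h
    rintro (_ | i) hi
    · exact Fin.ext (by omega)
    · exact ih h i (by omega)

/-- The set of `p`-adic integers all of whose digits lie in `{1, …, q}`. -/
def digitSet (p q : ℕ) [Fact p.Prime] : Set ℤ_[p] := range (ofSuccDigits p (q := q))

lemma isCompact_digitSet : IsCompact (digitSet p q) :=
  isCompact_range continuous_ofSuccDigits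

lemma mem_digitSet_iff {x : ℤ_[p]} :
    x ∈ digitSet p q ↔ ∃ d ∈ Finset.Icc 1 q, ∃ y ∈ digitSet p q, x = (d : ℤ_[p]) + p * y := by
  constructor
  · rintro ⟨ω, rfl⟩
    exact ⟨ω 0 + 1, by simp, _, ⟨_, rfl⟩, ofSuccDigits_eq ω⟩
  · rintro ⟨d, hd, _, ⟨ω, rfl⟩, rfl⟩
    rw [Finset.mem_Icc] at hd
    refine ⟨fun i => Nat.casesOn i ⟨d - 1, by omega⟩ ω, ?_⟩
    rw [ofSuccDigits_eq]
    simp [Nat.sub_add_cancel hd.1]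

lemma natCast_add_mul_mem_digitSet_iff (hpq : q < p) {d : ℕ} (hd : d < p) {y : ℤ_[p]} :
    (d : ℤ_[p]) + p * y ∈ digitSet p q ↔ d ∈ Finset.Icc 1 q ∧ y ∈ digitSet p q := by
  refine ⟨fun h => ?_, fun h => mem_digitSet_iff.2 ⟨d, h.1, y, h.2, rfl⟩⟩
  obtain ⟨d', hd', y', hy', e⟩ := mem_digitSet_iff.1 h
  have : d = d' := by
    refine eq_of_dvd_natCast_sub (p := p) hd (by rw [Finset.mem_Icc] at hd'; omega) ⟨y' - y, ?_⟩
    linear_combination e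
  subst this
  have hp0 : (p : ℤ_[p]) ≠ 0 := by exact_mod_cast hp.out.ne_zero
  rw [mul_left_cancel₀ hp0 (add_left_cancel e)]
  exact ⟨hd', hy'⟩

lemma rpow_logb_self (hq : 2 ≤ q) : (p : ℝ) ^ Real.logb p q = q :=
  Real.rpow_logb (by exact_mod_cast hp.out.pos) (by exact_mod_cast hp.out.ne_one)
    (by positivity)

lemma logb_pos (hq : 2 ≤ q) : 0 < Real.logb p q :=
  Real.logb_pos (by exact_mod_cast hp.out.one_lt) (by exact_mod_cast hq)

lemma ediam_image_add_mul_le (a b : ℤ_[p]) (s : Set ℤ_[p]) :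
    Metric.ediam ((fun y => a + b * y) '' s) ≤ ENNReal.ofReal ‖b‖ := by
  refine Metric.ediam_image_le_iff.2 fun x _ y _ => ?_
  rw [edist_dist, dist_eq_norm, add_sub_add_left_eq_sub, ← mul_sub, norm_mul]
  exact ENNReal.ofReal_le_ofReal (mul_le_of_le_one_right (norm_nonneg _) (norm_le_one _))

lemma exists_finset_digitSet_subset (n : ℕ) : ∃ s : Finset ℤ_[p], s.card ≤ q ^ n ∧
    digitSet p q ⊆ ⋃ a : s, (fun y => (a : ℤ_[p]) + (p : ℤ_[p]) ^ n * y) '' digitSet p q := by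
  induction n with
  | zero => exact ⟨{0}, by simp, fun x hx => mem_iUnion.2 ⟨⟨0, by simp⟩, x, hx, by simp⟩⟩
  | succ n ih =>
    obtain ⟨s, hs, hE⟩ := ih
    classical
    refine ⟨(s ×ˢ Finset.Icc 1 q).image fun x => x.1 + (p : ℤ_[p]) ^ n * x.2, ?_, ?_⟩
    · refine Finset.card_image_le.trans ?_
      rw [Finset.card_product, pow_succ, Nat.card_Icc, Nat.add_sub_cancel]
      gcongr
    · intro x hx
      obtain ⟨⟨a, ha⟩, y, hy, rfl⟩ := mem_iUnion.1 (hE hx)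
      obtain ⟨d, hd, z, hz, rfl⟩ := mem_digitSet_iff.1 hy
      refine mem_iUnion.2 ⟨⟨a + (p : ℤ_[p]) ^ n * d,
        Finset.mem_image.2 ⟨(a, d), by simpa [ha] using hd, rfl⟩⟩, z, hz, ?_⟩
      simp only
      ring

lemma hausdorffMeasure_digitSet_lt_top (hq : 2 ≤ q) :
    μH[Real.logb p q] (digitSet p q) < ∞ := by
  choose s hs hE using exists_finset_digitSet_subset (p := p) (q := q)
  have hb (n : ℕ) : ENNReal.ofReal ‖(p : ℤ_[p]) ^ n‖ = ENNReal.ofReal (p : ℝ)⁻¹ ^ n := by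
    rw [norm_pow, norm_p, ENNReal.ofReal_pow (by positivity)]
  have hlt : ENNReal.ofReal (p : ℝ)⁻¹ < 1 := by
    rw [ENNReal.ofReal_lt_one]
    exact inv_lt_one_of_one_lt₀ (by exact_mod_cast hp.out.one_lt)
  refine (Measure.hausdorffMeasure_le_liminf_sum (Real.logb p q) (digitSet p q) (l := atTop)
    (fun n => ENNReal.ofReal ‖(p : ℤ_[p]) ^ n‖) ?_
    (fun n (a : s n) => (fun y => (a : ℤ_[p]) + (p : ℤ_[p]) ^ n * y) '' digitSet p q)
    (.of_forall fun n a => ediam_image_add_mul_le _ _ _) (.of_forall hE)).trans_lt ?_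
  · simp_rw [hb]
    exact ENNReal.tendsto_pow_atTop_nhds_zero_of_lt_one hlt
  · refine lt_of_le_of_lt (b := 1) ?_ ENNReal.one_lt_top
    refine liminf_le_of_frequently_le (.of_forall fun n => ?_)
    calc _ ≤ ∑ _ : s n, ENNReal.ofReal ‖(p : ℤ_[p]) ^ n‖ ^ Real.logb p q := by
          gcongr
          · exact (logb_pos hq).le
          · exact ediam_image_add_mul_le _ _ _
      _ = (s n).card * ENNReal.ofReal ((q : ℝ) ^ n)⁻¹ := by
          rw [Finset.sum_const, Finset.card_univ, Fintype.card_coe, nsmul_eq_mul,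
            ENNReal.ofReal_rpow_of_nonneg (norm_nonneg _) (logb_pos hq).le, norm_pow, norm_p,
            ← Real.rpow_natCast, ← Real.rpow_mul (by positivity), mul_comm (n : ℝ),
            Real.rpow_mul (by positivity), Real.inv_rpow (by positivity), rpow_logb_self hq,
            Real.rpow_natCast, inv_pow]
      _ ≤ (q ^ n : ℕ) * ENNReal.ofReal ((q : ℝ) ^ n)⁻¹ := by
          gcongr
          exact hs n
      _ = 1 := by
          rw [← ENNReal.ofReal_natCast, ← ENNReal.ofReal_mul (by positivity)]
          push_cast
          rw [mul_inv_cancel₀ (by positivity), ENNReal.ofReal_one]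

lemma hausdorffMeasure_digitSet_pos (hq : 2 ≤ q) (hpq : q < p) :
    0 < μH[Real.logb p q] (digitSet p q) := by
  have hinj {ω ω' : ℕ → Fin q} (h : ofSuccDigits p ω = ofSuccDigits p ω') : ω = ω' :=
    funext fun i => digits_eq_of_pow_dvd hpq (i + 1) (by rw [h, sub_self]; exact dvd_zero _) i
      i.lt_succ_self
  have : Nonempty (Fin q) := ⟨⟨0, by omega⟩⟩
  let g : ℤ_[p] → ℝ := fun x => Real.ofDigits (Function.invFun (ofSuccDigits p (q := q)) x)
  have hg (ω : ℕ → Fin q) : g (ofSuccDigits p ω) = Real.ofDigits ω :=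
    congrArg Real.ofDigits (Function.leftInverse_invFun (fun _ _ => hinj) ω)
  have hholder : HolderOnWith 1 (Real.logb p q).toNNReal g (digitSet p q) := by
    rintro _ ⟨ω, rfl⟩ _ ⟨ω', rfl⟩
    rw [hg, hg, ENNReal.coe_one, one_mul, Real.coe_toNNReal _ (logb_pos hq).le, edist_dist,
      edist_dist, ENNReal.ofReal_rpow_of_nonneg dist_nonneg (logb_pos hq).le]
    refine ENNReal.ofReal_le_ofReal ?_
    rw [Real.dist_eq, dist_eq_norm]
    rcases eq_or_ne (ofSuccDigits p ω - ofSuccDigits p ω') 0 with h | h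
    · rw [hinj (sub_eq_zero.1 h), sub_self, abs_zero]
      positivity
    · set n := (ofSuccDigits p ω - ofSuccDigits p ω').valuation with hn
      have h1 := norm_eq_zpow_neg_valuation h
      have h2 := digits_eq_of_pow_dvd hpq n (ω := ω) (ω' := ω') <| by
        rw [← Ideal.mem_span_singleton, mem_span_pow_iff_le_valuation _ h]
      refine (Real.abs_ofDigits_sub_ofDigits_le h2).trans_eq ?_
      rw [h1, ← hn, zpow_neg, zpow_natCast, Real.inv_rpow (by positivity),
        ← Real.rpow_natCast (p : ℝ) n, ← Real.rpow_mul (by positivity), mul_comm,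
        Real.rpow_mul (by positivity), rpow_logb_self hq, Real.rpow_natCast]
  have h := hholder.hausdorffMeasure_image_le (d := 1)
    (Real.toNNReal_pos.2 (logb_pos hq)) zero_le_one
  rw [ENNReal.coe_one, ENNReal.one_rpow, one_mul, mul_one, Real.coe_toNNReal _ (logb_pos hq).le]
    at h
  refine lt_of_lt_of_le ?_ h
  have hsub : Icc (0 : ℝ) 1 ⊆ g '' digitSet p q := by
    intro y hy
    obtain ⟨ω, -, rfl⟩ := Real.ofDigits_SurjOn (b := q) (by omega) hy
    exact ⟨_, ⟨ω, rfl⟩, hg ω⟩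
  refine lt_of_lt_of_le ?_ (measure_mono hsub)
  rw [hausdorffMeasure_real]
  simp

lemma hausdorffMeasure_image_p_mul (hq : 2 ≤ q) (s : Set ℤ_[p]) :
    μH[Real.logb p q] ((fun y => (p : ℤ_[p]) * y) '' s) = (q : ℝ≥0∞)⁻¹ * μH[Real.logb p q] s := by
  have ht := (logb_pos (p := p) hq).le
  have hd (x y : ℤ_[p]) :
      edist ((p : ℤ_[p]) * x) (p * y) = ((p : NNReal)⁻¹ : NNReal) * edist x y := by
    rw [edist_dist, edist_dist, dist_eq_norm, dist_eq_norm, ← mul_sub, norm_mul, norm_p,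
      ENNReal.ofReal_mul (by positivity), ENNReal.ofReal, Real.toNNReal_inv, Real.toNNReal_natCast]
  have hp0 : (p : NNReal) ≠ 0 := by exact_mod_cast hp.out.ne_zero
  have h1 : LipschitzWith (p : NNReal)⁻¹ fun y : ℤ_[p] => (p : ℤ_[p]) * y := fun x y => (hd x y).le
  have h2 : AntilipschitzWith (p : NNReal) fun y : ℤ_[p] => (p : ℤ_[p]) * y := fun x y => by
    rw [hd, ← mul_assoc, ← ENNReal.coe_mul, mul_inv_cancel₀ hp0, ENNReal.coe_one, one_mul]
  have hr : ((p : NNReal) : ℝ≥0∞) ^ Real.logb p q = q := by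
    rw [← ENNReal.coe_rpow_of_nonneg _ ht]
    have : (p : NNReal) ^ Real.logb p q = q := by
      ext
      push_cast
      exact rpow_logb_self (p := p) hq
    rw [this, ENNReal.coe_natCast]
  have h3 := h1.hausdorffMeasure_image_le ht s
  have h4 := h2.le_hausdorffMeasure_image ht s
  rw [ENNReal.coe_inv hp0, ENNReal.inv_rpow, hr] at h3
  rw [hr] at h4
  refine h3.antisymm ?_
  have hq0 : (q : ℝ≥0∞) ≠ 0 := by exact_mod_cast (by omega : q ≠ 0)
  exact (ENNReal.inv_mul_le_iff hq0 (ENNReal.natCast_ne_top q)).2 h4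

/-- The contraction `y ↦ a + pⁿ y` of the `p`-adic integers. -/
noncomputable def branch (a n : ℕ) (y : ℤ_[p]) : ℤ_[p] := a + (p : ℤ_[p]) ^ n * y

lemma branch_branch (a n d m : ℕ) (y : ℤ_[p]) :
    branch a n (branch d m y) = branch (a + p ^ n * d) (n + m) y := by
  simp only [branch]
  push_cast
  ring

lemma p_pow_ne_zero (n : ℕ) : (p : ℤ_[p]) ^ n ≠ 0 :=
  pow_ne_zero _ (by exact_mod_cast hp.out.ne_zero)

lemma continuous_branch (a n : ℕ) : Continuous (branch (p := p) a n) := by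
  unfold branch
  fun_prop

lemma branch_injective (a n : ℕ) : Function.Injective (branch (p := p) a n) := fun _ _ h =>
  mul_left_cancel₀ (p_pow_ne_zero n) (add_left_cancel h)

lemma measurableEmbedding_branch (a n : ℕ) : MeasurableEmbedding (branch (p := p) a n) :=
  ((continuous_branch a n).isClosedEmbedding (branch_injective a n)).measurableEmbedding

lemma pow_dvd_intCast_iff {n : ℕ} {k : ℤ} : (p : ℤ_[p]) ^ n ∣ (k : ℤ_[p]) ↔ (p : ℤ) ^ n ∣ k := by
  rw [← norm_int_le_pow_iff_dvd, norm_le_pow_iff_mem_span_pow, Ideal.mem_span_singleton]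

lemma branch_left_cancel {a b n : ℕ} (ha : a < p ^ n) (hb : b < p ^ n) {x y : ℤ_[p]}
    (h : branch a n x = branch b n y) : a = b := by
  have h1 : (p : ℤ_[p]) ^ n ∣ ((a - b : ℤ) : ℤ_[p]) := ⟨y - x, by
    simp only [branch] at h
    push_cast
    linear_combination h⟩
  rw [pow_dvd_intCast_iff] at h1
  have := Int.eq_zero_of_abs_lt_dvd h1 (by rw [abs_lt]; constructor <;> zify at ha hb <;> omega)
  omega

/-- The image of the digit set under the contraction `y ↦ a + pⁿ y`. -/
def level (p q : ℕ) [Fact p.Prime] (a n : ℕ) : Set ℤ_[p] := branch a n '' digitSet p q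

lemma measurableSet_digitSet : MeasurableSet (digitSet p q) :=
  isCompact_digitSet.isClosed.measurableSet

lemma measurableSet_level (a n : ℕ) : MeasurableSet (level p q a n) :=
  (measurableEmbedding_branch a n).measurableSet_image.2 measurableSet_digitSet

lemma level_eq_biUnion (a n : ℕ) :
    level p q a n = ⋃ d ∈ Finset.Icc 1 q, level p q (a + p ^ n * d) (n + 1) := by
  ext x
  simp only [mem_iUnion]
  constructor
  · rintro ⟨y, hy, rfl⟩
    obtain ⟨d, hd, z, hz, rfl⟩ := mem_digitSet_iff.1 hy
    exact ⟨d, hd, z, hz, by rw [← branch_branch]; simp [branch]⟩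
  · rintro ⟨d, hd, z, hz, rfl⟩
    exact ⟨_, mem_digitSet_iff.2 ⟨d, hd, z, hz, rfl⟩, by rw [← branch_branch]; simp [branch]⟩

/-- The `p`-adic integers whose digits from the `n`-th one on all lie in `{1, …, q}`. -/
def tower (p q : ℕ) [Fact p.Prime] (n : ℕ) : Set ℤ_[p] :=
  ⋃ a ∈ Finset.range (p ^ n), level p q a n

lemma mem_tower_iff {n : ℕ} {x : ℤ_[p]} :
    x ∈ tower p q n ↔ ∃ a < p ^ n, ∃ y ∈ digitSet p q, branch a n y = x := by
  simp [tower, level]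

lemma measurableSet_tower (n : ℕ) : MeasurableSet (tower p q n) :=
  Finset.measurableSet_biUnion _ fun _ _ => measurableSet_level _ _

lemma add_pow_mul_lt {p a n d : ℕ} (ha : a < p ^ n) (hd : d < p) :
    a + p ^ n * d < p ^ (n + 1) := by
  calc a + p ^ n * d < p ^ n * (d + 1) := by rw [mul_add_one]; omega
    _ ≤ p ^ (n + 1) := by rw [pow_succ]; gcongr; omega

lemma tower_mono (hpq : q < p) : Monotone (tower p q) := by
  refine monotone_nat_of_le_succ fun n x hx => ?_
  obtain ⟨a, ha, y, hy, rfl⟩ := mem_tower_iff.1 hx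
  obtain ⟨d, hd, z, hz, rfl⟩ := mem_digitSet_iff.1 hy
  rw [Finset.mem_Icc] at hd
  refine mem_tower_iff.2 ⟨a + p ^ n * d, add_pow_mul_lt ha (by omega), z, hz, ?_⟩
  rw [← branch_branch]
  simp [branch]

/-- The `p`-adic integers all but finitely many of whose digits lie in `{1, …, q}`. -/
def eventualDigitSet (p q : ℕ) [Fact p.Prime] : Set ℤ_[p] := ⋃ n, tower p q n

lemma measurableSet_eventualDigitSet : MeasurableSet (eventualDigitSet p q) :=
  .iUnion measurableSet_tower

lemma add_one_mem_eventualDigitSet (hpq : q + 1 < p) {x : ℤ_[p]}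
    (hx : x ∈ eventualDigitSet p q) : x + 1 ∈ eventualDigitSet p q := by
  obtain ⟨n, hn⟩ := mem_iUnion.1 hx
  obtain ⟨a, ha, y, hy, rfl⟩ := mem_tower_iff.1 hn
  obtain ⟨d, hd, z, hz, rfl⟩ := mem_digitSet_iff.1 hy
  rw [Finset.mem_Icc] at hd
  refine mem_iUnion.2 ⟨n + 1, mem_tower_iff.2 ⟨a + 1 + p ^ n * d, ?_, z, hz, ?_⟩⟩
  · have := add_pow_mul_lt (p := p) (n := n) (d := d + 1) (a := 0)
      (Nat.pow_pos hp.out.pos) (by omega)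
    rw [mul_add_one] at this
    omega
  · simp only [branch]
    push_cast
    ring

lemma sub_one_mem_eventualDigitSet (hpq : q < p) {x : ℤ_[p]}
    (hx : x ∈ eventualDigitSet p q) : x - 1 ∈ eventualDigitSet p q := by
  obtain ⟨n, hn⟩ := mem_iUnion.1 hx
  obtain ⟨a, ha, y, hy, rfl⟩ := mem_tower_iff.1 hn
  obtain ⟨d, hd, z, hz, rfl⟩ := mem_digitSet_iff.1 hy
  rw [Finset.mem_Icc] at hd
  have h1 : 1 ≤ p ^ n * d := Nat.mul_pos (by have := hp.out.pos; positivity) (by omega)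
  refine mem_iUnion.2 ⟨n + 1, mem_tower_iff.2 ⟨a + p ^ n * d - 1, ?_, z, hz, ?_⟩⟩
  · have := add_pow_mul_lt (p := p) ha (d := d) (by omega)
    omega
  · simp only [branch]
    rw [Nat.cast_sub (by omega)]
    push_cast
    ring

lemma add_one_mem_eventualDigitSet_iff (hpq : q + 1 < p) {x : ℤ_[p]} :
    x + 1 ∈ eventualDigitSet p q ↔ x ∈ eventualDigitSet p q :=
  ⟨fun h => by simpa using sub_one_mem_eventualDigitSet (by omega) h,
    add_one_mem_eventualDigitSet hpq⟩

lemma natCast_add_mem_eventualDigitSet_iff (hpq : q + 1 < p) (a : ℕ) {x : ℤ_[p]} :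
    (a : ℤ_[p]) + x ∈ eventualDigitSet p q ↔ x ∈ eventualDigitSet p q := by
  induction a with
  | zero => simp
  | succ a ih =>
    rw [← ih, ← add_one_mem_eventualDigitSet_iff hpq (x := a + x)]
    push_cast
    rw [add_right_comm]

lemma p_mul_mem_eventualDigitSet_iff (hpq : q < p) {x : ℤ_[p]} :
    (p : ℤ_[p]) * x ∈ eventualDigitSet p q ↔ x ∈ eventualDigitSet p q := by
  constructor <;> intro hx <;> obtain ⟨n, hn⟩ := mem_iUnion.1 hx
  · obtain ⟨a, ha, y, hy, h⟩ := mem_tower_iff.1 (tower_mono hpq (Nat.le_add_right n 1) hn)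
    have hdvd : (p : ℤ_[p]) ^ 1 ∣ ((a : ℤ) : ℤ_[p]) := ⟨x - p ^ n * y, by
      simp only [branch] at h
      push_cast
      linear_combination h⟩
    rw [pow_dvd_intCast_iff, pow_one, Int.natCast_dvd_natCast] at hdvd
    obtain ⟨b, rfl⟩ := hdvd
    refine mem_iUnion.2 ⟨n, mem_tower_iff.2 ⟨b, ?_, y, hy, ?_⟩⟩
    · rw [pow_succ'] at ha
      exact lt_of_mul_lt_mul_left ha (zero_le)
    · refine mul_left_cancel₀ (p_pow_ne_zero 1) ?_
      rw [pow_one, ← h]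
      simp only [branch]
      push_cast
      ring
  · obtain ⟨a, ha, y, hy, rfl⟩ := mem_tower_iff.1 hn
    refine mem_iUnion.2 ⟨n + 1, mem_tower_iff.2 ⟨p * a, ?_, y, hy, ?_⟩⟩
    · rw [pow_succ']
      exact Nat.mul_lt_mul_of_pos_left ha hp.out.pos
    · simp only [branch]
      push_cast
      ring

/-- The Hausdorff measure of dimension `log q / log p` on the `p`-adic integers all but finitely
many of whose digits lie in `{1, …, q}`. -/
noncomputable def digitMeasure (p q : ℕ) [Fact p.Prime] : Measure ℤ_[p] :=
  (μH[Real.logb p q]).restrict (eventualDigitSet p q)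

lemma digitMeasure_apply (s : Set ℤ_[p]) :
    digitMeasure p q s = μH[Real.logb p q] (s ∩ eventualDigitSet p q) :=
  Measure.restrict_apply' measurableSet_eventualDigitSet

lemma measurePreserving_addRight_one (hpq : q + 1 < p) :
    MeasurePreserving (MeasurableEquiv.addRight (1 : ℤ_[p])) (digitMeasure p q)
      (digitMeasure p q) := by
  have h := ((IsometryEquiv.addRight (1 : ℤ_[p])).measurePreserving_hausdorffMeasure
    (Real.logb p q)).restrict_preimage (measurableSet_eventualDigitSet (p := p) (q := q))
  have : IsometryEquiv.addRight (1 : ℤ_[p]) ⁻¹' eventualDigitSet p q = eventualDigitSet p q :=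
    Set.ext fun x => add_one_mem_eventualDigitSet_iff hpq
  rw [this] at h
  exact h

lemma digitMeasure_image_branch (hq : 2 ≤ q) (hpq : q + 1 < p) (a n : ℕ) (s : Set ℤ_[p]) :
    digitMeasure p q (branch a n '' s) = (q : ℝ≥0∞)⁻¹ ^ n * digitMeasure p q s := by
  have hadd (a : ℕ) (s : Set ℤ_[p]) :
      digitMeasure p q ((fun y => (a : ℤ_[p]) + y) '' s) = digitMeasure p q s := by
    have h : (fun y => (a : ℤ_[p]) + y) ⁻¹' eventualDigitSet p q = eventualDigitSet p q :=
      Set.ext fun y => natCast_add_mem_eventualDigitSet_iff hpq a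
    rw [digitMeasure_apply, digitMeasure_apply, ← image_inter_preimage, h]
    exact (IsometryEquiv.addLeft (a : ℤ_[p])).hausdorffMeasure_image _ _
  have hmul (s : Set ℤ_[p]) : digitMeasure p q ((fun y => (p : ℤ_[p]) * y) '' s) =
      (q : ℝ≥0∞)⁻¹ * digitMeasure p q s := by
    have h : (fun y => (p : ℤ_[p]) * y) ⁻¹' eventualDigitSet p q = eventualDigitSet p q :=
      Set.ext fun y => p_mul_mem_eventualDigitSet_iff (by omega)
    rw [digitMeasure_apply, digitMeasure_apply, ← image_inter_preimage, h,
      hausdorffMeasure_image_p_mul hq]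
  induction n generalizing s with
  | zero =>
    have h : branch a 0 = fun y : ℤ_[p] => (a : ℤ_[p]) + y := funext fun y => by simp [branch]
    rw [h, hadd, pow_zero, one_mul]
  | succ n ih =>
    rw [pow_succ, mul_assoc, ← hmul, ← ih, image_image]
    simp only [branch, pow_succ, mul_assoc, image]

lemma digitMeasure_biUnion_branch (hq : 2 ≤ q) (hpq : q + 1 < p) (n : ℕ) (s : Finset ℕ)
    (hs : ∀ a ∈ s, a < p ^ n) {G : ℕ → Set ℤ_[p]} (hG : ∀ a ∈ s, MeasurableSet (G a)) :
    digitMeasure p q (⋃ a ∈ s, branch a n '' G a) =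
      ∑ a ∈ s, (q : ℝ≥0∞)⁻¹ ^ n * digitMeasure p q (G a) := by
  rw [measure_biUnion_finset]
  · simp_rw [digitMeasure_image_branch hq hpq]
  · intro a ha b hb hab
    refine disjoint_left.2 ?_
    rintro _ ⟨x, -, rfl⟩ ⟨y, -, h⟩
    exact hab (branch_left_cancel (hs _ hb) (hs _ ha) h).symm
  · exact fun a ha => (measurableEmbedding_branch a n).measurableSet_image.2 (hG a ha)

lemma digitMeasure_digitSet_inter (hq : 2 ≤ q) (hpq : q + 1 < p) {S : Set ℤ_[p]}
    (hS : MeasurableSet S) :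
    digitMeasure p q (digitSet p q ∩ S) =
      ∑ d ∈ Finset.Icc 1 q, (q : ℝ≥0∞)⁻¹ * digitMeasure p q (digitSet p q ∩ branch d 1 ⁻¹' S) := by
  have : digitSet p q ∩ S =
      ⋃ d ∈ Finset.Icc 1 q, branch d 1 '' (digitSet p q ∩ branch d 1 ⁻¹' S) := by
    ext x
    simp only [mem_iUnion]
    constructor
    · rintro ⟨hx, hxS⟩
      obtain ⟨d, hd, y, hy, rfl⟩ := mem_digitSet_iff.1 hx
      exact ⟨d, hd, y, ⟨hy, by simpa [branch] using hxS⟩, by simp [branch]⟩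
    · rintro ⟨d, hd, y, ⟨hy, hyS⟩, rfl⟩
      exact ⟨mem_digitSet_iff.2 ⟨d, hd, y, hy, by simp [branch]⟩, hyS⟩
  rw [this, digitMeasure_biUnion_branch hq hpq]
  · simp
  · intro d hd
    rw [Finset.mem_Icc] at hd
    rw [pow_one]
    omega
  · exact fun d _ => measurableSet_digitSet.inter ((continuous_branch d 1).measurable hS)

lemma digitSet_subset_eventualDigitSet : digitSet p q ⊆ eventualDigitSet p q := fun x hx =>
  mem_iUnion.2 ⟨0, mem_tower_iff.2 ⟨0, by simp, x, hx, by simp [branch]⟩⟩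

lemma digitMeasure_digitSet_pos (hq : 2 ≤ q) (hpq : q < p) :
    0 < digitMeasure p q (digitSet p q) := by
  rw [digitMeasure_apply, inter_eq_left.2 digitSet_subset_eventualDigitSet]
  exact hausdorffMeasure_digitSet_pos hq hpq

lemma digitMeasure_digitSet_lt_top (hq : 2 ≤ q) : digitMeasure p q (digitSet p q) < ∞ := by
  rw [digitMeasure_apply, inter_eq_left.2 digitSet_subset_eventualDigitSet]
  exact hausdorffMeasure_digitSet_lt_top hq

lemma digitMeasure_biUnion_level (hq : 2 ≤ q) (hpq : q + 1 < p) (n : ℕ) (s : Finset ℕ)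
    (hs : ∀ a ∈ s, a < p ^ n) :
    digitMeasure p q (⋃ a ∈ s, level p q a n) =
      s.card * ((q : ℝ≥0∞)⁻¹ ^ n * digitMeasure p q (digitSet p q)) := by
  rw [← nsmul_eq_mul, ← Finset.sum_const]
  exact digitMeasure_biUnion_branch hq hpq n s hs fun _ _ => measurableSet_digitSet

lemma digitMeasure_tower (hq : 2 ≤ q) (hpq : q + 1 < p) (n : ℕ) :
    digitMeasure p q (tower p q n) =
      (p ^ n : ℕ) * ((q : ℝ≥0∞)⁻¹ ^ n * digitMeasure p q (digitSet p q)) := by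
  rw [tower, digitMeasure_biUnion_level hq hpq n _ (by simp), Finset.card_range]

lemma digitMeasure_tower_lt_top (hq : 2 ≤ q) (hpq : q + 1 < p) (n : ℕ) :
    digitMeasure p q (tower p q n) < ∞ := by
  have hq0 : (q : ℝ≥0∞) ≠ 0 := by exact_mod_cast (by omega : q ≠ 0)
  rw [digitMeasure_tower hq hpq]
  exact ENNReal.mul_lt_top (ENNReal.natCast_lt_top _) (ENNReal.mul_lt_top
    (ENNReal.pow_lt_top (ENNReal.inv_lt_top.2 (pos_iff_ne_zero.2 hq0)))
    (digitMeasure_digitSet_lt_top hq))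

lemma one_sub_inv_eq (hq : 2 ≤ q) : 1 - (q : ℝ≥0∞)⁻¹ = (q - 1 : ℕ) * (q : ℝ≥0∞)⁻¹ := by
  have hq0 : (q : ℝ≥0∞) ≠ 0 := by exact_mod_cast (by omega : q ≠ 0)
  rw [ENNReal.natCast_sub, ENNReal.sub_mul (fun _ _ => ENNReal.inv_ne_top.2 hq0),
    ENNReal.mul_inv_cancel hq0 (ENNReal.natCast_ne_top q), Nat.cast_one, one_mul]

lemma measurableSet_preimage_sub {S : Set ℤ_[p]} (hS : MeasurableSet S) (c : ℤ_[p]) :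
    MeasurableSet ((fun x => x - c) ⁻¹' S) :=
  (by fun_prop : Continuous fun x : ℤ_[p] => x - c).measurable hS

lemma digitMeasure_overlap_p_mul (hq : 2 ≤ q) (hpq : q + 1 < p) (k : ℤ) :
    digitMeasure p q (digitSet p q ∩ (fun x => x - ((p * k : ℤ) : ℤ_[p])) ⁻¹' digitSet p q) =
      digitMeasure p q (digitSet p q ∩ (fun x => x - (k : ℤ_[p])) ⁻¹' digitSet p q) := by
  have hq0 : (q : ℝ≥0∞) ≠ 0 := by exact_mod_cast (by omega : q ≠ 0)
  rw [digitMeasure_digitSet_inter hq hpq (measurableSet_preimage_sub measurableSet_digitSet _)]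
  have (d : ℕ) (hd : d ∈ Finset.Icc 1 q) :
      branch d 1 ⁻¹' ((fun x => x - ((p * k : ℤ) : ℤ_[p])) ⁻¹' digitSet p q) =
        (fun x => x - (k : ℤ_[p])) ⁻¹' digitSet p q := by
    ext y
    have hd' := Finset.mem_Icc.1 hd
    have := natCast_add_mul_mem_digitSet_iff (p := p) (q := q) (by omega) (d := d) (by omega)
      (y := y - k)
    simp only [mem_preimage, branch, pow_one]
    rw [show (d : ℤ_[p]) + p * y - ((p * k : ℤ) : ℤ_[p]) = d + p * (y - k) by push_cast; ring,
      this]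
    simp only [hd, true_and]
  rw [Finset.sum_congr rfl fun d hd => by rw [this d hd], Finset.sum_const, Nat.card_Icc,
    Nat.add_sub_cancel, nsmul_eq_mul, ← mul_assoc,
    ENNReal.mul_inv_cancel hq0 (ENNReal.natCast_ne_top q), one_mul]

lemma digitMeasure_overlap_le (hq : 2 ≤ q) (hpq : 2 * q ≤ p) {k : ℤ} (hk : k ≠ 0) :
    digitMeasure p q (digitSet p q ∩ (fun x => x - (k : ℤ_[p])) ⁻¹' digitSet p q) ≤
      (1 - (q : ℝ≥0∞)⁻¹) * digitMeasure p q (digitSet p q) := by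
  induction hn : k.natAbs using Nat.strong_induction_on generalizing k with
  | _ n ih =>
  by_cases hdvd : (p : ℤ) ∣ k
  · obtain ⟨j, rfl⟩ := hdvd
    have hj : j ≠ 0 := right_ne_zero_of_mul hk
    rw [digitMeasure_overlap_p_mul hq (by omega)]
    refine ih j.natAbs ?_ hj rfl
    rw [← hn, Int.natAbs_mul, Int.natAbs_natCast]
    exact lt_mul_of_one_lt_left (Int.natAbs_pos.2 hj) hp.out.one_lt
  · have hp0 : (0 : ℤ) < p := by exact_mod_cast hp.out.pos
    obtain ⟨d₀, hd₀, hmod⟩ : ∃ d₀ ∈ Finset.Icc 1 q, ((d₀ - k) % p).toNat ∉ Finset.Icc 1 q := by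
      have h0 := Int.emod_nonneg k hp0.ne'
      have h1 := Int.emod_lt_of_pos k hp0
      have h2 : k % p ≠ 0 := fun h => hdvd (Int.dvd_of_emod_eq_zero h)
      have key (d : ℕ) : ((d : ℤ) - k) % p = (d - k % p) % p := by simp
      simp only [key, Finset.mem_Icc]
      rcases eq_or_ne (k % p) 1 with h | h
      · exact ⟨1, by omega, by simp [h]⟩
      · by_cases h' : k % p < p + 1 - q
        · refine ⟨1, by omega, ?_⟩
          rw [← Int.add_emod_right, Int.emod_eq_of_lt] <;> omega
        · refine ⟨q, by omega, ?_⟩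
          rw [← Int.add_emod_right, Int.emod_eq_of_lt] <;> omega
    rw [digitMeasure_digitSet_inter hq (by omega)
      (measurableSet_preimage_sub measurableSet_digitSet _),
      ← Finset.add_sum_erase _ _ hd₀]
    have hempty : digitSet p q ∩
        branch d₀ 1 ⁻¹' ((fun x => x - (k : ℤ_[p])) ⁻¹' digitSet p q) = ∅ := by
      refine eq_empty_of_forall_notMem fun y hy => hmod ?_
      have h0 := Int.emod_nonneg (d₀ - k) hp0.ne'
      have h1 := Int.emod_lt_of_pos (d₀ - k) hp0
      refine ((natCast_add_mul_mem_digitSet_iff (p := p) (q := q) (by omega)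
        (d := ((d₀ - k) % p).toNat) (by omega) (y := y + (((d₀ - k) / p : ℤ) : ℤ_[p]))).1 ?_).1
      have h2 : ((((d₀ - k) % p).toNat : ℤ) : ℤ_[p]) + p * (((d₀ - k) / p : ℤ) : ℤ_[p]) =
          (d₀ : ℤ_[p]) - k := by
        rw [Int.toNat_of_nonneg h0]
        exact_mod_cast congrArg (Int.cast (R := ℤ_[p])) (Int.emod_add_mul_ediv (d₀ - k) p)
      rw [Int.cast_natCast] at h2
      have hy' : branch d₀ 1 y - (k : ℤ_[p]) ∈ digitSet p q := hy.2
      convert hy' using 1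
      simp only [branch]
      linear_combination h2
    rw [hempty, measure_empty, mul_zero, zero_add, one_sub_inv_eq hq]
    calc _ ≤ ∑ d ∈ (Finset.Icc 1 q).erase d₀, (q : ℝ≥0∞)⁻¹ * digitMeasure p q (digitSet p q) := by
          gcongr
          exact inter_subset_left
      _ = _ := by
          rw [Finset.sum_const, Finset.card_erase_of_mem hd₀, Nat.card_Icc, Nat.add_sub_cancel,
            nsmul_eq_mul, mul_assoc]

lemma le_digitMeasure_overlap_pow (hq : 2 ≤ q) (hpq : q + 1 < p) (n : ℕ) :
    (1 - (q : ℝ≥0∞)⁻¹) * digitMeasure p q (digitSet p q) ≤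
      digitMeasure p q (digitSet p q ∩ (fun x => x - ((p ^ n : ℕ) : ℤ_[p])) ⁻¹' digitSet p q) := by
  induction n with
  | zero =>
    rw [digitMeasure_digitSet_inter hq hpq (measurableSet_preimage_sub measurableSet_digitSet _),
      one_sub_inv_eq hq]
    calc _ = ∑ d ∈ Finset.Icc 2 q, (q : ℝ≥0∞)⁻¹ * digitMeasure p q (digitSet p q) := by
          rw [Finset.sum_const, Nat.card_Icc, nsmul_eq_mul, mul_assoc,
            show q + 1 - 2 = q - 1 by omega]
      _ ≤ ∑ d ∈ Finset.Icc 2 q, (q : ℝ≥0∞)⁻¹ * digitMeasure p q (digitSet p q ∩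
          branch d 1 ⁻¹' ((fun x => x - ((p ^ 0 : ℕ) : ℤ_[p])) ⁻¹' digitSet p q)) := by
          gcongr with d hd
          refine subset_inter subset_rfl fun y hy => ?_
          rw [Finset.mem_Icc] at hd
          have := (natCast_add_mul_mem_digitSet_iff (p := p) (q := q) (by omega) (d := d - 1)
            (by omega) (y := y)).2 ⟨by rw [Finset.mem_Icc]; omega, hy⟩
          rw [Nat.cast_sub (by omega)] at this
          simp only [mem_preimage, branch, pow_one, pow_zero]
          convert this using 1
          ring
      _ ≤ _ := Finset.sum_le_sum_of_subset (Finset.Icc_subset_Icc_left (by omega))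
  | succ n ih =>
    have := digitMeasure_overlap_p_mul hq hpq ((p ^ n : ℕ) : ℤ)
    rw [pow_succ']
    push_cast at *
    rwa [this]

lemma digitMeasure_levels_overlap_le (hq : 2 ≤ q) (hpq : 2 * q ≤ p) {n : ℕ} {s : Finset ℕ}
    (hs : ∀ a ∈ s, a < p ^ n) {k : ℕ} (hk : p ^ n ≤ k) :
    digitMeasure p q ((⋃ a ∈ s, level p q a n) ∩
      (fun x => x - (k : ℤ_[p])) ⁻¹' ⋃ a ∈ s, level p q a n) ≤
      (1 - (q : ℝ≥0∞)⁻¹) * digitMeasure p q (⋃ a ∈ s, level p q a n) := by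
  set B := ⋃ a ∈ s, level p q a n with hB
  have hBm : MeasurableSet B := Finset.measurableSet_biUnion _ fun _ _ => measurableSet_level _ _
  let G : ℕ → Set ℤ_[p] := fun a =>
    digitSet p q ∩ branch a n ⁻¹' ((fun x => x - (k : ℤ_[p])) ⁻¹' B)
  have hsub : B ∩ (fun x => x - (k : ℤ_[p])) ⁻¹' B ⊆ ⋃ a ∈ s, branch a n '' G a := by
    rintro x ⟨hx, hxk⟩
    obtain ⟨a, ha, y, hy, rfl⟩ := mem_iUnion₂.1 hx
    exact mem_iUnion₂.2 ⟨a, ha, y, ⟨hy, hxk⟩, rfl⟩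
  have hG (a : ℕ) (ha : a ∈ s) :
      digitMeasure p q (G a) ≤ (1 - (q : ℝ≥0∞)⁻¹) * digitMeasure p q (digitSet p q) := by
    rcases (G a).eq_empty_or_nonempty with h | ⟨y, -, hy⟩
    · simp [h]
    obtain ⟨b, hb, z, -, hz⟩ := mem_iUnion₂.1 hy
    obtain ⟨j, hj⟩ : (p : ℤ) ^ n ∣ b + k - a := pow_dvd_intCast_iff.1 ⟨y - z, by
      simp only [branch] at hz
      push_cast
      linear_combination hz⟩
    have hj0 : j ≠ 0 := by
      rintro rfl
      have := hs a ha
      omega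
    refine le_trans (measure_mono ?_) (digitMeasure_overlap_le hq hpq hj0)
    rintro x ⟨hx, hxk⟩
    refine ⟨hx, ?_⟩
    obtain ⟨c, hc, w, hw, hwx⟩ := mem_iUnion₂.1 hxk
    have hj' := congrArg (Int.cast (R := ℤ_[p])) hj
    push_cast at hj'
    have h : branch c n w = branch b n (x - (j : ℤ_[p])) := by
      simp only [branch] at hwx ⊢
      linear_combination hwx - hj'
    obtain rfl := branch_left_cancel (hs c hc) (hs b hb) h
    rwa [branch_injective c n h] at hw
  calc _ ≤ ∑ a ∈ s, (q : ℝ≥0∞)⁻¹ ^ n * digitMeasure p q (G a) := by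
        rw [← digitMeasure_biUnion_branch hq (by omega) n s hs fun a _ =>
          measurableSet_digitSet.inter ((continuous_branch a n).measurable
            (measurableSet_preimage_sub hBm _))]
        exact measure_mono hsub
    _ ≤ ∑ a ∈ s, (q : ℝ≥0∞)⁻¹ ^ n * ((1 - (q : ℝ≥0∞)⁻¹) * digitMeasure p q (digitSet p q)) := by
        gcongr with a ha
        exact hG a ha
    _ = _ := by
        rw [hB, digitMeasure_biUnion_level hq (by omega) n s hs, Finset.sum_const, nsmul_eq_mul]
        ring

lemma le_digitMeasure_levels_overlap (hq : 2 ≤ q) (hpq : q + 1 < p) {n : ℕ} {s : Finset ℕ}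
    (hs : ∀ a ∈ s, a < p ^ n) {m : ℕ} (hm : n ≤ m) :
    (1 - (q : ℝ≥0∞)⁻¹) * digitMeasure p q (⋃ a ∈ s, level p q a n) ≤
    digitMeasure p q ((⋃ a ∈ s, level p q a n) ∩
      (fun x => x - ((p ^ m : ℕ) : ℤ_[p])) ⁻¹' ⋃ a ∈ s, level p q a n) := by
  set G := digitSet p q ∩ (fun x => x - ((p ^ (m - n) : ℕ) : ℤ_[p])) ⁻¹' digitSet p q
  calc _ = ∑ a ∈ s, (q : ℝ≥0∞)⁻¹ ^ n * ((1 - (q : ℝ≥0∞)⁻¹) * digitMeasure p q (digitSet p q)) := by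
        rw [digitMeasure_biUnion_level hq hpq n s hs, Finset.sum_const, nsmul_eq_mul]
        ring
    _ ≤ ∑ a ∈ s, (q : ℝ≥0∞)⁻¹ ^ n * digitMeasure p q G := by
        gcongr
        exact le_digitMeasure_overlap_pow hq hpq _
    _ = digitMeasure p q (⋃ a ∈ s, branch a n '' G) :=
        (digitMeasure_biUnion_branch hq hpq n s hs fun a _ =>
          measurableSet_digitSet.inter (measurableSet_preimage_sub measurableSet_digitSet _)).symm
    _ ≤ _ := by
        refine measure_mono fun x hx => ?_
        obtain ⟨a, ha, y, ⟨hy, hy'⟩, rfl⟩ := mem_iUnion₂.1 hx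
        refine ⟨mem_iUnion₂.2 ⟨a, ha, y, hy, rfl⟩, mem_iUnion₂.2 ⟨a, ha, _, hy', ?_⟩⟩
        simp only [branch]
        obtain ⟨j, rfl⟩ := Nat.exists_eq_add_of_le hm
        rw [Nat.add_sub_cancel_left, pow_add]
        push_cast
        ring

lemma exists_tower_eq_biUnion_level (hpq : q < p) {m n : ℕ} (hmn : m ≤ n) :
    ∃ s : Finset ℕ, (∀ a ∈ s, a < p ^ n) ∧ tower p q m = ⋃ a ∈ s, level p q a n := by
  induction n, hmn using Nat.le_induction with
  | base => exact ⟨Finset.range (p ^ m), by simp, rfl⟩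
  | succ n _ ih =>
    obtain ⟨s, hs, h⟩ := ih
    refine ⟨(s ×ˢ Finset.Icc 1 q).image fun x => x.1 + p ^ n * x.2, ?_, ?_⟩
    · simp only [Finset.mem_image, Finset.mem_product, Finset.mem_Icc, forall_exists_index,
        and_imp]
      rintro _ ⟨a, d⟩ ha - hd rfl
      exact add_pow_mul_lt (hs a ha) (by dsimp at hd; omega)
    · rw [h, Finset.set_biUnion_finset_image]
      ext x
      simp only [mem_iUnion, level_eq_biUnion (n := n), Finset.mem_product, Prod.exists]
      constructor
      · rintro ⟨a, ha, d, hd, hx⟩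
        exact ⟨a, d, ⟨ha, hd⟩, hx⟩
      · rintro ⟨a, d, ⟨ha, hd⟩, hx⟩
        exact ⟨a, ha, d, hd, hx⟩

lemma exists_levels_approx (hq : 2 ≤ q) (hpq : q + 1 < p) {A : Set ℤ_[p]} (hA : MeasurableSet A)
    (hfin : digitMeasure p q A ≠ ∞) {ε : ℝ≥0∞} (hε : ε ≠ 0) :
    ∃ (n : ℕ) (s : Finset ℕ), (∀ a ∈ s, a < p ^ n) ∧
      digitMeasure p q (A \ ⋃ a ∈ s, level p q a n) ≤ ε ∧
      digitMeasure p q ((⋃ a ∈ s, level p q a n) \ A) ≤ ε := by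
  have hε2 : ε / 2 ≠ 0 := (ENNReal.half_pos hε).ne'
  obtain ⟨m, hm⟩ : ∃ m, digitMeasure p q (A \ tower p q m) < ε / 2 := by
    have h := tendsto_measure_iInter_atTop (μ := digitMeasure p q)
      (s := fun m => A \ tower p q m)
      (fun m => (hA.diff (measurableSet_tower m)).nullMeasurableSet)
      (fun m n hmn => sdiff_subset_sdiff_right (tower_mono (by omega) hmn))
      ⟨0, measure_ne_top_of_subset sdiff_subset hfin⟩
    have h0 : digitMeasure p q (⋂ m, A \ tower p q m) = 0 := by
      rw [← sdiff_iUnion, digitMeasure_apply]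
      exact (congrArg _ disjoint_sdiff_left.inter_eq).trans measure_empty
    rw [h0] at h
    exact (h.eventually_lt_const (pos_iff_ne_zero.2 hε2)).exists
  have : IsFiniteMeasure ((digitMeasure p q).restrict (tower p q m)) :=
    ⟨by simpa using digitMeasure_tower_lt_top hq hpq m⟩
  obtain ⟨C, hCA, hC, hCε⟩ := hA.exists_isCompact_sdiff_lt
    (μ := (digitMeasure p q).restrict (tower p q m)) (measure_ne_top _ _) hε2
  obtain ⟨U, hAU, hU, -, hUε⟩ := hA.exists_isOpen_sdiff_lt
    (μ := (digitMeasure p q).restrict (tower p q m)) (measure_ne_top _ _) hε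
  obtain ⟨δ, hδ, hCU⟩ := hC.exists_thickening_subset_open hU (hCA.trans hAU)
  obtain ⟨n₀, hn₀⟩ := exists_pow_lt_of_lt_one hδ
    (inv_lt_one_of_one_lt₀ (by exact_mod_cast hp.out.one_lt : (1 : ℝ) < p))
  set n := max m n₀
  have hn : ((p : ℝ)⁻¹) ^ n < δ := lt_of_le_of_lt (pow_le_pow_of_le_one (by positivity)
    (inv_le_one_of_one_le₀ (by exact_mod_cast hp.out.one_lt.le)) (le_max_right _ _)) hn₀
  obtain ⟨t, ht, htower⟩ := exists_tower_eq_biUnion_level (p := p) (q := q) (by omega)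
    (le_max_left m n₀)
  have hsat {a : ℕ} {y z : ℤ_[p]} (h : branch a n y ∈ Metric.thickening δ C) :
      branch a n z ∈ Metric.thickening δ C := by
    obtain ⟨c, hc, hd⟩ := Metric.mem_thickening_iff.1 h
    refine Metric.mem_thickening_iff.2 ⟨c, hc, ?_⟩
    refine lt_of_le_of_lt (dist_triangle_max _ (branch a n y) _) (max_lt ?_ hd)
    refine lt_of_le_of_lt ?_ hn
    rw [dist_eq_norm, branch, branch, add_sub_add_left_eq_sub, ← mul_sub, norm_mul, norm_pow,
      norm_p]
    exact mul_le_of_le_one_right (by positivity) (norm_le_one _)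
  classical
  let s := t.filter fun a => (level p q a n ∩ Metric.thickening δ C).Nonempty
  have hs : ⋃ a ∈ s, level p q a n = Metric.thickening δ C ∩ tower p q m := by
    rw [htower]
    ext x
    simp only [mem_iUnion, mem_inter_iff, s, Finset.mem_filter]
    constructor
    · rintro ⟨a, ⟨ha, _, ⟨y, hy, rfl⟩, h⟩, z, hz, rfl⟩
      exact ⟨hsat h, a, ha, z, hz, rfl⟩
    · rintro ⟨hx, a, ha, hxa⟩
      exact ⟨a, ⟨ha, x, hxa, hx⟩, hxa⟩
  refine ⟨n, s, fun a ha => ht a (Finset.mem_filter.1 ha).1, ?_, ?_⟩ <;> rw [hs]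
  · have hsub : A \ (Metric.thickening δ C ∩ tower p q m) ⊆
        A \ tower p q m ∪ (A \ C) ∩ tower p q m := by
      rintro x ⟨hx, hx'⟩
      by_cases hxt : x ∈ tower p q m
      · exact .inr ⟨⟨hx, fun hxC => hx' ⟨Metric.self_subset_thickening hδ C hxC, hxt⟩⟩, hxt⟩
      · exact .inl ⟨hx, hxt⟩
    rw [Measure.restrict_apply' (measurableSet_tower m)] at hCε
    calc _ ≤ _ := measure_mono hsub
      _ ≤ _ := measure_union_le _ _
      _ ≤ ε / 2 + ε / 2 := add_le_add hm.le hCε.le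
      _ = ε := ENNReal.add_halves ε
  · rw [Measure.restrict_apply' (measurableSet_tower m)] at hUε
    refine (measure_mono ?_).trans hUε.le
    rintro x ⟨⟨hx, hxt⟩, hxA⟩
    exact ⟨⟨hCU hx, hxA⟩, hxt⟩

lemma digitMeasure_preimage_sub (hq : 2 ≤ q) (hpq : q + 1 < p) (k : ℕ) (S : Set ℤ_[p]) :
    digitMeasure p q ((fun x => x - (k : ℤ_[p])) ⁻¹' S) = digitMeasure p q S := by
  have h := digitMeasure_image_branch hq hpq k 0 S
  rw [pow_zero, one_mul] at h
  rw [← h]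
  congr 1
  ext x
  constructor
  · exact fun hx => ⟨_, hx, by simp [branch]⟩
  · rintro ⟨y, hy, rfl⟩
    simpa [branch] using hy

lemma digitMeasure_inter_preimage_sub_le (hq : 2 ≤ q) (hpq : q + 1 < p) (k : ℕ)
    (A B : Set ℤ_[p]) :
    digitMeasure p q (A ∩ (fun x => x - (k : ℤ_[p])) ⁻¹' A) ≤
      digitMeasure p q (B ∩ (fun x => x - (k : ℤ_[p])) ⁻¹' B) + 2 * digitMeasure p q (A \ B) := by
  have hsub : A ∩ (fun x => x - (k : ℤ_[p])) ⁻¹' A ⊆ (B ∩ (fun x => x - (k : ℤ_[p])) ⁻¹' B) ∪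
      (A \ B ∪ (fun x => x - (k : ℤ_[p])) ⁻¹' (A \ B)) := by
    rintro x ⟨h1, h2⟩
    simp only [mem_union, mem_inter_iff, mem_preimage, Set.mem_sdiff] at h2 ⊢
    tauto
  refine (measure_mono hsub).trans ((measure_union_le _ _).trans ?_)
  gcongr
  rw [two_mul]
  refine (measure_union_le _ _).trans_eq ?_
  rw [digitMeasure_preimage_sub hq hpq]

lemma digitMeasure_le_add_diff (A B : Set ℤ_[p]) :
    digitMeasure p q A ≤ digitMeasure p q B + digitMeasure p q (A \ B) :=
  (measure_mono (by rw [union_sdiff_self]; exact subset_union_right)).trans (measure_union_le _ _)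

lemma image_iterate_addRight_one (n : ℕ) (A : Set ℤ_[p]) :
    (MeasurableEquiv.addRight (1 : ℤ_[p]))^[n] '' A = (fun x => x - (n : ℤ_[p])) ⁻¹' A := by
  have h : (MeasurableEquiv.addRight (1 : ℤ_[p]))^[n] = fun x => x + (n : ℤ_[p]) := by
    induction n with
    | zero => ext1 x; simp
    | succ n ih =>
      ext1 x
      rw [Function.iterate_succ_apply', ih]
      simp [add_assoc]
  rw [h]
  ext x
  constructor
  · rintro ⟨y, hy, rfl⟩
    simpa using hy
  · exact fun hx => ⟨_, hx, by simp⟩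

lemma isAlphaType_addRight_one (hq : 2 ≤ q) (hpq : 2 * q ≤ p) :
    IsAlphaType (digitMeasure p q) (MeasurableEquiv.addRight (1 : ℤ_[p]))
      (1 - (q : ℝ≥0∞)⁻¹) := by
  intro A hA _ hfin
  simp_rw [image_iterate_addRight_one]
  set α := 1 - (q : ℝ≥0∞)⁻¹
  have hα : α ≤ 1 := tsub_le_self
  have hsum (x : ℝ≥0∞) (ε : NNReal) : x + 3 * ((ε / 3 : NNReal) : ℝ≥0∞) = x + ε := by
    congr 1
    exact_mod_cast mul_div_cancel₀ ε (by norm_num : (3 : NNReal) ≠ 0)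
  refine le_antisymm ?_ ?_ <;> refine ENNReal.le_of_forall_pos_le_add fun ε hε _ => ?_ <;>
    obtain ⟨n, s, hs, hAB, hBA⟩ := exists_levels_approx hq (by omega) hA hfin.ne
      (ε := ((ε / 3 : NNReal) : ℝ≥0∞)) (by simpa using hε.ne') <;>
    set B := ⋃ a ∈ s, level p q a n <;> rw [← hsum] <;> set η := ((ε / 3 : NNReal) : ℝ≥0∞)
  · refine limsup_le_of_le (by isBoundedDefault) ?_
    filter_upwards [eventually_ge_atTop (p ^ n)] with k hk
    calc _ ≤ _ := digitMeasure_inter_preimage_sub_le hq (by omega) k A B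
      _ ≤ α * digitMeasure p q B + 2 * η := by
          gcongr
          exact digitMeasure_levels_overlap_le hq hpq hs hk
      _ ≤ α * (digitMeasure p q A + η) + 2 * η := by
          gcongr
          exact (digitMeasure_le_add_diff B A).trans (by gcongr)
      _ ≤ α * digitMeasure p q A + 1 * η + 2 * η := by
          rw [mul_add]
          gcongr
      _ = _ := by ring
  · rw [← tsub_le_iff_right]
    refine le_limsup_of_frequently_le ?_ (by isBoundedDefault)
    refine frequently_atTop.2 fun N => ⟨p ^ max n N, ?_, ?_⟩
    · exact (le_max_right n N).trans (Nat.lt_pow_self hp.out.one_lt).le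
    · rw [tsub_le_iff_right]
      calc _ ≤ α * (digitMeasure p q B + η) := by
            gcongr
            exact (digitMeasure_le_add_diff A B).trans (by gcongr)
        _ ≤ α * digitMeasure p q B + 1 * η := by
            rw [mul_add]
            gcongr
        _ ≤ digitMeasure p q (B ∩ (fun x => x - ((p ^ max n N : ℕ) : ℤ_[p])) ⁻¹' B) + 1 * η := by
            gcongr
            exact le_digitMeasure_levels_overlap hq (by omega) hs (le_max_left n N)
        _ ≤ digitMeasure p q (A ∩ (fun x => x - ((p ^ max n N : ℕ) : ℤ_[p])) ⁻¹' A) + 2 * η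
            + 1 * η := by
            gcongr
            exact (digitMeasure_inter_preimage_sub_le hq (by omega) _ B A).trans (by gcongr)
        _ = _ := by ring

lemma digitMeasure_eq_zero_of_inter_tower {A : Set ℤ_[p]}
    (h : ∀ n, digitMeasure p q (A ∩ tower p q n) = 0) : digitMeasure p q A = 0 := by
  rw [digitMeasure_apply, eventualDigitSet, inter_iUnion]
  refine measure_iUnion_null fun n => ?_
  rw [← h n, digitMeasure_apply, inter_assoc,
    inter_eq_left.2 (show tower p q n ⊆ eventualDigitSet p q from subset_iUnion _ n)]

lemma digitMeasure_singleton (hq : 2 ≤ q) (x : ℤ_[p]) : digitMeasure p q {x} = 0 := by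
  have := Measure.nullSingletonClass_hausdorff ℤ_[p] (logb_pos (p := p) hq)
  exact Measure.absolutelyContinuous_of_le Measure.restrict_le_self (measure_singleton x)

lemma sigmaFinite_digitMeasure (hq : 2 ≤ q) (hpq : q + 1 < p) :
    SigmaFinite (digitMeasure p q) := by
  refine Measure.sigmaFinite_of_countable
    (S := insert (eventualDigitSet p q)ᶜ (range (tower p q)))
    ((countable_range _).insert _) ?_ ?_
  · rintro _ (rfl | ⟨n, rfl⟩)
    · simp [digitMeasure_apply]
    · exact digitMeasure_tower_lt_top hq hpq n
  · rw [sUnion_insert, sUnion_range]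
    exact compl_union_self _

lemma digitMeasure_univ (hq : 2 ≤ q) (hpq : 2 * q ≤ p) : digitMeasure p q univ = ∞ := by
  have hq0 : (q : ℝ≥0∞) ≠ 0 := by exact_mod_cast (by omega : q ≠ 0)
  by_contra hfin
  have h : digitMeasure p q univ + digitMeasure p q univ ≤ digitMeasure p q univ + 0 := by
    calc _ = (2 * q : ℕ) * ((q : ℝ≥0∞)⁻¹ ^ 1 * digitMeasure p q univ) := by
          rw [Nat.cast_mul, pow_one, mul_assoc, ← mul_assoc (q : ℝ≥0∞),
            ENNReal.mul_inv_cancel hq0 (ENNReal.natCast_ne_top q), one_mul, Nat.cast_ofNat, two_mul]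
      _ ≤ p * ((q : ℝ≥0∞)⁻¹ ^ 1 * digitMeasure p q univ) := by gcongr
      _ = digitMeasure p q (⋃ d ∈ Finset.range p, branch d 1 '' univ) := by
          rw [digitMeasure_biUnion_branch hq (by omega) 1 (Finset.range p) (by simp)
            fun _ _ => .univ, Finset.sum_const, Finset.card_range, nsmul_eq_mul]
      _ ≤ _ := by
          rw [add_zero]
          exact measure_mono (subset_univ _)
  exact (digitMeasure_digitSet_pos hq (by omega : q < p)).not_ge
    ((measure_mono (subset_univ _)).trans ((ENNReal.add_le_add_iff_left hfin).1 h))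

lemma isConservative_addRight_one (hq : 2 ≤ q) (hpq : 2 * q ≤ p) :
    IsConservative (digitMeasure p q) (MeasurableEquiv.addRight (1 : ℤ_[p])) := by
  intro A hA hpos
  obtain ⟨N, hN⟩ : ∃ N, digitMeasure p q (A ∩ tower p q N) ≠ 0 := by
    by_contra! h
    exact hpos.ne' (digitMeasure_eq_zero_of_inter_tower h)
  set B := A ∩ tower p q N
  have hB : MeasurableSet B := hA.inter (measurableSet_tower N)
  have hlim := isAlphaType_addRight_one hq hpq B hB (pos_iff_ne_zero.2 hN)
    ((measure_mono inter_subset_right).trans_lt (digitMeasure_tower_lt_top hq (by omega) N))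
  have hα : 0 < (1 - (q : ℝ≥0∞)⁻¹) * digitMeasure p q B :=
    pos_iff_ne_zero.2 (mul_ne_zero (tsub_pos_of_lt (ENNReal.inv_lt_one.2
      (by exact_mod_cast (by omega : 1 < q)))).ne' hN)
  rw [← hlim] at hα
  obtain ⟨n, hn, h⟩ := frequently_atTop.1 (frequently_lt_of_lt_limsup (by isBoundedDefault) hα) 1
  refine ⟨n, hn, ?_⟩
  rw [← ((measurePreserving_addRight_one (by omega)).iterate n).measure_preimage
    (hB.inter ?_).nullMeasurableSet] at h
  · refine h.trans_le (measure_mono ?_)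
    rw [preimage_inter, preimage_image_eq _ ((MeasurableEquiv.injective _).iterate n), inter_comm]
    exact inter_subset_inter inter_subset_left (preimage_mono inter_subset_left)
  · rw [image_iterate_addRight_one]
    exact measurableSet_preimage_sub hB _

lemma natCast_add_mem_iff_of_invariant {A : Set ℤ_[p]}
    (hA : MeasurableEquiv.addRight (1 : ℤ_[p]) ⁻¹' A = A) (a : ℕ) (x : ℤ_[p]) :
    (a : ℤ_[p]) + x ∈ A ↔ x ∈ A := by
  induction a with
  | zero => simp
  | succ a ih =>
    rw [← ih]
    conv_rhs => rw [← hA]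
    simp [add_right_comm]

lemma digitMeasure_digitSet_inter_preimage_branch_of_invariant (hq : 2 ≤ q) (hpq : q + 1 < p)
    {A : Set ℤ_[p]} (hA : MeasurableSet A)
    (hinv : MeasurableEquiv.addRight (1 : ℤ_[p]) ⁻¹' A = A) (a n : ℕ) :
    digitMeasure p q (digitSet p q ∩ branch a n ⁻¹' A) = digitMeasure p q (digitSet p q ∩ A) := by
  have hq0 : (q : ℝ≥0∞) ≠ 0 := by exact_mod_cast (by omega : q ≠ 0)
  have hbranch (b m : ℕ) : branch b m ⁻¹' A = (fun y => (p : ℤ_[p]) ^ m * y) ⁻¹' A :=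
    Set.ext fun y => natCast_add_mem_iff_of_invariant hinv b _
  induction n with
  | zero => simp [hbranch]
  | succ n ih =>
    rw [← ih, digitMeasure_digitSet_inter hq hpq ((continuous_branch a n).measurable hA)]
    have (d : ℕ) : branch d 1 ⁻¹' (branch a n ⁻¹' A) = branch a (n + 1) ⁻¹' A := by
      rw [hbranch a (n + 1), ← hbranch (a + p ^ n * d)]
      ext y
      rw [mem_preimage, mem_preimage, mem_preimage, branch_branch]
    simp_rw [this]
    rw [Finset.sum_const, Nat.card_Icc, Nat.add_sub_cancel, nsmul_eq_mul, ← mul_assoc,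
      ENNReal.mul_inv_cancel hq0 (ENNReal.natCast_ne_top q), one_mul]

lemma digitMeasure_biUnion_level_inter_of_invariant (hq : 2 ≤ q) (hpq : q + 1 < p)
    {A : Set ℤ_[p]} (hA : MeasurableSet A)
    (hinv : MeasurableEquiv.addRight (1 : ℤ_[p]) ⁻¹' A = A) (n : ℕ) (s : Finset ℕ)
    (hs : ∀ a ∈ s, a < p ^ n) :
    digitMeasure p q ((⋃ a ∈ s, level p q a n) ∩ A) =
      s.card * (q : ℝ≥0∞)⁻¹ ^ n * digitMeasure p q (digitSet p q ∩ A) := by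
  simp_rw [iUnion₂_inter, level, ← image_inter_preimage]
  rw [digitMeasure_biUnion_branch hq hpq n s hs fun a _ =>
    measurableSet_digitSet.inter ((continuous_branch a n).measurable hA)]
  simp_rw [digitMeasure_digitSet_inter_preimage_branch_of_invariant hq hpq hA hinv]
  rw [Finset.sum_const, nsmul_eq_mul, mul_assoc]

lemma digitMeasure_eq_zero_of_invariant (hq : 2 ≤ q) (hpq : q + 1 < p)
    {A : Set ℤ_[p]} (hA : MeasurableSet A)
    (hinv : MeasurableEquiv.addRight (1 : ℤ_[p]) ⁻¹' A = A)
    (h : digitMeasure p q (digitSet p q ∩ A) = 0) : digitMeasure p q A = 0 := by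
  refine digitMeasure_eq_zero_of_inter_tower fun n => ?_
  rw [inter_comm, tower, digitMeasure_biUnion_level_inter_of_invariant hq hpq hA hinv n _ (by simp),
    h, mul_zero]

lemma isErgodicT_addRight_one (hq : 2 ≤ q) (hpq : q + 1 < p) :
    IsErgodicT (digitMeasure p q) (MeasurableEquiv.addRight (1 : ℤ_[p])) := by
  intro A hA hinv
  have hinv' : MeasurableEquiv.addRight (1 : ℤ_[p]) ⁻¹' Aᶜ = Aᶜ := by rw [preimage_compl, hinv]
  set c := digitMeasure p q (digitSet p q)
  set c₀ := digitMeasure p q (digitSet p q ∩ A)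
  set c₁ := digitMeasure p q (digitSet p q ∩ Aᶜ)
  have hc : c₀ + c₁ = c := measure_inter_add_sdiff _ hA
  have hc0 : c ≠ 0 := (digitMeasure_digitSet_pos hq (by omega)).ne'
  have hctop : c ≠ ∞ := (digitMeasure_digitSet_lt_top hq).ne
  suffices c₀ * c₁ = 0 from (mul_eq_zero.1 this).imp
    (digitMeasure_eq_zero_of_invariant hq hpq hA hinv)
    (digitMeasure_eq_zero_of_invariant hq hpq hA.compl hinv')
  refine nonpos_iff_eq_zero.1 (ENNReal.le_of_forall_pos_le_add fun δ hδ _ => ?_)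
  obtain ⟨n, s, hs, h₁, h₂⟩ := exists_levels_approx hq hpq (measurableSet_digitSet.inter hA)
    (measure_ne_top_of_subset inter_subset_left hctop) (ε := δ / c)
    (ENNReal.div_ne_zero.2 ⟨by exact_mod_cast hδ.ne', hctop⟩)
  set B := ⋃ a ∈ s, level p q a n
  have hBA := digitMeasure_biUnion_level_inter_of_invariant hq hpq hA hinv n s hs
  have hBA' := digitMeasure_biUnion_level_inter_of_invariant hq hpq hA.compl hinv' n s hs
  have h₀ : c₀ ≤ digitMeasure p q (B ∩ A) + δ / c := by
    refine (digitMeasure_le_add_diff _ (B ∩ A)).trans ?_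
    gcongr
    refine (measure_mono ?_).trans h₁
    exact fun x hx => ⟨hx.1, fun hxB => hx.2 ⟨hxB, hx.1.2⟩⟩
  have h₃ : digitMeasure p q (B ∩ Aᶜ) ≤ δ / c := by
    refine (measure_mono ?_).trans h₂
    exact fun x hx => ⟨hx.1, fun hxA => hx.2 hxA.2⟩
  calc c₀ * c₁ ≤ (digitMeasure p q (B ∩ A) + δ / c) * c₁ := by gcongr
    _ = digitMeasure p q (B ∩ Aᶜ) * c₀ + δ / c * c₁ := by
        rw [hBA, hBA']
        ring
    _ ≤ δ / c * c₀ + δ / c * c₁ := by gcongr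
    _ = 0 + δ := by rw [← mul_add, hc, ENNReal.div_mul_cancel hc0 hctop, zero_add]

lemma not_WDE_addRight_one (hq : 2 ≤ q) (hpq : q + 1 < p) :
    ¬ WDE (digitMeasure p q) (MeasurableEquiv.addRight (1 : ℤ_[p])) := by
  intro h
  have hpos (a : ℕ) : 0 < digitMeasure p q (branch a 1 '' univ) := by
    rw [digitMeasure_image_branch hq hpq]
    exact ENNReal.mul_pos (pow_ne_zero _ (ENNReal.inv_ne_zero.2 (ENNReal.natCast_ne_top q)))
      ((digitMeasure_digitSet_pos hq (by omega)).trans_le (measure_mono (subset_univ _))).ne'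
  have hmeas (a : ℕ) : MeasurableSet (branch (p := p) a 1 '' univ) :=
    (measurableEmbedding_branch a 1).measurableSet_image.2 .univ
  have hmod {a n : ℕ} (hn : 0 < digitMeasure p q (branch a 1 '' univ ∩
      (MeasurableEquiv.addRight (1 : ℤ_[p]))^[n] '' (branch 0 1 '' univ))) :
      (p : ℤ) ∣ n - a := by
    rw [image_iterate_addRight_one] at hn
    obtain ⟨_, ⟨y, -, rfl⟩, z, -, hz⟩ := nonempty_of_measure_ne_zero hn.ne'
    rw [← pow_one (p : ℤ), ← pow_dvd_intCast_iff]
    refine ⟨y - z, ?_⟩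
    simp only [branch] at hz
    push_cast at hz ⊢
    linear_combination hz
  obtain ⟨n, -, h₀, h₁⟩ := h _ _ (hmeas 0) (hmeas 1) (hpos 0) (hpos 1)
  have hdvd := dvd_sub (hmod h₀) (hmod h₁)
  rw [sub_sub_sub_cancel_left, Nat.cast_one, Nat.cast_zero, sub_zero, ← Nat.cast_one,
    Int.natCast_dvd_natCast] at hdvd
  exact hp.out.one_lt.ne' (Nat.dvd_one.1 hdvd)

end PadicInt

/-- For every `q ≥ 2` there is a conservative ergodic invertible measure-preserving
transformation of an infinite nonatomic σ-finite measure space which is of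
`(1 - q⁻¹)`-type but not weak doubly ergodic. -/
theorem exists_oneSubInvQType_not_WDE (q : ℕ) (hq : 2 ≤ q) :
    ∃ (X : Type) (_ : MeasurableSpace X) (μ : Measure X) (_ : SigmaFinite μ) (T : X ≃ᵐ X),
      (∀ x : X, μ {x} = 0) ∧ μ Set.univ = ∞ ∧
      MeasurePreserving T μ μ ∧
      IsConservative μ T ∧
      IsErgodicT μ T ∧
      IsAlphaType μ T (1 - (q : ℝ≥0∞)⁻¹) ∧
      ¬ WDE μ T := by
  obtain ⟨p, hpq, hp⟩ := Nat.exists_infinite_primes (2 * q)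
  have : Fact p.Prime := ⟨hp⟩
  have hpq' : q + 1 < p := by omega
  exact ⟨ℤ_[p], inferInstance, PadicInt.digitMeasure p q,
    PadicInt.sigmaFinite_digitMeasure hq hpq', MeasurableEquiv.addRight 1,
    PadicInt.digitMeasure_singleton hq, PadicInt.digitMeasure_univ hq hpq,
    PadicInt.measurePreserving_addRight_one hpq', PadicInt.isConservative_addRight_one hq hpq,
    PadicInt.isErgodicT_addRight_one hq hpq', PadicInt.isAlphaType_addRight_one hq hpq,
    PadicInt.not_WDE_addRight_one hq hpq'⟩
end

section
/- Let T be an invertible nonsingular ergodic transformation of a σ-finite measure space (X,μ). The following are equivalent: (I) T is weak doubly ergodic; (II) for every pair of measurable sets A, B of positive measure there exists n ∈ ℤ with n ≠ 0 such that μ(A ∩ Tⁿ(A)) > 0 and μ(B ∩ Tⁿ(A)) > 0; (III) for all measurable sets A, B, C, D of positive measure there exists n ∈ ℤ with n ≠ 0 such that μ(A ∩ Tⁿ(B)) > 0 and μ(C ∩ Tⁿ(D)) > 0. -/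
open MeasureTheory Filter Set
open scoped ENNReal

/-- The `n`-th iterate (for `n ∈ ℤ`) of an invertible transformation. -/
def iterZ {X : Type*} (T : X ≃ X) (n : ℤ) : X → X := ⇑(T ^ n)

theorem iterZ_natCast {X : Type*} (T : X ≃ X) (n : ℕ) : iterZ T (n : ℤ) = (⇑T)^[n] := by
  rw [iterZ, zpow_natCast]
  exact (Equiv.Perm.iterate_eq_pow (T : Equiv.Perm X) n).symm

/-- Every iterate of an invertible nonsingular transformation is nonsingular. -/
theorem quasiMeasurePreserving_iterZ {X : Type*} [MeasurableSpace X] {μ : Measure X}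
    {T : X ≃ᵐ X} (hT : Measure.QuasiMeasurePreserving (⇑T) μ μ)
    (hT' : Measure.QuasiMeasurePreserving (⇑T.symm) μ μ) (n : ℤ) :
    Measure.QuasiMeasurePreserving (iterZ T.toEquiv n) μ μ := by
  rcases Int.eq_nat_or_neg n with ⟨m, rfl | rfl⟩
  · rw [iterZ_natCast]
    exact hT.iterate m
  · have h : iterZ T.toEquiv (-(m : ℤ)) = (⇑T.symm)^[m] := by
      rw [iterZ, zpow_neg, zpow_natCast, ← inv_pow]
      exact (Equiv.Perm.iterate_eq_pow ((T.toEquiv : Equiv.Perm X)⁻¹) m).symm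
    rw [h]
    exact hT'.iterate m

section Images

variable {X : Type*} (T : X ≃ X)

theorem iterZ_zero_image (A : Set X) : iterZ T 0 '' A = A := by
  simp [iterZ]

theorem iterZ_image_image (m n : ℤ) (A : Set X) :
    iterZ T m '' (iterZ T n '' A) = iterZ T (m + n) '' A := by
  rw [image_image, iterZ, iterZ, iterZ, zpow_add]
  rfl

theorem iterZ_image_eq_preimage (n : ℤ) (A : Set X) :
    iterZ T n '' A = iterZ T (-n) ⁻¹' A := by
  rw [iterZ, iterZ, zpow_neg]
  exact Equiv.image_eq_preimage_symm (T ^ n) A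

theorem iterZ_image_inter (n : ℤ) (A B : Set X) :
    iterZ T n '' (A ∩ B) = iterZ T n '' A ∩ iterZ T n '' B :=
  image_inter (T ^ n).injective

theorem inter_iterZ_image_inter_subset (A : Set X) (i j : ℤ) :
    (A ∩ iterZ T i '' A) ∩ iterZ T j '' (A ∩ iterZ T i '' A) ⊆ A ∩ iterZ T (j + i) '' A := by
  rw [iterZ_image_inter, iterZ_image_image]
  exact fun x hx ↦ ⟨hx.1.1, hx.2.2⟩

end Images

section Nonsingular

variable {X : Type*} [MeasurableSpace X] {μ : Measure X} {T : X ≃ X}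

theorem measurableSet_iterZ_image (hT : ∀ n, Measure.QuasiMeasurePreserving (iterZ T n) μ μ)
    {A : Set X} (hA : MeasurableSet A) (n : ℤ) : MeasurableSet (iterZ T n '' A) := by
  rw [iterZ_image_eq_preimage]
  exact (hT _).measurable hA

theorem measure_iterZ_image_pos (hT : ∀ n, Measure.QuasiMeasurePreserving (iterZ T n) μ μ)
    {A : Set X} (hA : 0 < μ A) (n : ℤ) : 0 < μ (iterZ T n '' A) := by
  rw [pos_iff_ne_zero] at hA ⊢
  intro h
  apply hA
  have := (hT n).preimage_null h
  rwa [iterZ, preimage_image_eq _ (T ^ n).injective] at this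

theorem measure_iterZ_image_inter_pos
    (hT : ∀ n, Measure.QuasiMeasurePreserving (iterZ T n) μ μ) {A B : Set X} {a b : ℤ}
    (h : 0 < μ (A ∩ iterZ T (b - a) '' B)) : 0 < μ (iterZ T a '' A ∩ iterZ T b '' B) := by
  have := measure_iterZ_image_pos hT h a
  rwa [iterZ_image_inter, iterZ_image_image, add_sub_cancel] at this

theorem measure_inter_iterZ_neg_image_pos
    (hT : ∀ n, Measure.QuasiMeasurePreserving (iterZ T n) μ μ) {A B : Set X} {n : ℤ}
    (h : 0 < μ (A ∩ iterZ T n '' B)) : 0 < μ (B ∩ iterZ T (-n) '' A) := by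
  have := measure_iterZ_image_pos hT h (-n)
  rwa [iterZ_image_inter, iterZ_image_image, neg_add_cancel, iterZ_zero_image,
    inter_comm] at this

/-- Under an ergodic transformation, every set of positive measure contains a set of positive
measure that is carried by some iterate into a prescribed set of positive measure. -/
theorem exists_subset_iterZ_image_subset
    (hT : ∀ n, Measure.QuasiMeasurePreserving (iterZ T n) μ μ)
    (herg : ∀ A : Set X, MeasurableSet A → ⇑T ⁻¹' A = A → μ A = 0 ∨ μ Aᶜ = 0)
    {A B : Set X} (hA : MeasurableSet A) (hB : MeasurableSet B) (hA0 : 0 < μ A)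
    (hB0 : 0 < μ B) :
    ∃ (k : ℤ) (E : Set X), MeasurableSet E ∧ 0 < μ E ∧ E ⊆ A ∧ iterZ T k '' E ⊆ B := by
  suffices h : ∃ k : ℤ, 0 < μ (A ∩ iterZ T k '' B) by
    obtain ⟨k, hk⟩ := h
    refine ⟨-k, _, hA.inter (measurableSet_iterZ_image hT hB k), hk, inter_subset_left, ?_⟩
    rw [iterZ_image_inter, iterZ_image_image, neg_add_cancel, iterZ_zero_image]
    exact inter_subset_right
  by_contra! h
  have hinv : ⇑T ⁻¹' (⋃ k : ℤ, iterZ T k '' B) = ⋃ k : ℤ, iterZ T k '' B := by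
    have hpre : ∀ S : Set X, ⇑T ⁻¹' S = iterZ T (-1) '' S := fun S ↦ by
      rw [iterZ_image_eq_preimage]
      simp [iterZ]
    rw [hpre, image_iUnion]
    simp only [iterZ_image_image]
    exact (Equiv.addLeft (-1 : ℤ)).surjective.iUnion_comp fun k ↦ iterZ T k '' B
  rcases herg _ (.iUnion fun k ↦ measurableSet_iterZ_image hT hB k) hinv with h0 | h0
  · refine hB0.ne' (measure_mono_null ?_ h0)
    exact (iterZ_zero_image T B).symm.subset.trans (subset_iUnion (fun k ↦ iterZ T k '' B) 0)
  · have h1 : μ (A ∩ ⋃ k : ℤ, iterZ T k '' B) = 0 := by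
      rw [inter_iUnion]
      exact measure_iUnion_null fun k ↦ nonpos_iff_eq_zero.1 (h k)
    refine hA0.ne' (measure_mono_null ?_ (measure_union_null h1 h0))
    intro x hx
    by_cases hU : x ∈ ⋃ k : ℤ, iterZ T k '' B
    · exact Or.inl ⟨hx, hU⟩
    · exact Or.inr hU

/-- If every set of positive measure returns to itself, then it does so at arbitrarily large
times. -/
theorem exists_large_return (hT : ∀ n, Measure.QuasiMeasurePreserving (iterZ T n) μ μ)
    (hrec : ∀ A : Set X, MeasurableSet A → 0 < μ A → ∃ n : ℤ, n ≠ 0 ∧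
      0 < μ (A ∩ iterZ T n '' A))
    {A : Set X} (hA : MeasurableSet A) (hA0 : 0 < μ A) (N : ℕ) :
    ∃ j : ℤ, (N : ℤ) < j ∧ 0 < μ (A ∩ iterZ T j '' A) := by
  have hpos : ∀ A : Set X, MeasurableSet A → 0 < μ A →
      ∃ n : ℤ, 0 < n ∧ 0 < μ (A ∩ iterZ T n '' A) := by
    intro A hA hA0
    obtain ⟨n, hn, h⟩ := hrec A hA hA0
    rcases lt_or_gt_of_ne hn with hn | hn
    · exact ⟨-n, by omega, measure_inter_iterZ_neg_image_pos hT h⟩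
    · exact ⟨n, hn, h⟩
  induction N with
  | zero => simpa using hpos A hA hA0
  | succ N ih =>
    obtain ⟨i, hi, h⟩ := ih
    obtain ⟨j, hj, h'⟩ := hpos _ (hA.inter (measurableSet_iterZ_image hT hA i)) h
    exact ⟨j + i, by push_cast; omega,
      h'.trans_le (measure_mono (inter_iterZ_image_inter_subset T A i j))⟩

theorem exists_pos_return_of_exists_ne_zero
    (hT : ∀ n, Measure.QuasiMeasurePreserving (iterZ T n) μ μ)
    (herg : ∀ A : Set X, MeasurableSet A → ⇑T ⁻¹' A = A → μ A = 0 ∨ μ Aᶜ = 0)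
    (h2 : ∀ A B : Set X, MeasurableSet A → MeasurableSet B → 0 < μ A → 0 < μ B →
        ∃ n : ℤ, n ≠ 0 ∧ 0 < μ (A ∩ iterZ T n '' A) ∧ 0 < μ (B ∩ iterZ T n '' A))
    {A B : Set X} (hA : MeasurableSet A) (hB : MeasurableSet B) (hA0 : 0 < μ A)
    (hB0 : 0 < μ B) :
    ∃ n : ℤ, 0 < n ∧ 0 < μ (A ∩ iterZ T n '' A) ∧ 0 < μ (B ∩ iterZ T n '' A) := by
  have hrec : ∀ A : Set X, MeasurableSet A → 0 < μ A → ∃ n : ℤ, n ≠ 0 ∧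
      0 < μ (A ∩ iterZ T n '' A) := fun A hA hA0 ↦ by
    obtain ⟨n, hn, h, -⟩ := h2 A A hA hA hA0 hA0
    exact ⟨n, hn, h⟩
  obtain ⟨k, E, hE, hE0, hk, hEA, hEB⟩ : ∃ (k : ℤ) (E : Set X), MeasurableSet E ∧ 0 < μ E ∧
      0 < k ∧ E ⊆ A ∧ iterZ T k '' E ⊆ B := by
    obtain ⟨k, E, hE, hE0, hEA, hEB⟩ := exists_subset_iterZ_image_subset hT herg hA hB hA0 hB0
    obtain ⟨j, hj, h⟩ := exists_large_return hT hrec hE hE0 k.natAbs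
    refine ⟨k + j, _, hE.inter (measurableSet_iterZ_image hT hE (-j)),
      measure_inter_iterZ_neg_image_pos hT h, by omega, inter_subset_left.trans hEA, ?_⟩
    rw [iterZ_image_inter, iterZ_image_image, add_neg_cancel_right]
    exact inter_subset_right.trans hEB
  obtain ⟨n, hn, h, h'⟩ := h2 E (iterZ T k '' E) hE (measurableSet_iterZ_image hT hE k) hE0
    (measure_iterZ_image_pos hT hE0 k)
  have key : ∀ n : ℤ, 0 < μ (E ∩ iterZ T n '' E) → 0 < μ (iterZ T k '' E ∩ iterZ T n '' E) →
      0 < μ (A ∩ iterZ T n '' A) ∧ 0 < μ (B ∩ iterZ T n '' A) := fun n h h' ↦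
    ⟨h.trans_le (measure_mono (inter_subset_inter hEA (image_mono hEA))),
      h'.trans_le (measure_mono (inter_subset_inter hEB (image_mono hEA)))⟩
  rcases lt_or_gt_of_ne hn with hn | hn
  · have h₁ : 0 < μ (E ∩ iterZ T (n - k) '' E) := by
      have := measure_iterZ_image_inter_pos hT (a := -k) (b := n - k)
        (A := iterZ T k '' E) (B := E) (by rwa [sub_neg_eq_add, sub_add_cancel])
      rwa [iterZ_image_image, neg_add_cancel, iterZ_zero_image] at this
    refine ⟨k - n, by omega, key _ ?_ ?_⟩
    · simpa using measure_inter_iterZ_neg_image_pos hT h₁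
    · refine measure_iterZ_image_inter_pos hT ?_
      rw [sub_sub_cancel_left]
      exact measure_inter_iterZ_neg_image_pos hT h
  · exact ⟨n, hn, key n h h'⟩

theorem exists_ne_zero_four_sets_of_exists_ne_zero
    (hT : ∀ n, Measure.QuasiMeasurePreserving (iterZ T n) μ μ)
    (herg : ∀ A : Set X, MeasurableSet A → ⇑T ⁻¹' A = A → μ A = 0 ∨ μ Aᶜ = 0)
    (h2 : ∀ A B : Set X, MeasurableSet A → MeasurableSet B → 0 < μ A → 0 < μ B →
        ∃ n : ℤ, n ≠ 0 ∧ 0 < μ (A ∩ iterZ T n '' A) ∧ 0 < μ (B ∩ iterZ T n '' A))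
    {A B C D : Set X} (hA : MeasurableSet A) (hB : MeasurableSet B) (hC : MeasurableSet C)
    (hD : MeasurableSet D) (hA0 : 0 < μ A) (hB0 : 0 < μ B) (hC0 : 0 < μ C) (hD0 : 0 < μ D) :
    ∃ n : ℤ, n ≠ 0 ∧ 0 < μ (A ∩ iterZ T n '' B) ∧ 0 < μ (C ∩ iterZ T n '' D) := by
  obtain ⟨b, E₁, hE₁, hE₁0, hEA, hEB⟩ :=
    exists_subset_iterZ_image_subset hT herg hA hB hA0 hB0
  obtain ⟨c, E₂, hE₂, hE₂0, hE₂₁, hEC⟩ :=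
    exists_subset_iterZ_image_subset hT herg hE₁ hC hE₁0 hC0
  obtain ⟨d, E, hE, hE0, hE₃₂, hED⟩ :=
    exists_subset_iterZ_image_subset hT herg hE₂ hD hE₂0 hD0
  replace hEC := (image_mono hE₃₂).trans hEC
  replace hEB := (image_mono (hE₃₂.trans hE₂₁)).trans hEB
  replace hEA := (hE₃₂.trans hE₂₁).trans hEA
  have hrec : ∀ A : Set X, MeasurableSet A → 0 < μ A → ∃ n : ℤ, n ≠ 0 ∧
      0 < μ (A ∩ iterZ T n '' A) := fun A hA hA0 ↦ by
    obtain ⟨n, hn, h, -⟩ := h2 A A hA hA hA0 hA0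
    exact ⟨n, hn, h⟩
  obtain ⟨j, hj, hFj⟩ := exists_large_return hT hrec hE hE0 b.natAbs
  set F := E ∩ iterZ T j '' E
  have hF : MeasurableSet F := hE.inter (measurableSet_iterZ_image hT hE j)
  -- Returns of `F` at time `i` give returns of `E` at time `i + j`.
  obtain ⟨m, hm, h, h'⟩ := exists_pos_return_of_exists_ne_zero hT herg h2 hF
    (measurableSet_iterZ_image hT hF (b + c - d)) hFj (measure_iterZ_image_pos hT hFj _)
  have h₁ : 0 < μ (E ∩ iterZ T (m + j) '' E) :=
    h.trans_le (measure_mono (inter_iterZ_image_inter_subset T E j m))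
  have h₂ : 0 < μ (E ∩ iterZ T (m - (b + c - d) + j) '' E) := by
    have := measure_iterZ_image_inter_pos hT (a := -(b + c - d)) (b := m - (b + c - d))
      (A := iterZ T (b + c - d) '' F) (B := F) (by rwa [sub_neg_eq_add, sub_add_cancel])
    rw [iterZ_image_image, neg_add_cancel, iterZ_zero_image] at this
    exact this.trans_le (measure_mono (inter_iterZ_image_inter_subset T E j _))
  refine ⟨m + j - b, by omega, ?_, ?_⟩
  · refine h₁.trans_le (measure_mono (inter_subset_inter hEA ?_))
    refine subset_trans ?_ (image_mono hEB)
    rw [iterZ_image_image, sub_add_cancel]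
  · have h₃ : 0 < μ (iterZ T c '' E ∩ iterZ T (m + j - b + d) '' E) := by
      refine measure_iterZ_image_inter_pos hT ?_
      rwa [show m + j - b + d - c = m - (b + c - d) + j by ring]
    refine h₃.trans_le (measure_mono (inter_subset_inter hEC ?_))
    refine subset_trans ?_ (image_mono hED)
    rw [iterZ_image_image]

end Nonsingular

/-- For an invertible nonsingular ergodic transformation `T`, the following are
equivalent: (I) `T` is weak doubly ergodic; (II) for all positive measure sets `A`, `B`
there is `n ∈ ℤ`, `n ≠ 0`, with `μ(A ∩ Tⁿ(A)) > 0` and `μ(B ∩ Tⁿ(A)) > 0`; (III) for all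
positive measure sets `A`, `B`, `C`, `D` there is `n ∈ ℤ`, `n ≠ 0`, with
`μ(A ∩ Tⁿ(B)) > 0` and `μ(C ∩ Tⁿ(D)) > 0`. -/
theorem wde_iff_zpow_iff_four_sets {X : Type*} [MeasurableSpace X] (μ : Measure X)
    [SigmaFinite μ] (T : X ≃ᵐ X)
    (hns : Measure.QuasiMeasurePreserving (⇑T) μ μ)
    (hns' : Measure.QuasiMeasurePreserving (⇑T.symm) μ μ)
    (herg : ∀ A : Set X, MeasurableSet A → ⇑T ⁻¹' A = A → μ A = 0 ∨ μ Aᶜ = 0) :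
    (WDE μ T ↔
      (∀ A B : Set X, MeasurableSet A → MeasurableSet B → 0 < μ A → 0 < μ B →
        ∃ n : ℤ, n ≠ 0 ∧ 0 < μ (A ∩ iterZ T.toEquiv n '' A) ∧
          0 < μ (B ∩ iterZ T.toEquiv n '' A))) ∧
    ((∀ A B : Set X, MeasurableSet A → MeasurableSet B → 0 < μ A → 0 < μ B →
        ∃ n : ℤ, n ≠ 0 ∧ 0 < μ (A ∩ iterZ T.toEquiv n '' A) ∧
          0 < μ (B ∩ iterZ T.toEquiv n '' A)) ↔
      (∀ A B C D : Set X, MeasurableSet A → MeasurableSet B → MeasurableSet C →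
        MeasurableSet D → 0 < μ A → 0 < μ B → 0 < μ C → 0 < μ D →
        ∃ n : ℤ, n ≠ 0 ∧ 0 < μ (A ∩ iterZ T.toEquiv n '' B) ∧
          0 < μ (C ∩ iterZ T.toEquiv n '' D))) := by
  have hT := quasiMeasurePreserving_iterZ hns hns'
  refine ⟨⟨fun h A B hA hB hA0 hB0 ↦ ?_, fun h A B hA hB hA0 hB0 ↦ ?_⟩,
    fun h A B C D hA hB hC hD hA0 hB0 hC0 hD0 ↦
      exists_ne_zero_four_sets_of_exists_ne_zero hT herg h hA hB hC hD hA0 hB0 hC0 hD0,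
    fun h A B hA hB hA0 hB0 ↦ h A A B A hA hA hB hA hA0 hA0 hB0 hA0⟩
  · obtain ⟨n, hn, h⟩ := h A B hA hB hA0 hB0
    refine ⟨n, by omega, ?_⟩
    rwa [iterZ_natCast]
  · obtain ⟨n, hn, h⟩ := exists_pos_return_of_exists_ne_zero hT herg h hA hB hA0 hB0
    lift n to ℕ using hn.le
    rw [iterZ_natCast] at h
    exact ⟨n, by omega, h⟩
end
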